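/- Let θ ∈ (0,1] and let u be a C^{2,1} function on B_4 × [0, 1/R^2] satisfying |Δu + ∂_t u| ≤ R^2|u| + R|∇u|, ‖u‖_{L^∞(B_4 × [0,1/R^2])} ≤ 1, ‖∇u‖_{L^∞(B_4 × [0,1/R^2])} ≤ R, and ‖u(·,0)‖_{L^2(B_1)} ≥ θ R^{-n/2}. Then there is a constant N = N(n,θ), depending only on the dimension n and on θ, such that the doubling inequality ∫_{B_{2r}} u(x,0)^2 dx ≤ e^{N R^2} ∫_{B_r} u(x,0)^2 dx holds whenever 0 < r ≤ 1/2 and R ≥ N. -/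

import Mathlib

open MeasureTheory Real Set Metric

/-- The spatial Laplacian of `f : ℝⁿ → ℝ`. -/
noncomputable def slap {n : ℕ} (f : EuclideanSpace ℝ (Fin n) → ℝ)
    (x : EuclideanSpace ℝ (Fin n)) : ℝ :=
  ∑ i : Fin n, fderiv ℝ (fun y => fderiv ℝ f y (EuclideanSpace.single i 1)) x
    (EuclideanSpace.single i 1)

/-- The `i`-th partial derivative of a function on `ℝⁿ`. -/
noncomputable def pd {n : ℕ} (i : Fin n) (f : EuclideanSpace ℝ (Fin n) → ℝ)
    (x : EuclideanSpace ℝ (Fin n)) : ℝ :=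
  fderiv ℝ f x (EuclideanSpace.single i 1)

section Partial

variable {n : ℕ} {f g : EuclideanSpace ℝ (Fin n) → ℝ} {x : EuclideanSpace ℝ (Fin n)}

theorem slap_eq_sum_pd (f : EuclideanSpace ℝ (Fin n) → ℝ) (x : EuclideanSpace ℝ (Fin n)) :
    slap f x = ∑ i, pd i (pd i f) x := rfl

theorem pd_add (i : Fin n) (hf : DifferentiableAt ℝ f x) (hg : DifferentiableAt ℝ g x) :
    pd i (fun y => f y + g y) x = pd i f x + pd i g x := by
  simp [pd, fderiv_fun_add hf hg]

theorem pd_sub (i : Fin n) (hf : DifferentiableAt ℝ f x) (hg : DifferentiableAt ℝ g x) :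
    pd i (fun y => f y - g y) x = pd i f x - pd i g x := by
  simp [pd, fderiv_fun_sub hf hg]

theorem pd_mul (i : Fin n) (hf : DifferentiableAt ℝ f x) (hg : DifferentiableAt ℝ g x) :
    pd i (fun y => f y * g y) x = pd i f x * g x + f x * pd i g x := by
  simp [pd, fderiv_fun_mul hf hg]; ring

theorem pd_const_mul (i : Fin n) (c : ℝ) (hf : DifferentiableAt ℝ f x) :
    pd i (fun y => c * f y) x = c * pd i f x := by
  simp [pd, fderiv_const_mul hf]

theorem pd_sum {ι : Type*} (s : Finset ι) (F : ι → EuclideanSpace ℝ (Fin n) → ℝ) (i : Fin n)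
    (hF : ∀ j ∈ s, DifferentiableAt ℝ (F j) x) :
    pd i (fun y => ∑ j ∈ s, F j y) x = ∑ j ∈ s, pd i (F j) x := by
  simp [pd, fderiv_fun_sum hF]

theorem pd_coord (i j : Fin n) : pd i (fun y : EuclideanSpace ℝ (Fin n) => y j) x =
    if i = j then 1 else 0 := by
  have : (fun y : EuclideanSpace ℝ (Fin n) => y j) =
      (EuclideanSpace.proj j : EuclideanSpace ℝ (Fin n) →L[ℝ] ℝ) := rfl
  rw [pd, this, ContinuousLinearMap.fderiv]
  simp [PiLp.single_apply, eq_comm]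

theorem contDiff_pd {m k : WithTop ℕ∞} (i : Fin n) (hf : ContDiff ℝ k f) (hk : m + 1 ≤ k) :
    ContDiff ℝ m (pd i f) :=
  (hf.fderiv_right hk).clm_apply contDiff_const

theorem contDiffAt_pd {m k : WithTop ℕ∞} (i : Fin n) (hf : ContDiffAt ℝ k f x) (hk : m + 1 ≤ k) :
    ContDiffAt ℝ m (pd i f) x :=
  (hf.fderiv_right hk).clm_apply contDiffAt_const

theorem pd_congr_of_eventuallyEq (i : Fin n) (h : f =ᶠ[nhds x] g) : pd i f x = pd i g x := by
  simp [pd, h.fderiv_eq]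

theorem pd_comm (i j : Fin n) (hf : ContDiffAt ℝ 2 f x) : pd i (pd j f) x = pd j (pd i f) x := by
  have h := hf.isSymmSndFDerivAt (by simp)
  have hd : DifferentiableAt ℝ (fderiv ℝ f) x :=
    (hf.fderiv_right (m := 1) (by norm_num)).differentiableAt (by norm_num)
  have key : ∀ a b : EuclideanSpace ℝ (Fin n),
      fderiv ℝ (fun y => fderiv ℝ f y a) x b = fderiv ℝ (fderiv ℝ f) x b a := by
    intro a b
    rw [fderiv_clm_apply hd (differentiableAt_const a)]
    simp
  show fderiv ℝ (fun y => fderiv ℝ f y _) x _ = fderiv ℝ (fun y => fderiv ℝ f y _) x _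
  rw [key, key]
  exact h.eq _ _

theorem HasCompactSupport.pd (i : Fin n) (hf : HasCompactSupport f) :
    HasCompactSupport (pd i f) :=
  hf.fderiv_apply (𝕜 := ℝ) _

theorem slap_mul (hf : ContDiffAt ℝ 2 f x) (hg : ContDiffAt ℝ 2 g x) :
    slap (fun y => f y * g y) x =
      slap f x * g x + 2 * ∑ i, pd i f x * pd i g x + f x * slap g x := by
  simp only [slap_eq_sum_pd, Finset.sum_mul, Finset.mul_sum, ← Finset.sum_add_distrib]
  refine Finset.sum_congr rfl fun i _ => ?_
  have e : pd i (fun y => f y * g y) =ᶠ[nhds x] fun y => pd i f y * g y + f y * pd i g y := by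
    filter_upwards [hf.eventually (by simp), hg.eventually (by simp)] with y h1 h2
    exact pd_mul i (h1.differentiableAt (by norm_num)) (h2.differentiableAt (by norm_num))
  have df := hf.differentiableAt (by norm_num)
  have dg := hg.differentiableAt (by norm_num)
  have dpf := (contDiffAt_pd (m := 1) i hf (by norm_num)).differentiableAt (by norm_num)
  have dpg := (contDiffAt_pd (m := 1) i hg (by norm_num)).differentiableAt (by norm_num)
  rw [pd_congr_of_eventuallyEq i e, pd_add (f := fun y => pd i f y * g y)
    (g := fun y => f y * pd i g y) i (dpf.mul dg) (df.mul dpg), pd_mul i dpf dg, pd_mul i df dpg]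
  ring

theorem slap_sub (hf : ContDiffAt ℝ 2 f x) (hg : ContDiffAt ℝ 2 g x) :
    slap (fun y => f y - g y) x = slap f x - slap g x := by
  simp only [slap_eq_sum_pd, ← Finset.sum_sub_distrib]
  refine Finset.sum_congr rfl fun i _ => ?_
  have e : pd i (fun y => f y - g y) =ᶠ[nhds x] fun y => pd i f y - pd i g y := by
    filter_upwards [hf.eventually (by simp), hg.eventually (by simp)] with y h1 h2
    exact pd_sub i (h1.differentiableAt (by norm_num)) (h2.differentiableAt (by norm_num))
  rw [pd_congr_of_eventuallyEq i e, pd_sub i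
    ((contDiffAt_pd (m := 1) i hf (by norm_num)).differentiableAt (by norm_num))
    ((contDiffAt_pd (m := 1) i hg (by norm_num)).differentiableAt (by norm_num))]

theorem slap_add (hf : ContDiffAt ℝ 2 f x) (hg : ContDiffAt ℝ 2 g x) :
    slap (fun y => f y + g y) x = slap f x + slap g x := by
  simp only [slap_eq_sum_pd, ← Finset.sum_add_distrib]
  refine Finset.sum_congr rfl fun i _ => ?_
  have e : pd i (fun y => f y + g y) =ᶠ[nhds x] fun y => pd i f y + pd i g y := by
    filter_upwards [hf.eventually (by simp), hg.eventually (by simp)] with y h1 h2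
    exact pd_add i (h1.differentiableAt (by norm_num)) (h2.differentiableAt (by norm_num))
  rw [pd_congr_of_eventuallyEq i e, pd_add i
    ((contDiffAt_pd (m := 1) i hf (by norm_num)).differentiableAt (by norm_num))
    ((contDiffAt_pd (m := 1) i hg (by norm_num)).differentiableAt (by norm_num))]

theorem slap_const_mul (c : ℝ) (hf : ContDiffAt ℝ 2 f x) :
    slap (fun y => c * f y) x = c * slap f x := by
  simp only [slap_eq_sum_pd, Finset.mul_sum]
  refine Finset.sum_congr rfl fun i _ => ?_
  have e : pd i (fun y => c * f y) =ᶠ[nhds x] fun y => c * pd i f y := by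
    filter_upwards [hf.eventually (by simp)] with y h1
    exact pd_const_mul i c (h1.differentiableAt (by norm_num))
  rw [pd_congr_of_eventuallyEq i e, pd_const_mul i c
    ((contDiffAt_pd (m := 1) i hf (by norm_num)).differentiableAt (by norm_num))]

theorem norm_gradient_sq (f : EuclideanSpace ℝ (Fin n) → ℝ) (x : EuclideanSpace ℝ (Fin n)) :
    ‖gradient f x‖ ^ 2 = ∑ i, pd i f x ^ 2 := by
  rw [EuclideanSpace.norm_sq_eq]
  refine Finset.sum_congr rfl fun i _ => ?_
  have : gradient f x i = pd i f x := by
    have h : inner ℝ (gradient f x) (EuclideanSpace.single i (1:ℝ)) = pd i f x := by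
      simp [gradient, pd]
    rw [← h, EuclideanSpace.inner_single_right]; simp
  rw [this, Real.norm_eq_abs, sq_abs]

theorem norm_gradient_eq (f : EuclideanSpace ℝ (Fin n) → ℝ) (x : EuclideanSpace ℝ (Fin n)) :
    ‖gradient f x‖ = √(∑ i, pd i f x ^ 2) := by
  rw [← norm_gradient_sq, Real.sqrt_sq (norm_nonneg _)]

theorem integral_pd_eq_zero (i : Fin n) (hf : ContDiff ℝ 1 f) (hc : HasCompactSupport f) :
    ∫ x, pd i f x = 0 := by
  have h := integral_mul_fderiv_eq_neg_fderiv_mul_of_integrable (μ := volume)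
    (f := fun _ : EuclideanSpace ℝ (Fin n) => (1 : ℝ)) (g := f)
    (v := EuclideanSpace.single i (1:ℝ)) (by simp)
    (by
      simp only [one_mul]
      exact ((contDiff_pd (m := 0) i hf (by norm_num)).continuous).integrable_of_hasCompactSupport
        (hc.pd i))
    (by
      simp only [one_mul]
      exact hf.continuous.integrable_of_hasCompactSupport hc)
    (by simp) (fun x _ => hf.differentiable (by norm_num) x)
  simpa [pd] using h

end Partial

section Weight

variable {n : ℕ} {f g h : EuclideanSpace ℝ (Fin n) → ℝ} {x : EuclideanSpace ℝ (Fin n)} {s : ℝ}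

/-- The Gaussian weight `exp (-|x|² / (4 s))`. -/
noncomputable def gw (s : ℝ) (x : EuclideanSpace ℝ (Fin n)) : ℝ :=
  Real.exp (-‖x‖ ^ 2 / (4 * s))

theorem gw_pos (s : ℝ) (x : EuclideanSpace ℝ (Fin n)) : 0 < gw s x := Real.exp_pos _

theorem contDiff_gw {k : WithTop ℕ∞} (s : ℝ) :
    ContDiff ℝ k (gw s : EuclideanSpace ℝ (Fin n) → ℝ) :=
  (((contDiff_norm_sq ℝ).neg).div_const _).exp

theorem continuous_gw (s : ℝ) : Continuous (gw s : EuclideanSpace ℝ (Fin n) → ℝ) :=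
  (contDiff_gw (k := 0) s).continuous

theorem pd_gw (i : Fin n) (s : ℝ) (x : EuclideanSpace ℝ (Fin n)) :
    pd i (gw s) x = -(x i / (2 * s)) * gw s x := by
  have h1 : HasFDerivAt (fun y : EuclideanSpace ℝ (Fin n) => ‖y‖ ^ 2) (2 • (innerSL ℝ x)) x :=
    (hasStrictFDerivAt_norm_sq x).hasFDerivAt
  have h2 := ((h1.neg.mul_const ((4 * s)⁻¹)).exp)
  have e : (gw s : EuclideanSpace ℝ (Fin n) → ℝ) =
      fun y => Real.exp (-‖y‖ ^ 2 * (4 * s)⁻¹) := by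
    funext y; rw [gw, div_eq_mul_inv]
  rw [pd, e]
  erw [h2.fderiv]
  simp [EuclideanSpace.inner_single_right]
  ring

theorem pd_eq_zero (i : Fin n) (hx : x ∉ tsupport f) : pd i f x = 0 := by
  simp [pd, fderiv_of_notMem_tsupport (𝕜 := ℝ) hx]

theorem tsupport_pd_subset (i : Fin n) : tsupport (pd i f) ⊆ tsupport f :=
  tsupport_fderiv_apply_subset ℝ _

theorem pd_pd_eq_zero (i j : Fin n) (hx : x ∉ tsupport f) : pd i (pd j f) x = 0 :=
  pd_eq_zero i fun hx' => hx (tsupport_pd_subset j hx')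

theorem slap_eq_zero (hx : x ∉ tsupport f) : slap f x = 0 := by
  simp [slap_eq_sum_pd, pd_pd_eq_zero _ _ hx]

theorem integrable_of_tsupport {F : EuclideanSpace ℝ (Fin n) → ℝ} (hc : HasCompactSupport f)
    (hF : Continuous F) (h0 : ∀ x ∉ tsupport f, F x = 0) : Integrable F :=
  hF.integrable_of_hasCompactSupport (HasCompactSupport.intro hc h0)

theorem continuous_slap (hf : ContDiff ℝ 2 f) : Continuous (slap f) := by
  show Continuous fun x => ∑ i, pd i (pd i f) x
  exact continuous_finsetSum _ fun i _ => ((contDiff_pd (m := 0) i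
    (contDiff_pd (m := 1) i hf (by norm_num)) (by norm_num))).continuous

theorem continuous_pd (i : Fin n) (hf : ContDiff ℝ 1 f) : Continuous (pd i f) :=
  (contDiff_pd (m := 0) i hf (by norm_num)).continuous

theorem contDiff_coord {k : WithTop ℕ∞} (i : Fin n) :
    ContDiff ℝ k fun y : EuclideanSpace ℝ (Fin n) => y i :=
  (EuclideanSpace.proj i : EuclideanSpace ℝ (Fin n) →L[ℝ] ℝ).contDiff

/-- The drift Laplacian associated with the weight `gw s`. -/
noncomputable def dlap (s : ℝ) (f : EuclideanSpace ℝ (Fin n) → ℝ)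
    (x : EuclideanSpace ℝ (Fin n)) : ℝ :=
  slap f x - (∑ i, x i * pd i f x) / (2 * s)

theorem continuous_dlap (hf : ContDiff ℝ 2 f) : Continuous (dlap s f) := by
  have h1 := continuous_slap hf
  have h2 := fun i => continuous_pd i (hf.of_le one_le_two)
  unfold dlap
  fun_prop

theorem dlap_eq_zero (hx : x ∉ tsupport f) : dlap s f x = 0 := by
  simp [dlap, slap_eq_zero hx, pd_eq_zero _ hx]

/-- Green's identity for the drift Laplacian. -/
theorem integral_dlap_mul (hf : ContDiff ℝ 2 f) (hc : HasCompactSupport f) (hh : ContDiff ℝ 1 h) :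
    ∫ x, dlap s f x * h x * gw s x = -∫ x, (∑ i, pd i f x * pd i h x) * gw s x := by
  have hpf := fun i => contDiff_pd (m := 1) i hf (by norm_num)
  have cpf := fun i => (hpf i).continuous
  have cph := fun i => continuous_pd i hh
  have cg := continuous_gw (n := n) s
  have ch := hh.continuous
  have cd := continuous_dlap (s := s) hf
  have key : ∀ i, ∫ x, pd i (fun y => pd i f y * (h y * gw s y)) x = 0 := by
    intro i
    refine integral_pd_eq_zero i ((hpf i).mul (hh.mul (contDiff_gw s))) ?_
    exact HasCompactSupport.intro hc fun x hx => by simp [pd_eq_zero i hx]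
  have e : ∀ i x, pd i (fun y => pd i f y * (h y * gw s y)) x =
      pd i (pd i f) x * h x * gw s x + pd i f x * pd i h x * gw s x
        - x i * pd i f x / (2 * s) * h x * gw s x := by
    intro i x
    rw [pd_mul i ((hpf i).differentiable (by norm_num) x)
      ((hh.differentiable (by norm_num) x).fun_mul
        ((contDiff_gw (k := 1) s).differentiable (by norm_num) x)),
      pd_mul i (hh.differentiable (by norm_num) x)
        ((contDiff_gw (k := 1) s).differentiable (by norm_num) x), pd_gw]
    ring
  rw [eq_neg_iff_add_eq_zero, ← integral_add]
  · rw [← Finset.sum_eq_zero (fun i (_ : i ∈ Finset.univ) => key i), ← integral_finsetSum]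
    · congr 1
      funext x
      simp only [e, dlap, slap_eq_sum_pd, Finset.sum_add_distrib, Finset.sum_sub_distrib,
        Finset.sum_div, ← Finset.sum_mul]
      ring
    · intro i _
      refine integrable_of_tsupport hc ?_ fun x hx =>
        by simp [e, pd_eq_zero i hx, pd_pd_eq_zero i i hx]
      exact continuous_pd i ((hpf i).mul (hh.mul (contDiff_gw s)))
  · exact integrable_of_tsupport hc (by fun_prop) fun x hx => by simp [dlap_eq_zero hx]
  · exact integrable_of_tsupport hc (by fun_prop) fun x hx => by simp [pd_eq_zero _ hx]

theorem integral_normSq_mul (hf : ContDiff ℝ 1 f) (hc : HasCompactSupport f) :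
    ∫ x, f x * (‖x‖ ^ 2 / (2 * s)) * gw s x =
      ∫ x, (n * f x + ∑ i, x i * pd i f x) * gw s x := by
  have cf := hf.continuous
  have cpf := fun i => continuous_pd i hf
  have cg := continuous_gw (n := n) s
  have dg := fun x => (contDiff_gw (n := n) (k := 1) s).differentiable (by norm_num) x
  have dc := fun i x => (contDiff_coord (n := n) (k := 1) i).differentiable (by norm_num) x
  have hcd : ∀ i, ContDiff ℝ 1 (fun y : EuclideanSpace ℝ (Fin n) => f y * (y i * gw s y)) :=
    fun i => hf.mul ((contDiff_coord i).mul (contDiff_gw s))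
  have key : ∀ i, ∫ x, pd i (fun y => f y * (y i * gw s y)) x = 0 := by
    intro i
    refine integral_pd_eq_zero i (hcd i) ?_
    exact HasCompactSupport.intro hc fun x hx => by simp [image_eq_zero_of_notMem_tsupport hx]
  have e : ∀ i x, pd i (fun y => f y * (y i * gw s y)) x =
      (f x + x i * pd i f x) * gw s x - f x * (x i ^ 2 / (2 * s)) * gw s x := by
    intro i x
    rw [pd_mul i (hf.differentiable (by norm_num) x) ((dc i x).fun_mul (dg x)),
      pd_mul i (dc i x) (dg x), pd_gw, pd_coord]
    simp only [if_true]
    ring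
  rw [← sub_eq_zero, ← neg_eq_zero, neg_sub, ← integral_sub]
  · rw [← Finset.sum_eq_zero (fun i (_ : i ∈ Finset.univ) => key i), ← integral_finsetSum]
    · congr 1
      funext x
      simp only [e, Finset.sum_add_distrib, Finset.sum_sub_distrib, EuclideanSpace.real_norm_sq_eq,
        ← Finset.sum_mul, Finset.sum_div, ← Finset.mul_sum]
      simp
    · intro i _
      refine integrable_of_tsupport hc (continuous_pd i (hcd i)) fun x hx => by
        simp [e, pd_eq_zero i hx, image_eq_zero_of_notMem_tsupport hx]
  · exact integrable_of_tsupport hc (by fun_prop) fun x hx => by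
      simp [pd_eq_zero _ hx, image_eq_zero_of_notMem_tsupport hx]
  · exact integrable_of_tsupport hc (by fun_prop) fun x hx => by
      simp [image_eq_zero_of_notMem_tsupport hx]

/-- The Rellich-type identity for the Gaussian weight. -/
theorem integral_gradSq_mul_normSq (hs : s ≠ 0) (hf : ContDiff ℝ 3 f) (hc : HasCompactSupport f) :
    ∫ x, (∑ i, pd i f x ^ 2) * (‖x‖ ^ 2 / (4 * s ^ 2)) * gw s x =
      2 * (∫ x, dlap s f x * (-(∑ i, x i * pd i f x) / (2 * s)) * gw s x)
      + (n / (2 * s) - 1 / s) * ∫ x, (∑ i, pd i f x ^ 2) * gw s x := by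
  have hf2 : ContDiff ℝ 2 f := hf.of_le (by norm_num)
  have hpf := fun i => contDiff_pd (m := 2) i hf (by norm_num)
  have cpf := fun i => (hpf i).continuous
  have cppf := fun i j => continuous_pd i ((hpf j).of_le one_le_two)
  have cg := continuous_gw (n := n) s
  have cd := continuous_dlap (s := s) hf2
  have dpf := fun i x => (hpf i).differentiable (by norm_num) x
  have dc := fun i x => (contDiff_coord (n := n) (k := 1) i).differentiable (by norm_num) x
  have hX : ContDiff ℝ 1 (fun x : EuclideanSpace ℝ (Fin n) => ∑ i, x i * pd i f x) :=
    ContDiff.sum fun i _ => (contDiff_coord i).mul ((hpf i).of_le one_le_two)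
  have hw : ContDiff ℝ 1 (fun x : EuclideanSpace ℝ (Fin n) => ∑ i, pd i f x ^ 2) :=
    ContDiff.sum fun i _ => ((hpf i).of_le one_le_two).pow 2
  have hwc : HasCompactSupport (fun x : EuclideanSpace ℝ (Fin n) => ∑ i, pd i f x ^ 2) :=
    HasCompactSupport.intro hc fun x hx => by simp [pd_eq_zero _ hx]
  have e1 : ∀ i x, pd i (fun x : EuclideanSpace ℝ (Fin n) => ∑ j, pd j f x ^ 2) x =
      ∑ j, 2 * pd j f x * pd i (pd j f) x := by
    intro i x
    simp only [pow_two]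
    rw [pd_sum _ _ i fun j _ => (dpf j x).fun_mul (dpf j x)]
    refine Finset.sum_congr rfl fun j _ => ?_
    rw [pd_mul i (dpf j x) (dpf j x)]; ring
  have e2 : ∀ i x, pd i (fun x : EuclideanSpace ℝ (Fin n) => ∑ j, x j * pd j f x) x =
      pd i f x + ∑ j, x j * pd i (pd j f) x := by
    intro i x
    rw [pd_sum _ _ i fun j _ => (dc j x).fun_mul (dpf j x)]
    have : ∀ j ∈ Finset.univ, pd i (fun x : EuclideanSpace ℝ (Fin n) => x j * pd j f x) x =
        (if i = j then pd j f x else 0) + x j * pd i (pd j f) x := by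
      intro j _
      rw [pd_mul i (dc j x) (dpf j x), pd_coord]; split_ifs <;> ring
    rw [Finset.sum_congr rfl this, Finset.sum_add_distrib]
    simp
  have h1 := integral_normSq_mul (s := s) hw hwc
  have h2 := integral_dlap_mul (s := s) hf2 hc hX
  have comm : ∀ x, ∑ i, x i * pd i (fun x : EuclideanSpace ℝ (Fin n) => ∑ j, pd j f x ^ 2) x =
      2 * ∑ i, pd i f x * ∑ j, x j * pd i (pd j f) x := by
    intro x
    simp only [e1, Finset.mul_sum]
    rw [Finset.sum_comm]
    refine Finset.sum_congr rfl fun i _ => Finset.sum_congr rfl fun j _ => ?_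
    rw [pd_comm j i hf2.contDiffAt]; ring
  have L : ∫ x, (∑ i, pd i f x ^ 2) * (‖x‖ ^ 2 / (4 * s ^ 2)) * gw s x =
      (1 / (2 * s)) * ∫ x, (∑ i, pd i f x ^ 2) * (‖x‖ ^ 2 / (2 * s)) * gw s x := by
    rw [← integral_const_mul]; congr 1; funext x; field_simp; ring
  have L2 : ∫ x, dlap s f x * (-(∑ i, x i * pd i f x) / (2 * s)) * gw s x =
      -(1 / (2 * s)) * ∫ x, dlap s f x * (∑ i, x i * pd i f x) * gw s x := by
    rw [← integral_const_mul]; congr 1; funext x; ring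
  have A : ∫ x, (n * (∑ i, pd i f x ^ 2) +
        ∑ i, x i * pd i (fun x : EuclideanSpace ℝ (Fin n) => ∑ j, pd j f x ^ 2) x) * gw s x =
      n * (∫ x, (∑ i, pd i f x ^ 2) * gw s x) +
      2 * ∫ x, (∑ i, pd i f x * ∑ j, x j * pd i (pd j f) x) * gw s x := by
    rw [← integral_const_mul, ← integral_const_mul, ← integral_add]
    · congr 1; funext x; rw [comm]; ring
    · exact integrable_of_tsupport hc (by fun_prop) fun x hx => by simp [pd_eq_zero _ hx]
    · exact integrable_of_tsupport hc (by fun_prop) fun x hx => by simp [pd_eq_zero _ hx]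
  have B : ∫ x, (∑ i, pd i f x *
        pd i (fun x : EuclideanSpace ℝ (Fin n) => ∑ j, x j * pd j f x) x) * gw s x =
      (∫ x, (∑ i, pd i f x ^ 2) * gw s x) +
      ∫ x, (∑ i, pd i f x * ∑ j, x j * pd i (pd j f) x) * gw s x := by
    rw [← integral_add]
    · congr 1; funext x
      simp only [e2, mul_add, Finset.sum_add_distrib, pow_two]
      ring
    · exact integrable_of_tsupport hc (by fun_prop) fun x hx => by simp [pd_eq_zero _ hx]
    · exact integrable_of_tsupport hc (by fun_prop) fun x hx => by simp [pd_eq_zero _ hx]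
  rw [L, h1, A, L2, h2, B]
  field_simp
  ring

end Weight

section TimeDerivative

variable {n : ℕ}

theorem hasDerivAt_integral_of_support {F F' : EuclideanSpace ℝ (Fin n) → ℝ → ℝ} {c t₀ ρ : ℝ}
    (ht₀ : c < t₀) (hF : ∀ t, c < t → Continuous fun x => F x t)
    (hd : ∀ x t, c < t → HasDerivAt (F x) (F' x t) t)
    (hF' : ContinuousOn (fun p : EuclideanSpace ℝ (Fin n) × ℝ => F' p.1 p.2) (univ ×ˢ Ioi c))
    (h0 : ∀ x t, ρ < ‖x‖ → F x t = 0) :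
    HasDerivAt (fun t => ∫ x, F x t) (∫ x, F' x t₀) t₀ := by
  have h0' : ∀ x t, c < t → ρ < ‖x‖ → F' x t = 0 := by
    intro x t ht hx
    have : F x = fun _ => 0 := funext fun t => h0 x t hx
    have h1 := hd x t ht
    rw [this] at h1
    exact h1.unique (hasDerivAt_const t 0)
  obtain ⟨δ, hδ, hδc⟩ : ∃ δ > 0, c < t₀ - δ := ⟨(t₀ - c) / 2, by linarith, by linarith⟩
  have hcomp : IsCompact (closedBall (0 : EuclideanSpace ℝ (Fin n)) ρ ×ˢ Icc (t₀ - δ) (t₀ + δ)) :=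
    (isCompact_closedBall _ _).prod isCompact_Icc
  obtain ⟨C, hC⟩ := hcomp.exists_bound_of_continuousOn (hF'.mono (by
    rintro ⟨x, t⟩ ⟨_, ht⟩
    exact ⟨mem_univ _, lt_of_lt_of_le hδc ht.1⟩))
  have hslice : ∀ t, c < t → Continuous fun x => F' x t := by
    intro t ht
    have := hF'.comp (f := fun x : EuclideanSpace ℝ (Fin n) => (x, t)) (s := univ)
      (by fun_prop) (fun x _ => ⟨mem_univ _, ht⟩)
    exact continuousOn_univ.mp this
  have hcs : ∀ t, HasCompactSupport fun x => F x t := fun t =>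
    HasCompactSupport.intro (isCompact_closedBall 0 ρ) fun x hx => h0 x t (by simpa using hx)
  refine (hasDerivAt_integral_of_dominated_loc_of_deriv_le (μ := volume)
    (F := fun t x => F x t) (F' := fun t x => F' x t) (s := Icc (t₀ - δ) (t₀ + δ))
    (bound := (closedBall (0 : EuclideanSpace ℝ (Fin n)) ρ).indicator fun _ => C)
    (Icc_mem_nhds (by linarith) (by linarith)) ?_ ?_ ?_ ?_ ?_ ?_).2
  · filter_upwards [lt_mem_nhds ht₀] with t ht
    exact (hF t ht).aestronglyMeasurable
  · exact (hF t₀ ht₀).integrable_of_hasCompactSupport (hcs t₀)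
  · exact (hslice t₀ ht₀).aestronglyMeasurable
  · refine Filter.Eventually.of_forall fun x t ht => ?_
    by_cases hx : x ∈ closedBall (0 : EuclideanSpace ℝ (Fin n)) ρ
    · rw [indicator_of_mem hx]; exact hC (x, t) ⟨hx, ht⟩
    · rw [indicator_of_notMem hx, h0' x t (lt_of_lt_of_le hδc ht.1) (by simpa using hx)]; simp
  · exact (integrable_indicator_iff measurableSet_closedBall).2
      (integrableOn_const measure_closedBall_lt_top.ne)
  · exact Filter.Eventually.of_forall fun x t ht => hd x t (lt_of_lt_of_le hδc ht.1)

variable {V : EuclideanSpace ℝ (Fin n) → ℝ → ℝ}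

theorem hasFDerivAt_slice {F : EuclideanSpace ℝ (Fin n) → ℝ → ℝ}
    (hF : ContDiff ℝ 1 fun p : EuclideanSpace ℝ (Fin n) × ℝ => F p.1 p.2)
    (x : EuclideanSpace ℝ (Fin n)) (t : ℝ) (i : Fin n) :
    pd i (fun y => F y t) x = fderiv ℝ (fun p : EuclideanSpace ℝ (Fin n) × ℝ => F p.1 p.2) (x, t)
      (EuclideanSpace.single i 1, 0) := by
  have h1 := (hF.differentiable (by norm_num) (x, t)).hasFDerivAt
  have h2 : HasFDerivAt (fun y : EuclideanSpace ℝ (Fin n) => (y, t))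
    (ContinuousLinearMap.inl ℝ _ ℝ) x := hasFDerivAt_prodMk_left x t
  have h3 := h1.comp x h2
  rw [pd]
  erw [h3.fderiv]
  simp

theorem deriv_slice {F : EuclideanSpace ℝ (Fin n) → ℝ → ℝ}
    (hF : ContDiff ℝ 1 fun p : EuclideanSpace ℝ (Fin n) × ℝ => F p.1 p.2)
    (x : EuclideanSpace ℝ (Fin n)) (t : ℝ) :
    deriv (F x) t = fderiv ℝ (fun p : EuclideanSpace ℝ (Fin n) × ℝ => F p.1 p.2) (x, t) (0, 1) := by
  have h1 := (hF.differentiable (by norm_num) (x, t)).hasFDerivAt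
  have h2 : HasFDerivAt (fun s : ℝ => (x, s)) (ContinuousLinearMap.inr ℝ _ ℝ) t :=
    hasFDerivAt_prodMk_right x t
  have h3 := (h1.comp t h2).hasDerivAt
  have := h3.deriv
  simpa [Function.comp_def] using this

theorem contDiff_pd_slice {k m : WithTop ℕ∞} (hm : m + 1 ≤ k) {F : EuclideanSpace ℝ (Fin n) → ℝ → ℝ}
    (hF : ContDiff ℝ k fun p : EuclideanSpace ℝ (Fin n) × ℝ => F p.1 p.2) (i : Fin n) :
    ContDiff ℝ m fun p : EuclideanSpace ℝ (Fin n) × ℝ => pd i (fun y => F y p.2) p.1 := by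
  have hF1 : ContDiff ℝ 1 fun p : EuclideanSpace ℝ (Fin n) × ℝ => F p.1 p.2 :=
    hF.of_le (le_trans (by simp) hm)
  simp only [hasFDerivAt_slice hF1]
  exact (hF.fderiv_right hm).clm_apply contDiff_const

theorem contDiff_deriv_slice {k m : WithTop ℕ∞} (hm : m + 1 ≤ k)
    {F : EuclideanSpace ℝ (Fin n) → ℝ → ℝ}
    (hF : ContDiff ℝ k fun p : EuclideanSpace ℝ (Fin n) × ℝ => F p.1 p.2) :
    ContDiff ℝ m fun p : EuclideanSpace ℝ (Fin n) × ℝ => deriv (F p.1) p.2 := by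
  have hF1 : ContDiff ℝ 1 fun p : EuclideanSpace ℝ (Fin n) × ℝ => F p.1 p.2 :=
    hF.of_le (le_trans (by simp) hm)
  simp only [deriv_slice hF1]
  exact (hF.fderiv_right hm).clm_apply contDiff_const

theorem deriv_pd_slice {F : EuclideanSpace ℝ (Fin n) → ℝ → ℝ}
    (hF : ContDiff ℝ 2 fun p : EuclideanSpace ℝ (Fin n) × ℝ => F p.1 p.2) (i : Fin n)
    (x : EuclideanSpace ℝ (Fin n)) (t : ℝ) :
    deriv (fun t => pd i (fun y => F y t) x) t = pd i (fun y => deriv (F y) t) x := by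
  have hF1 : ContDiff ℝ 1 fun p : EuclideanSpace ℝ (Fin n) × ℝ => F p.1 p.2 := hF.of_le one_le_two
  rw [deriv_slice (F := fun x t => pd i (fun y => F y t) x)
      (contDiff_pd_slice (m := 1) (by norm_num) hF i),
    hasFDerivAt_slice (F := fun y t => deriv (F y) t)
      (contDiff_deriv_slice (m := 1) (by norm_num) hF)]
  simp only [hasFDerivAt_slice hF1, deriv_slice hF1]
  have hd : DifferentiableAt ℝ (fderiv ℝ fun p : EuclideanSpace ℝ (Fin n) × ℝ => F p.1 p.2)
      (x, t) := (hF.fderiv_right (m := 1) (by norm_num)).differentiable (by norm_num) _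
  have key : ∀ a b : EuclideanSpace ℝ (Fin n) × ℝ,
      fderiv ℝ (fun p => fderiv ℝ (fun p : EuclideanSpace ℝ (Fin n) × ℝ => F p.1 p.2) p a) (x, t) b
      = fderiv ℝ (fderiv ℝ fun p : EuclideanSpace ℝ (Fin n) × ℝ => F p.1 p.2) (x, t) b a := by
    intro a b
    rw [fderiv_clm_apply hd (differentiableAt_const a)]
    simp
  have h := (hF.contDiffAt (x := (x, t))).isSymmSndFDerivAt (by simp)
  exact (key _ _).trans ((h.eq _ _).trans (key _ _).symm)

theorem ContDiff.slice_left {k : WithTop ℕ∞} {F : EuclideanSpace ℝ (Fin n) → ℝ → ℝ}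
    (hF : ContDiff ℝ k fun p : EuclideanSpace ℝ (Fin n) × ℝ => F p.1 p.2) (t : ℝ) :
    ContDiff ℝ k fun x => F x t :=
  hF.comp (contDiff_id.prodMk contDiff_const)

theorem ContDiff.slice_right {k : WithTop ℕ∞} {F : EuclideanSpace ℝ (Fin n) → ℝ → ℝ}
    (hF : ContDiff ℝ k fun p : EuclideanSpace ℝ (Fin n) × ℝ => F p.1 p.2)
    (x : EuclideanSpace ℝ (Fin n)) : ContDiff ℝ k (F x) :=
  hF.comp (contDiff_const.prodMk contDiff_id)

theorem hasDerivAt_gw (x : EuclideanSpace ℝ (Fin n)) {a t : ℝ} (h : 0 < t + a) :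
    HasDerivAt (fun t => gw (t + a) x) (‖x‖ ^ 2 / (4 * (t + a) ^ 2) * gw (t + a) x) t := by
  have h1 : HasDerivAt (fun t : ℝ => 4 * (t + a)) (4 * 1) t :=
    ((hasDerivAt_id t).add_const a).const_mul 4
  have h2 := ((hasDerivAt_const t (-‖x‖ ^ 2)).div h1 (by positivity)).exp
  refine h2.congr_deriv ?_
  simp only [gw, Pi.div_apply]
  field_simp
  ring

end TimeDerivative

section Frequency

variable {n : ℕ} {V : EuclideanSpace ℝ (Fin n) → ℝ → ℝ} {a t ρ : ℝ}

/-- The weighted `L²` energy. -/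
noncomputable def enH (a : ℝ) (V : EuclideanSpace ℝ (Fin n) → ℝ → ℝ) (t : ℝ) : ℝ :=
  ∫ x, V x t ^ 2 * gw (t + a) x

/-- The weighted Dirichlet energy. -/
noncomputable def enD (a : ℝ) (V : EuclideanSpace ℝ (Fin n) → ℝ → ℝ) (t : ℝ) : ℝ :=
  ∫ x, (∑ i, pd i (fun y => V y t) x ^ 2) * gw (t + a) x

/-- The backward heat operator applied to `V`. -/
noncomputable def src (V : EuclideanSpace ℝ (Fin n) → ℝ → ℝ) (t : ℝ)
    (x : EuclideanSpace ℝ (Fin n)) : ℝ :=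
  slap (fun y => V y t) x + deriv (V x) t

theorem dlap_eq_src_sub (s : ℝ) (x : EuclideanSpace ℝ (Fin n)) :
    deriv (V x) t = src V t x - dlap s (fun y => V y t) x
      - (∑ i, x i * pd i (fun y => V y t) x) / (2 * s) := by
  simp only [src, dlap]; ring

theorem hasCompactSupport_slice (h0 : ∀ x t, ρ < ‖x‖ → V x t = 0) (t : ℝ) :
    HasCompactSupport fun x => V x t :=
  HasCompactSupport.intro (isCompact_closedBall 0 ρ) fun x hx => h0 x t (by simpa using hx)

theorem tsupport_slice_subset (h0 : ∀ x t, ρ < ‖x‖ → V x t = 0) (t : ℝ) :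
    tsupport (fun x => V x t) ⊆ closedBall 0 ρ :=
  closure_minimal (fun x hx => by
    by_contra hx'
    exact hx (h0 x t (by simpa using hx'))) isClosed_closedBall

theorem continuous_src (hV : ContDiff ℝ 3 fun p : EuclideanSpace ℝ (Fin n) × ℝ => V p.1 p.2)
    (t : ℝ) : Continuous (src V t) :=
  (continuous_slap ((hV.slice_left t).of_le (by norm_num))).add
    ((contDiff_deriv_slice (m := 2) (by norm_num) hV).continuous.comp
      (continuous_id.prodMk continuous_const))

theorem deriv_eq_zero_of_norm (h0 : ∀ x t, ρ < ‖x‖ → V x t = 0) (t : ℝ)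
    {x : EuclideanSpace ℝ (Fin n)} (hx : ρ < ‖x‖) : deriv (V x) t = 0 := by
  have : V x = fun _ => 0 := funext fun t => h0 x t hx
  rw [this]; simp

theorem hasDerivAt_enH (hV : ContDiff ℝ 3 fun p : EuclideanSpace ℝ (Fin n) × ℝ => V p.1 p.2)
    (h0 : ∀ x t, ρ < ‖x‖ → V x t = 0) (hs : 0 < t + a) :
    HasDerivAt (enH a V) (2 * enD a V t + 2 * (∫ x, V x t * src V t x * gw (t + a) x)
      + n / (2 * (t + a)) * enH a V t) t := by
  have hc := hasCompactSupport_slice h0 t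
  have hVt := hV.slice_left t
  have hVt2 : ContDiff ℝ 2 fun x => V x t := hVt.of_le (by norm_num)
  have hVt1 : ContDiff ℝ 1 fun x => V x t := hVt.of_le (by norm_num)
  have hcV := hV.continuous
  have hcdV := (contDiff_deriv_slice (m := 2) (by norm_num) hV).continuous
  have hder : HasDerivAt (enH a V) (∫ x, (2 * V x t * deriv (V x) t
      + V x t ^ 2 * (‖x‖ ^ 2 / (4 * (t + a) ^ 2))) * gw (t + a) x) t := by
    refine hasDerivAt_integral_of_support (F := fun x t => V x t ^ 2 * gw (t + a) x)
      (F' := fun x t => (2 * V x t * deriv (V x) t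
      + V x t ^ 2 * (‖x‖ ^ 2 / (4 * (t + a) ^ 2))) * gw (t + a) x) (c := -a) (ρ := ρ)
      (by linarith) ?_ ?_ ?_ ?_
    · intro t _
      exact ((hV.slice_left t).continuous.pow 2).mul (continuous_gw _)
    · intro x t ht
      have h1 := ((hV.slice_right x).differentiable (by norm_num) t).hasDerivAt
      refine ((h1.pow 2).mul (hasDerivAt_gw x (by linarith))).congr_deriv ?_
      simp; ring
    · have : ContinuousOn (fun p : EuclideanSpace ℝ (Fin n) × ℝ => p.2 + a) (univ ×ˢ Ioi (-a)) := by
        fun_prop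
      have hne : ∀ p ∈ (univ : Set (EuclideanSpace ℝ (Fin n))) ×ˢ Ioi (-a), p.2 + a ≠ 0 := by
        rintro p ⟨_, hp⟩
        have : -a < p.2 := hp
        linarith
      unfold gw
      refine ContinuousOn.mul (ContinuousOn.add (by fun_prop) (ContinuousOn.mul (by fun_prop)
        (ContinuousOn.div (by fun_prop) (by fun_prop) fun p hp => ?_)))
        (ContinuousOn.rexp (ContinuousOn.div (by fun_prop) (by fun_prop) fun p hp => ?_))
      · have := hne p hp; positivity
      · have := hne p hp; positivity
    · intro x t hx; simp [h0 x t hx]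
  refine hder.congr_deriv ?_
  have cd := continuous_dlap (s := t + a) hVt2
  have cV := hVt.continuous
  have cp := fun i => continuous_pd i hVt1
  have cs := continuous_src hV t
  have cg := continuous_gw (n := n) (t + a)
  have hz : ∀ x ∉ tsupport (fun x => V x t), V x t = 0 := fun x hx =>
    image_eq_zero_of_notMem_tsupport (f := fun x => V x t) hx
  have e1 := integral_dlap_mul (s := t + a) hVt2 hc hVt1
  have e2 := integral_normSq_mul (s := t + a) (f := fun x => V x t ^ 2) (hVt1.pow 2)
    (HasCompactSupport.intro hc fun x hx => by simp [hz x hx])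
  have hD : enD a V t = -∫ x, dlap (t + a) (fun y => V y t) x * V x t * gw (t + a) x := by
    rw [e1, enD]; simp [pow_two]
  have e3 : ∫ x, V x t ^ 2 * (‖x‖ ^ 2 / (4 * (t + a) ^ 2)) * gw (t + a) x =
      n / (2 * (t + a)) * enH a V t + ∫ x, V x t *
        ((∑ i, x i * pd i (fun y => V y t) x) / (t + a)) * gw (t + a) x := by
    have h1 : ∫ x, V x t ^ 2 * (‖x‖ ^ 2 / (4 * (t + a) ^ 2)) * gw (t + a) x =
        1 / (2 * (t + a)) * ∫ x, V x t ^ 2 * (‖x‖ ^ 2 / (2 * (t + a))) * gw (t + a) x := by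
      rw [← integral_const_mul]; congr 1; funext x; field_simp; ring
    have h2 : ∀ i x, pd i (fun x => V x t ^ 2) x = 2 * V x t * pd i (fun y => V y t) x := by
      intro i x
      simp only [pow_two]
      rw [pd_mul i (hVt1.differentiable (by norm_num) x) (hVt1.differentiable (by norm_num) x)]
      ring
    rw [h1, e2, enH, ← integral_const_mul, ← integral_const_mul, ← integral_add]
    · congr 1; funext x
      have : ∑ i, x i * pd i (fun x => V x t ^ 2) x =
          2 * V x t * ∑ i, x i * pd i (fun y => V y t) x := by
        rw [Finset.mul_sum]; exact Finset.sum_congr rfl fun i _ => by rw [h2]; ring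
      rw [this]; field_simp
    · exact integrable_of_tsupport hc (by fun_prop) fun x hx => by simp [hz x hx]
    · exact integrable_of_tsupport hc (by fun_prop) fun x hx => by simp [hz x hx]
  have e4 : ∫ x, (2 * V x t * deriv (V x) t
      + V x t ^ 2 * (‖x‖ ^ 2 / (4 * (t + a) ^ 2))) * gw (t + a) x =
      2 * (∫ x, V x t * src V t x * gw (t + a) x)
      - 2 * (∫ x, dlap (t + a) (fun y => V y t) x * V x t * gw (t + a) x)
      - (∫ x, V x t * ((∑ i, x i * pd i (fun y => V y t) x) / (t + a)) * gw (t + a) x)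
      + ∫ x, V x t ^ 2 * (‖x‖ ^ 2 / (4 * (t + a) ^ 2)) * gw (t + a) x := by
    rw [← integral_const_mul, ← integral_const_mul, ← integral_sub, ← integral_sub, ← integral_add]
    · congr 1; funext x
      rw [dlap_eq_src_sub (V := V) (t := t) (t + a) x]
      field_simp
    all_goals exact integrable_of_tsupport hc (by fun_prop) fun x hx => by simp [hz x hx]
  rw [e4, e3, hD]; ring

theorem hasDerivAt_enD (hV : ContDiff ℝ 3 fun p : EuclideanSpace ℝ (Fin n) × ℝ => V p.1 p.2)
    (h0 : ∀ x t, ρ < ‖x‖ → V x t = 0) (hs : 0 < t + a) :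
    HasDerivAt (enD a V) (2 * (∫ x, dlap (t + a) (fun y => V y t) x ^ 2 * gw (t + a) x)
      - 2 * (∫ x, src V t x * dlap (t + a) (fun y => V y t) x * gw (t + a) x)
      + (n / (2 * (t + a)) - 1 / (t + a)) * enD a V t) t := by
  have hc := hasCompactSupport_slice h0 t
  have hVt := hV.slice_left t
  have hVt2 : ContDiff ℝ 2 fun x => V x t := hVt.of_le (by norm_num)
  have hVt1 : ContDiff ℝ 1 fun x => V x t := hVt.of_le (by norm_num)
  have hV2 : ContDiff ℝ 2 fun p : EuclideanSpace ℝ (Fin n) × ℝ => V p.1 p.2 :=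
    hV.of_le (by norm_num)
  have hpd := fun i => contDiff_pd_slice (m := 2) (by norm_num) hV i
  have hcpd := fun i => (hpd i).continuous
  have hVd := contDiff_deriv_slice (m := 2) (by norm_num) hV
  have hcVd := hVd.continuous
  have hpdd : ∀ i, Continuous fun p : EuclideanSpace ℝ (Fin n) × ℝ =>
      pd i (fun y => deriv (V y) p.2) p.1 := fun i =>
    (contDiff_pd_slice (F := fun y t => deriv (V y) t) (m := 1) (by norm_num) hVd i).continuous
  have hder : HasDerivAt (enD a V) (∫ x, (2 * (∑ i, pd i (fun y => V y t) x
      * pd i (fun y => deriv (V y) t) x)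
      + (∑ i, pd i (fun y => V y t) x ^ 2) * (‖x‖ ^ 2 / (4 * (t + a) ^ 2))) * gw (t + a) x) t := by
    refine hasDerivAt_integral_of_support
      (F := fun x t => (∑ i, pd i (fun y => V y t) x ^ 2) * gw (t + a) x)
      (F' := fun x t => (2 * (∑ i, pd i (fun y => V y t) x * pd i (fun y => deriv (V y) t) x)
      + (∑ i, pd i (fun y => V y t) x ^ 2) * (‖x‖ ^ 2 / (4 * (t + a) ^ 2))) * gw (t + a) x)
      (c := -a) (ρ := ρ) (by linarith) ?_ ?_ ?_ ?_
    · intro t _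
      have := fun i => continuous_pd i ((hV.slice_left t).of_le (by norm_num))
      have cg := continuous_gw (n := n) (t + a)
      fun_prop
    · intro x t ht
      have h1 : ∀ i, HasDerivAt (fun t => pd i (fun y => V y t) x)
          (pd i (fun y => deriv (V y) t) x) t := by
        intro i
        rw [← deriv_pd_slice hV2 i x t]
        exact ((ContDiff.slice_right (F := fun x t => pd i (fun y => V y t) x) (hpd i)
          x).differentiable (by norm_num) t).hasDerivAt
      have h2 := HasDerivAt.fun_sum (u := Finset.univ) fun i _ => (h1 i).pow 2
      refine (h2.mul (hasDerivAt_gw x (by linarith))).congr_deriv ?_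
      simp [Finset.mul_sum, mul_assoc]; ring
    · have hne : ∀ p ∈ (univ : Set (EuclideanSpace ℝ (Fin n))) ×ˢ Ioi (-a), p.2 + a ≠ 0 := by
        rintro p ⟨_, hp⟩
        have : -a < p.2 := hp
        linarith
      have q1 : Continuous fun p : EuclideanSpace ℝ (Fin n) × ℝ =>
          ∑ i, pd i (fun y => V y p.2) p.1 ^ 2 :=
        continuous_finsetSum _ fun i _ => (hcpd i).pow 2
      have q2 : Continuous fun p : EuclideanSpace ℝ (Fin n) × ℝ =>
          2 * ∑ i, pd i (fun y => V y p.2) p.1 * pd i (fun y => deriv (V y) p.2) p.1 :=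
        continuous_const.mul (continuous_finsetSum _ fun i _ => (hcpd i).mul (hpdd i))
      unfold gw
      refine ContinuousOn.mul (ContinuousOn.add q2.continuousOn (ContinuousOn.mul q1.continuousOn
        (ContinuousOn.div (by fun_prop) (by fun_prop) fun p hp => ?_)))
        (ContinuousOn.rexp (ContinuousOn.div (by fun_prop) (by fun_prop) fun p hp => ?_))
      · have := hne p hp; positivity
      · have := hne p hp; positivity
    · intro x t hx
      have : x ∉ tsupport fun y => V y t := fun h =>
        absurd (tsupport_slice_subset h0 t h) (by simpa using hx)
      simp [pd_eq_zero _ this]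
  refine hder.congr_deriv ?_
  have cd := continuous_dlap (s := t + a) hVt2
  have cV := hVt.continuous
  have cp := fun i => continuous_pd i hVt1
  have cs := continuous_src hV t
  have cg := continuous_gw (n := n) (t + a)
  have cdV : Continuous fun x => deriv (V x) t :=
    hcVd.comp (continuous_id.prodMk continuous_const)
  have cpdV := fun i => (hpdd i).comp (continuous_id.prodMk (continuous_const (y := t)))
  simp only [Function.comp_def, id] at cpdV
  have e1 := integral_dlap_mul (s := t + a) hVt2 hc (h := fun y => deriv (V y) t)
    ((ContDiff.slice_left (F := fun x t => deriv (V x) t) hVd t).of_le (by norm_num))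
  have e2 := integral_gradSq_mul_normSq (s := t + a) hs.ne' hVt hc
  have e3 : ∫ x, (2 * (∑ i, pd i (fun y => V y t) x
      * pd i (fun y => deriv (V y) t) x)
      + (∑ i, pd i (fun y => V y t) x ^ 2) * (‖x‖ ^ 2 / (4 * (t + a) ^ 2))) * gw (t + a) x =
      2 * (∫ x, (∑ i, pd i (fun y => V y t) x * pd i (fun y => deriv (V y) t) x) * gw (t + a) x)
      + ∫ x, (∑ i, pd i (fun y => V y t) x ^ 2) * (‖x‖ ^ 2 / (4 * (t + a) ^ 2)) * gw (t + a) x := by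
    rw [← integral_const_mul, ← integral_add]
    · congr 1; funext x; ring
    all_goals exact integrable_of_tsupport hc (by fun_prop) fun x hx => by simp [pd_eq_zero _ hx]
  have e4 : ∫ x, dlap (t + a) (fun y => V y t) x * deriv (V x) t * gw (t + a) x =
      (∫ x, src V t x * dlap (t + a) (fun y => V y t) x * gw (t + a) x)
      - (∫ x, dlap (t + a) (fun y => V y t) x ^ 2 * gw (t + a) x)
      + ∫ x, dlap (t + a) (fun y => V y t) x *
        (-(∑ i, x i * pd i (fun y => V y t) x) / (2 * (t + a))) * gw (t + a) x := by
    rw [← integral_sub, ← integral_add]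
    · congr 1; funext x
      rw [dlap_eq_src_sub (V := V) (t := t) (t + a) x]
      ring
    all_goals exact integrable_of_tsupport hc (by fun_prop) fun x hx => by simp [dlap_eq_zero hx]
  rw [e3, e2, ← neg_eq_iff_eq_neg.mpr e1, e4, enD]; ring

theorem sq_integral_mul_le {f g : EuclideanSpace ℝ (Fin n) → ℝ} (s : ℝ)
    (hff : Integrable fun x => f x ^ 2 * gw s x) (hfg : Integrable fun x => f x * g x * gw s x)
    (hgg : Integrable fun x => g x ^ 2 * gw s x) (hpos : 0 < ∫ x, f x ^ 2 * gw s x) :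
    (∫ x, f x * g x * gw s x) ^ 2 ≤ (∫ x, f x ^ 2 * gw s x) * ∫ x, g x ^ 2 * gw s x := by
  set A := ∫ x, f x ^ 2 * gw s x
  set B := ∫ x, f x * g x * gw s x
  set C := ∫ x, g x ^ 2 * gw s x
  have h : 0 ≤ C - 2 * (B / A) * B + (B / A) ^ 2 * A := by
    have hi : Integrable fun x => g x ^ 2 * gw s x - 2 * (B / A) * (f x * g x * gw s x) :=
      hgg.sub (hfg.const_mul _)
    have : C - 2 * (B / A) * B + (B / A) ^ 2 * A =
        ∫ x, (g x - B / A * f x) ^ 2 * gw s x := by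
      rw [← integral_const_mul, ← integral_const_mul, ← integral_sub hgg (hfg.const_mul _),
        ← integral_add hi (hff.const_mul _)]
      congr 1; funext x; ring
    rw [this]
    exact integral_nonneg fun x => mul_nonneg (sq_nonneg _) (gw_pos _ _).le
  have h2 : C - 2 * (B / A) * B + (B / A) ^ 2 * A = C - B ^ 2 / A := by field_simp; ring
  rw [h2, sub_nonneg, div_le_iff₀ hpos] at h
  linarith

/-- Almost monotonicity of the frequency function. -/
theorem exists_hasDerivAt_frequency
    (hV : ContDiff ℝ 3 fun p : EuclideanSpace ℝ (Fin n) × ℝ => V p.1 p.2)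
    (h0 : ∀ x t, ρ < ‖x‖ → V x t = 0) (hs : 0 < t + a) (hpos : 0 < enH a V t) :
    ∃ F', HasDerivAt (fun t => (t + a) * (enD a V t / enH a V t)) F' t ∧
      -((t + a) / (2 * enH a V t)) * (∫ x, src V t x ^ 2 * gw (t + a) x) ≤ F' := by
  have hH := hasDerivAt_enH hV h0 hs
  have hD := hasDerivAt_enD hV h0 hs
  refine ⟨_, ((hasDerivAt_id t).add_const a).mul (hD.div hH hpos.ne'), ?_⟩
  have hc := hasCompactSupport_slice h0 t
  have hVt := hV.slice_left t
  have hVt2 : ContDiff ℝ 2 fun x => V x t := hVt.of_le (by norm_num)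
  have cd := continuous_dlap (s := t + a) hVt2
  have cV := hVt.continuous
  have cs := continuous_src hV t
  have cg := continuous_gw (n := n) (t + a)
  have hz : ∀ x ∉ tsupport (fun x => V x t), V x t = 0 := fun x hx =>
    image_eq_zero_of_notMem_tsupport (f := fun x => V x t) hx
  have sz : ∀ x, x ∉ closedBall (0 : EuclideanSpace ℝ (Fin n)) ρ → src V t x = 0 := by
    intro x hx
    have hx' : ρ < ‖x‖ := by simpa using hx
    rw [src, slap_eq_zero (fun h => hx (tsupport_slice_subset h0 t h)),
      deriv_eq_zero_of_norm h0 t hx', add_zero]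
  have e1 := integral_dlap_mul (s := t + a) hVt2 hc (hVt.of_le (by norm_num))
  have hDe : enD a V t = -∫ x, dlap (t + a) (fun y => V y t) x * V x t * gw (t + a) x := by
    rw [e1, enD]; simp [pow_two]
  have i1 : Integrable fun x => V x t * src V t x * gw (t + a) x :=
    integrable_of_tsupport hc (by fun_prop) fun x hx => by simp [hz x hx]
  have i2 : Integrable fun x => dlap (t + a) (fun y => V y t) x * V x t * gw (t + a) x :=
    integrable_of_tsupport hc (by fun_prop) fun x hx => by simp [hz x hx]
  have i3 : Integrable fun x => dlap (t + a) (fun y => V y t) x ^ 2 * gw (t + a) x :=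
    integrable_of_tsupport hc (by fun_prop) fun x hx => by simp [dlap_eq_zero hx]
  have i4 : Integrable fun x => src V t x * dlap (t + a) (fun y => V y t) x * gw (t + a) x :=
    integrable_of_tsupport hc (by fun_prop) fun x hx => by simp [dlap_eq_zero hx]
  have i5 : Integrable fun x => src V t x ^ 2 * gw (t + a) x := by
    refine Continuous.integrable_of_hasCompactSupport (by fun_prop)
      (HasCompactSupport.intro (isCompact_closedBall 0 ρ) fun x hx => by simp [sz x hx])
  have cs := sq_integral_mul_le (n := n) (f := fun x => V x t)
    (g := fun x => dlap (t + a) (fun y => V y t) x - src V t x / 2) (t + a)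
    (integrable_of_tsupport hc (by fun_prop) fun x hx => by simp [hz x hx])
    (integrable_of_tsupport hc (by fun_prop) fun x hx => by simp [hz x hx])
    (Continuous.integrable_of_hasCompactSupport (by fun_prop)
      (HasCompactSupport.intro (isCompact_closedBall 0 ρ) fun x hx => by
        simp [sz x hx, dlap_eq_zero fun h => hx (tsupport_slice_subset h0 t h)])) hpos
  have r1 : ∫ x, V x t * (dlap (t + a) (fun y => V y t) x - src V t x / 2) * gw (t + a) x =
      -enD a V t - (∫ x, V x t * src V t x * gw (t + a) x) / 2 := by
    rw [hDe, neg_neg, ← integral_div, ← integral_sub i2 (i1.div_const 2)]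
    congr 1; funext x; ring
  have r2 : ∫ x, (dlap (t + a) (fun y => V y t) x - src V t x / 2) ^ 2 * gw (t + a) x =
      (∫ x, dlap (t + a) (fun y => V y t) x ^ 2 * gw (t + a) x)
      - (∫ x, src V t x * dlap (t + a) (fun y => V y t) x * gw (t + a) x)
      + (∫ x, src V t x ^ 2 * gw (t + a) x) / 4 := by
    have hi : Integrable fun x => dlap (t + a) (fun y => V y t) x ^ 2 * gw (t + a) x
        - src V t x * dlap (t + a) (fun y => V y t) x * gw (t + a) x := i3.sub i4
    rw [← integral_div, ← integral_sub i3 i4, ← integral_add hi (i5.div_const 4)]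
    congr 1; funext x; ring
  rw [r1, r2] at cs
  change _ ≤ enH a V t * _ at cs
  set D := enD a V t
  set H := enH a V t
  set W := ∫ x, V x t * src V t x * gw (t + a) x
  set P := ∫ x, dlap (t + a) (fun y => V y t) x ^ 2 * gw (t + a) x
  set Q := ∫ x, src V t x * dlap (t + a) (fun y => V y t) x * gw (t + a) x
  set S := ∫ x, src V t x ^ 2 * gw (t + a) x
  simp only [id]
  have key : 1 * (D / H) + (t + a) * (((2 * P - 2 * Q + (n / (2 * (t + a)) - 1 / (t + a)) * D) * H
      - D * (2 * D + 2 * W + n / (2 * (t + a)) * H)) / H ^ 2)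
      - -((t + a) / (2 * H)) * S
      = 2 * (t + a) / H ^ 2 * (H * (P - Q + S / 4) - (-D - W / 2) ^ 2 + W ^ 2 / 4) := by
    field_simp
    ring
  have : 0 ≤ 2 * (t + a) / H ^ 2 * (H * (P - Q + S / 4) - (-D - W / 2) ^ 2 + W ^ 2 / 4) :=
    mul_nonneg (by positivity) (by nlinarith [sq_nonneg W])
  rw [← key] at this
  exact sub_nonneg.mp this

end Frequency

section SmoothDoubling

variable {n : ℕ} {V : EuclideanSpace ℝ (Fin n) → ℝ → ℝ} {a t ρ R η : ℝ}

theorem gw_le_one {s : ℝ} (hs : 0 < s) (x : EuclideanSpace ℝ (Fin n)) : gw s x ≤ 1 := by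
  rw [gw, Real.exp_le_one_iff]
  exact div_nonpos_of_nonpos_of_nonneg (by nlinarith [sq_nonneg ‖x‖]) (by linarith)

theorem gw_le_of_le_norm {s d : ℝ} (hs : 0 < s) (hd : 0 ≤ d) {x : EuclideanSpace ℝ (Fin n)}
    (hx : d ≤ ‖x‖) : gw s x ≤ exp (-(d ^ 2 / (4 * s))) := by
  rw [gw, neg_div]
  gcongr

theorem le_gw_of_norm_le {s d : ℝ} (hs : 0 < s) {x : EuclideanSpace ℝ (Fin n)}
    (hx : ‖x‖ ≤ d) : exp (-(d ^ 2 / (4 * s))) ≤ gw s x := by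
  rw [gw, neg_div]
  gcongr

theorem integrable_sq_mul_gw (hV : ContDiff ℝ 3 fun p : EuclideanSpace ℝ (Fin n) × ℝ => V p.1 p.2)
    (h0 : ∀ x t, ρ < ‖x‖ → V x t = 0) (s t : ℝ) : Integrable fun x => V x t ^ 2 * gw s x := by
  have cV := (hV.slice_left t).continuous
  have cg := continuous_gw (n := n) s
  refine integrable_of_tsupport (hasCompactSupport_slice h0 t) (by fun_prop) fun x hx => ?_
  have : V x t = 0 := image_eq_zero_of_notMem_tsupport (f := fun x => V x t) hx
  simp [this]

theorem integrable_sq (hV : ContDiff ℝ 3 fun p : EuclideanSpace ℝ (Fin n) × ℝ => V p.1 p.2)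
    (h0 : ∀ x t, ρ < ‖x‖ → V x t = 0) (t : ℝ) : Integrable fun x => V x t ^ 2 := by
  have cV := (hV.slice_left t).continuous
  refine integrable_of_tsupport (hasCompactSupport_slice h0 t) (by fun_prop) fun x hx => ?_
  have : V x t = 0 := image_eq_zero_of_notMem_tsupport (f := fun x => V x t) hx
  simp [this]

theorem integrable_gradSq_mul_gw
    (hV : ContDiff ℝ 3 fun p : EuclideanSpace ℝ (Fin n) × ℝ => V p.1 p.2)
    (h0 : ∀ x t, ρ < ‖x‖ → V x t = 0) (s t : ℝ) :
    Integrable fun x => (∑ i, pd i (fun y => V y t) x ^ 2) * gw s x := by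
  have cp := fun i => continuous_pd i ((hV.slice_left t).of_le (by norm_num))
  have cg := continuous_gw (n := n) s
  exact integrable_of_tsupport (hasCompactSupport_slice h0 t) (by fun_prop) fun x hx => by
    simp [pd_eq_zero _ hx]

theorem enD_nonneg (a t : ℝ) : 0 ≤ enD a V t :=
  integral_nonneg fun _ =>
    mul_nonneg (Finset.sum_nonneg fun _ _ => sq_nonneg _) (gw_pos _ _).le

theorem source_estimates
    (hV : ContDiff ℝ 3 fun p : EuclideanSpace ℝ (Fin n) × ℝ => V p.1 p.2)
    (h0 : ∀ x t, ρ < ‖x‖ → V x t = 0) (hR : 0 < R) {e : EuclideanSpace ℝ (Fin n) → ℝ}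
    (he : ∀ x, e x ^ 2 * gw (t + a) x ≤ η)
    (hsrc : ∀ x, |src V t x| ≤
      R ^ 2 * |V x t| + R * √(∑ i, pd i (fun y => V y t) x ^ 2) + e x) :
    (∫ x, src V t x ^ 2 * gw (t + a) x) ≤ 3 * (R ^ 4 * enH a V t + R ^ 2 * enD a V t
      + η * volume.real (closedBall (0 : EuclideanSpace ℝ (Fin n)) ρ)) ∧
    -(4 * R ^ 2 * enH a V t + enD a V t
      + η * volume.real (closedBall (0 : EuclideanSpace ℝ (Fin n)) ρ) / R ^ 2) ≤
      2 * ∫ x, V x t * src V t x * gw (t + a) x := by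
  have cV := (hV.slice_left t).continuous
  have cs := continuous_src hV t
  have cg := continuous_gw (n := n) (t + a)
  have hz : ∀ x ∉ tsupport (fun x => V x t), V x t = 0 := fun x hx =>
    image_eq_zero_of_notMem_tsupport (f := fun x => V x t) hx
  have sz : ∀ x, x ∉ closedBall (0 : EuclideanSpace ℝ (Fin n)) ρ → src V t x = 0 := by
    intro x hx
    have hx' : ρ < ‖x‖ := by simpa using hx
    rw [src, slap_eq_zero (fun h => hx (tsupport_slice_subset h0 t h)),
      deriv_eq_zero_of_norm h0 t hx', add_zero]
  have iH := integrable_sq_mul_gw hV h0 (t + a) t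
  have iD := integrable_gradSq_mul_gw hV h0 (t + a) t
  have iI : Integrable ((closedBall (0 : EuclideanSpace ℝ (Fin n)) ρ).indicator fun _ => η) :=
    (integrable_indicator_iff measurableSet_closedBall).2
      (integrableOn_const measure_closedBall_lt_top.ne)
  have vI : ∫ x, (closedBall (0 : EuclideanSpace ℝ (Fin n)) ρ).indicator (fun _ => η) x =
      η * volume.real (closedBall (0 : EuclideanSpace ℝ (Fin n)) ρ) := by
    rw [integral_indicator measurableSet_closedBall, setIntegral_const, smul_eq_mul, mul_comm]
  have i1 : Integrable fun x => V x t * src V t x * gw (t + a) x :=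
    integrable_of_tsupport (hasCompactSupport_slice h0 t) (by fun_prop)
      fun x hx => by simp [hz x hx]
  have i5 : Integrable fun x => src V t x ^ 2 * gw (t + a) x :=
    Continuous.integrable_of_hasCompactSupport (by fun_prop)
      (HasCompactSupport.intro (isCompact_closedBall 0 ρ) fun x hx => by simp [sz x hx])
  have hη : 0 ≤ η := le_trans (mul_nonneg (sq_nonneg _) (gw_pos _ _).le) (he 0)
  have gp := fun x => gw_pos (n := n) (t + a) x
  have hg2 : ∀ x, √(∑ i, pd i (fun y => V y t) x ^ 2) ^ 2 = ∑ i, pd i (fun y => V y t) x ^ 2 :=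
    fun x => sq_sqrt (Finset.sum_nonneg fun i _ => sq_nonneg _)
  have hDnn : ∀ x, 0 ≤ ∑ i, pd i (fun y => V y t) x ^ 2 :=
    fun x => Finset.sum_nonneg fun i _ => sq_nonneg _
  constructor
  · have iA : Integrable fun x => R ^ 4 * (V x t ^ 2 * gw (t + a) x)
        + R ^ 2 * ((∑ i, pd i (fun y => V y t) x ^ 2) * gw (t + a) x) :=
      (iH.const_mul _).add (iD.const_mul _)
    rw [enH, enD, ← vI, ← integral_const_mul, ← integral_const_mul,
      ← integral_add (iH.const_mul _) (iD.const_mul _), ← integral_add iA iI,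
      ← integral_const_mul]
    refine integral_mono i5 ((iA.add iI).const_mul 3) fun x => ?_
    beta_reduce
    by_cases hx : x ∈ closedBall (0 : EuclideanSpace ℝ (Fin n)) ρ
    · rw [indicator_of_mem hx]
      have h1 : src V t x ^ 2 ≤ 3 * (R ^ 4 * V x t ^ 2
          + R ^ 2 * (∑ i, pd i (fun y => V y t) x ^ 2) + e x ^ 2) := by
        have := sq_le_sq' (by linarith [hsrc x, neg_abs_le (src V t x)])
          ((le_abs_self _).trans (hsrc x))
        refine this.trans ?_
        have h2 := hg2 x
        generalize √(∑ i, pd i (fun y => V y t) x ^ 2) = g at h2 ⊢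
        rw [← h2, ← sq_abs (V x t)]
        nlinarith [sq_nonneg (R ^ 2 * |V x t| - R * g), sq_nonneg (R ^ 2 * |V x t| - e x),
          sq_nonneg (R * g - e x)]
      nlinarith [mul_le_mul_of_nonneg_right h1 (gp x).le, he x]
    · rw [indicator_of_notMem hx, sz x hx]
      have := hDnn x
      have := (gp x).le
      simp only [ne_eq, OfNat.ofNat_ne_zero, not_false_eq_true, zero_pow, zero_mul]
      positivity
  · have iA : Integrable fun x => 4 * R ^ 2 * (V x t ^ 2 * gw (t + a) x)
        + ((∑ i, pd i (fun y => V y t) x ^ 2) * gw (t + a) x) :=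
      (iH.const_mul _).add iD
    rw [enH, enD, ← vI, ← integral_const_mul, ← integral_const_mul, ← integral_div,
      ← integral_add (iH.const_mul _) iD, ← integral_add iA (iI.div_const _), ← integral_neg]
    refine integral_mono (iA.add (iI.div_const _)).neg (i1.const_mul 2) fun x => ?_
    beta_reduce
    by_cases hx : x ∈ closedBall (0 : EuclideanSpace ℝ (Fin n)) ρ
    · rw [indicator_of_mem hx]
      have h1 : -(4 * R ^ 2 * V x t ^ 2 + (∑ i, pd i (fun y => V y t) x ^ 2) + e x ^ 2 / R ^ 2) ≤
          2 * (V x t * src V t x) := by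
        have h2 : -(|V x t| * |src V t x|) ≤ V x t * src V t x := by
          rw [← abs_mul]; exact neg_abs_le _
        have h3 := mul_le_mul_of_nonneg_left (hsrc x) (abs_nonneg (V x t))
        rw [← hg2, ← sq_abs (V x t)]
        generalize √(∑ i, pd i (fun y => V y t) x ^ 2) = g at *
        have h4 : 2 * (|V x t| * e x) ≤ R ^ 2 * |V x t| ^ 2 + e x ^ 2 / R ^ 2 := by
          have : 0 ≤ (R * |V x t| - e x / R) ^ 2 := sq_nonneg _
          have h5 : (R * |V x t| - e x / R) ^ 2 =
            R ^ 2 * |V x t| ^ 2 + e x ^ 2 / R ^ 2 - 2 * (|V x t| * e x) := by field_simp; ring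
          linarith
        nlinarith [sq_nonneg (R * |V x t| - g)]
      have h6 : e x ^ 2 * gw (t + a) x / R ^ 2 ≤ η / R ^ 2 := by gcongr; exact he x
      have h7 : e x ^ 2 * gw (t + a) x / R ^ 2 = e x ^ 2 / R ^ 2 * gw (t + a) x := by ring
      nlinarith [mul_le_mul_of_nonneg_right h1 (gp x).le]
    · rw [indicator_of_notMem hx, sz x hx]
      have := hDnn x
      have := (gp x).le
      simp only [mul_zero, zero_mul, zero_div, add_zero, Left.neg_nonpos_iff]
      positivity

end SmoothDoubling

section SmoothDoubling

variable {n : ℕ} {V : EuclideanSpace ℝ (Fin n) → ℝ → ℝ} {a t s R K ε : ℝ}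

/-- A smooth compactly supported function which almost satisfies the differential inequality,
with an additional error of size `K * R` away from the ball of radius `2`. -/
structure IsApproxSol (V : EuclideanSpace ℝ (Fin n) → ℝ → ℝ) (R K ε : ℝ) : Prop where
  smooth : ContDiff ℝ 3 fun p : EuclideanSpace ℝ (Fin n) × ℝ => V p.1 p.2
  supp : ∀ x t, 4 < ‖x‖ → V x t = 0
  bound : ∀ x, ∀ t ∈ Icc 0 (1 / (4 * R ^ 2)), |V x t| ≤ 1
  source : ∀ x, ∀ t ∈ Icc 0 (1 / (4 * R ^ 2)), |src V t x| ≤ R ^ 2 * |V x t|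
    + R * √(∑ i, pd i (fun y => V y t) x ^ 2) + (ε + if 2 ≤ ‖x‖ then K * R else 0)

theorem error_sq_mul_gw_le (hs : 0 < s) (x : EuclideanSpace ℝ (Fin n)) :
    (ε + if 2 ≤ ‖x‖ then K * R else 0) ^ 2 * gw s x ≤
      2 * ε ^ 2 + 2 * K ^ 2 * R ^ 2 * exp (-(1 / s)) := by
  have g0 := gw_pos s x
  have g1 := gw_le_one hs x
  have he := Real.exp_pos (-(1 / s))
  split_ifs with h
  · have h2 := gw_le_of_le_norm hs (by norm_num : (0 : ℝ) ≤ 2) h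
    have h3 : (2 : ℝ) ^ 2 / (4 * s) = 1 / s := by field_simp; norm_num
    rw [h3] at h2
    have h4 : (ε + K * R) ^ 2 ≤ 2 * ε ^ 2 + 2 * K ^ 2 * R ^ 2 := by
      nlinarith [sq_nonneg (ε - K * R)]
    have h5 : 2 * ε ^ 2 * gw s x ≤ 2 * ε ^ 2 * 1 := by gcongr
    have h6 : 2 * K ^ 2 * R ^ 2 * gw s x ≤ 2 * K ^ 2 * R ^ 2 * exp (-(1 / s)) := by gcongr
    nlinarith [mul_le_mul_of_nonneg_right h4 g0.le]
  · have h5 : ε ^ 2 * gw s x ≤ ε ^ 2 * 1 := by gcongr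
    have : 0 ≤ 2 * K ^ 2 * R ^ 2 * exp (-(1 / s)) := by positivity
    nlinarith [sq_nonneg ε]

theorem enH_nonneg (a t : ℝ) : 0 ≤ enH a V t :=
  integral_nonneg fun _ => mul_nonneg (sq_nonneg _) (gw_pos _ _).le

theorem enH_deriv_lower (h : IsApproxSol V R K ε) (hR : 0 < R) (ht : t ∈ Icc 0 (1 / (4 * R ^ 2)))
    (hs : 0 < t + a) : ∃ H', HasDerivAt (enH a V) H' t ∧
      enD a V t - 4 * R ^ 2 * enH a V t
      - (2 * ε ^ 2 + 2 * K ^ 2 * R ^ 2 * exp (-(1 / (t + a))))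
        * volume.real (closedBall (0 : EuclideanSpace ℝ (Fin n)) 4) / R ^ 2 ≤ H' := by
  refine ⟨_, hasDerivAt_enH h.smooth h.supp hs, ?_⟩
  have h1 := (source_estimates (t := t) (a := a) h.smooth h.supp hR (error_sq_mul_gw_le hs)
    fun x => h.source x t ht).2
  have h2 : 0 ≤ n / (2 * (t + a)) * enH a V t := mul_nonneg (by positivity) (enH_nonneg _ _)
  linarith

theorem IsApproxSol.setIntegral_sq_mul_gw_le (h : IsApproxSol V R K ε)
    (ht : t ∈ Icc 0 (1 / (4 * R ^ 2))) {S : Set (EuclideanSpace ℝ (Fin n))} {m : ℝ}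
    (hS : MeasurableSet S) (hm0 : 0 ≤ m)
    (hm : ∀ x ∈ S, gw s x ≤ m) : ∫ x in S, V x t ^ 2 * gw s x ≤
      m * volume.real (closedBall (0 : EuclideanSpace ℝ (Fin n)) 4) := by
  have iI : Integrable ((closedBall (0 : EuclideanSpace ℝ (Fin n)) 4).indicator fun _ => m) :=
    (integrable_indicator_iff measurableSet_closedBall).2
      (integrableOn_const measure_closedBall_lt_top.ne)
  have vI : ∫ x, (closedBall (0 : EuclideanSpace ℝ (Fin n)) 4).indicator (fun _ => m) x =
      m * volume.real (closedBall (0 : EuclideanSpace ℝ (Fin n)) 4) := by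
    rw [integral_indicator measurableSet_closedBall, setIntegral_const, smul_eq_mul, mul_comm]
  rw [← vI, ← integral_indicator hS]
  refine integral_mono ((integrable_sq_mul_gw h.smooth h.supp s t).indicator hS) iI fun x => ?_
  have hnn : 0 ≤ (closedBall (0 : EuclideanSpace ℝ (Fin n)) 4).indicator (fun _ => m) x :=
    indicator_nonneg (fun _ _ => hm0) x
  by_cases hx : x ∈ S
  · rw [indicator_of_mem hx]
    by_cases hb : x ∈ closedBall (0 : EuclideanSpace ℝ (Fin n)) 4
    · rw [indicator_of_mem hb]
      have : V x t ^ 2 ≤ 1 := by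
        rw [← sq_abs]; exact pow_le_one₀ (abs_nonneg _) (h.bound x t ht)
      calc V x t ^ 2 * gw s x ≤ 1 * gw s x := by gcongr; exact (gw_pos _ _).le
        _ ≤ m := by rw [one_mul]; exact hm x hx
    · simpa [h.supp x t (by simpa using hb)] using hnn
  · rw [indicator_of_notMem hx]; exact hnn

theorem IsApproxSol.enH_le (h : IsApproxSol V R K ε) (ht : t ∈ Icc 0 (1 / (4 * R ^ 2)))
    (hs : 0 < t + a) :
    enH a V t ≤ volume.real (closedBall (0 : EuclideanSpace ℝ (Fin n)) 4) := by
  have := h.setIntegral_sq_mul_gw_le (s := t + a) (S := univ) (m := 1) ht MeasurableSet.univ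
    zero_le_one fun x _ => gw_le_one hs x
  simpa [enH] using this

theorem IsApproxSol.mul_setIntegral_le_enH (h : IsApproxSol V R K ε)
    (hs : 0 < t + a) {d : ℝ} :
    exp (-(d ^ 2 / (4 * (t + a)))) * ∫ x in ball (0 : EuclideanSpace ℝ (Fin n)) d, V x t ^ 2 ≤
      enH a V t := by
  rw [enH, ← integral_const_mul]
  refine (setIntegral_mono_on ((integrable_sq h.smooth h.supp t).const_mul _).integrableOn
    (integrable_sq_mul_gw h.smooth h.supp (t + a) t).integrableOn measurableSet_ball
    fun x hx => ?_).trans (setIntegral_le_integral (integrable_sq_mul_gw h.smooth h.supp (t + a) t)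
      (Filter.Eventually.of_forall fun x => mul_nonneg (sq_nonneg _) (gw_pos _ _).le))
  rw [mul_comm]
  have : ‖x‖ ≤ d := by simpa using (mem_ball.1 hx).le
  exact mul_le_mul_of_nonneg_left (le_gw_of_norm_le hs this) (sq_nonneg _)

theorem tendsto_pow_mul_exp_neg_sq (m : ℕ) {b : ℝ} (hb : 0 < b) :
    Filter.Tendsto (fun R : ℝ => R ^ m * exp (-(b * R ^ 2))) Filter.atTop (nhds 0) := by
  have h1 : Filter.Tendsto (fun R : ℝ => R ^ m * exp (-(b * R))) Filter.atTop (nhds 0) := by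
    have := Real.tendsto_pow_mul_exp_neg_atTop_nhds_zero m
    have h2 := (this.comp (Filter.tendsto_id.const_mul_atTop hb)).const_mul ((b ^ m)⁻¹)
    simp only [mul_zero, Function.comp_def, id] at h2
    refine h2.congr fun R => ?_
    rw [mul_pow]; field_simp
  refine squeeze_zero' (Filter.eventually_atTop.2 ⟨0, fun R hR => by positivity⟩)
    (Filter.eventually_atTop.2 ⟨1, fun R hR => ?_⟩) h1
  have : R ≤ R ^ 2 := by nlinarith
  gcongr

set_option maxHeartbeats 1000000 in
theorem exists_mass_lower_bound (n : ℕ) (K : ℝ) {θ : ℝ} (hθ : 0 < θ) : ∀ᶠ R : ℝ in Filter.atTop,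
    ∀ ε, ε ^ 2 ≤ exp (-(2 * R ^ 2)) → ∀ V : EuclideanSpace ℝ (Fin n) → ℝ → ℝ,
    IsApproxSol V R K ε →
    θ ^ 2 * (R ^ n)⁻¹ / 2 ≤ ∫ x in ball (0 : EuclideanSpace ℝ (Fin n)) 1, V x 0 ^ 2 →
    ∀ t ∈ Icc 0 (1 / (4 * R ^ 2)),
      exp (-(2 * R ^ 2)) ≤ ∫ x in ball (0 : EuclideanSpace ℝ (Fin n)) (3 / 2), V x t ^ 2 := by
  set c := volume.real (closedBall (0 : EuclideanSpace ℝ (Fin n)) 4) with hc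
  have hc0 : 0 ≤ c := measureReal_nonneg
  have hlim := (tendsto_pow_mul_exp_neg_sq n (b := 1 / 8) (by norm_num)).const_mul
    (1 + c + c * (2 + 2 * K ^ 2))
  rw [mul_zero] at hlim
  have hpos : 0 < exp (-1) * θ ^ 2 / 2 := by positivity
  filter_upwards [hlim.eventually_lt_const hpos, Filter.eventually_ge_atTop 1]
    with R hR1 hR ε hε V h hL2 t ht
  have hR0 : 0 < R := by linarith
  set a := 1 / (4 * R ^ 2) with ha
  have ha0 : 0 < a := by positivity
  set η := 2 * ε ^ 2 + 2 * K ^ 2 * R ^ 2 * exp (-(2 * R ^ 2)) with hη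
  have hη0 : 0 ≤ η := by positivity
  have hd : ∀ τ ∈ Icc 0 a, ∃ H', HasDerivAt (enH a V) H' τ ∧
      - 4 * R ^ 2 * enH a V τ - η * c / R ^ 2 ≤ H' := by
    intro τ hτ
    have hs : 0 < τ + a := by linarith [hτ.1]
    obtain ⟨H', h1, h2⟩ := enH_deriv_lower h hR0 hτ hs
    refine ⟨H', h1, le_trans ?_ h2⟩
    have h3 : exp (-(1 / (τ + a))) ≤ exp (-(2 * R ^ 2)) := by
      rw [Real.exp_le_exp, neg_le_neg_iff, le_div_iff₀ hs]
      have : τ + a ≤ 2 * (1 / (4 * R ^ 2)) := by rw [← ha]; linarith [hτ.2]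
      calc 2 * R ^ 2 * (τ + a) ≤ 2 * R ^ 2 * (2 * (1 / (4 * R ^ 2))) := by gcongr
        _ = 1 := by field_simp; norm_num
    have h4 : (2 * ε ^ 2 + 2 * K ^ 2 * R ^ 2 * exp (-(1 / (τ + a)))) * c / R ^ 2 ≤
        η * c / R ^ 2 := by rw [hη]; gcongr
    have := enD_nonneg (V := V) a τ
    linarith
  choose! H' hH1 hH2 using hd
  have h4a : 4 * R ^ 2 * a = 1 := by rw [ha]; field_simp
  have hmono : MonotoneOn (fun τ => enH a V τ * exp (4 * R ^ 2 * τ) + exp 1 * (η * c / R ^ 2) * τ)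
      (Icc 0 a) := by
    have hder : ∀ τ ∈ Icc 0 a, HasDerivAt
        (fun τ => enH a V τ * exp (4 * R ^ 2 * τ) + exp 1 * (η * c / R ^ 2) * τ)
        (H' τ * exp (4 * R ^ 2 * τ) + enH a V τ * (exp (4 * R ^ 2 * τ) * (4 * R ^ 2))
          + exp 1 * (η * c / R ^ 2)) τ := by
      intro τ hτ
      have e1 : HasDerivAt (fun τ => exp (4 * R ^ 2 * τ)) (exp (4 * R ^ 2 * τ) * (4 * R ^ 2)) τ := by
        have := ((hasDerivAt_id τ).const_mul (4 * R ^ 2)).exp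
        simpa using this
      have e2 : HasDerivAt (fun τ => exp 1 * (η * c / R ^ 2) * τ) (exp 1 * (η * c / R ^ 2)) τ := by
        simpa using (hasDerivAt_id τ).const_mul (exp 1 * (η * c / R ^ 2))
      exact ((hH1 τ hτ).mul e1).add e2
    refine monotoneOn_of_hasDerivWithinAt_nonneg (convex_Icc 0 a)
      (fun τ hτ => (hder τ hτ).continuousAt.continuousWithinAt)
      (fun τ hτ => (hder τ (interior_subset hτ)).hasDerivWithinAt) fun τ hτ => ?_
    have hτ' := interior_subset hτ
    have e3 : exp (4 * R ^ 2 * τ) ≤ exp 1 := by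
      rw [Real.exp_le_exp, ← h4a]; gcongr; exact hτ'.2
    have e4 := mul_le_mul_of_nonneg_right (hH2 τ hτ') (Real.exp_pos (4 * R ^ 2 * τ)).le
    have e5 : η * c / R ^ 2 * exp (4 * R ^ 2 * τ) ≤ η * c / R ^ 2 * exp 1 := by gcongr
    linarith
  have hm := hmono ⟨le_rfl, ha0.le⟩ ht ht.1
  simp only [mul_zero, Real.exp_zero, mul_one, add_zero] at hm
  have hH0 := h.mul_setIntegral_le_enH (t := 0) (a := a) (d := 1) (by linarith)
  have e0 : (1 : ℝ) ^ 2 / (4 * (0 + a)) = R ^ 2 := by rw [ha]; field_simp; norm_num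
  rw [e0] at hH0
  have hs : 0 < t + a := by linarith [ht.1]
  have hfar := h.setIntegral_sq_mul_gw_le (s := t + a) (S := (ball 0 (3 / 2))ᶜ)
    (m := exp (-(9 / 8 * R ^ 2))) ht measurableSet_ball.compl (Real.exp_pos _).le fun x hx => by
      refine (gw_le_of_le_norm hs (d := 3 / 2) (by norm_num) (by simpa using hx)).trans ?_
      rw [Real.exp_le_exp, neg_le_neg_iff, le_div_iff₀ (by positivity)]
      have : t + a ≤ 2 * (1 / (4 * R ^ 2)) := by rw [← ha]; linarith [ht.2]
      calc 9 / 8 * R ^ 2 * (4 * (t + a)) ≤ 9 / 8 * R ^ 2 * (4 * (2 * (1 / (4 * R ^ 2)))) := by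
            gcongr
        _ = (3 / 2) ^ 2 := by field_simp; norm_num
  have hnear : ∫ x in ball (0 : EuclideanSpace ℝ (Fin n)) (3 / 2), V x t ^ 2 * gw (t + a) x ≤
      ∫ x in ball (0 : EuclideanSpace ℝ (Fin n)) (3 / 2), V x t ^ 2 :=
    setIntegral_mono (integrable_sq_mul_gw h.smooth h.supp (t + a) t).integrableOn
      (integrable_sq h.smooth h.supp t).integrableOn fun x =>
        mul_le_of_le_one_right (sq_nonneg _) (gw_le_one hs x)
  have hsplit := integral_add_compl (μ := volume) (s := ball (0 : EuclideanSpace ℝ (Fin n)) (3 / 2))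
    measurableSet_ball (integrable_sq_mul_gw h.smooth h.supp (t + a) t)
  change _ = enH a V t at hsplit
  have hexp : exp (4 * R ^ 2 * t) ≤ exp 1 := by
    rw [Real.exp_le_exp, ← h4a]; gcongr; exact ht.2
  have hHt : exp (-1) * enH a V 0 - η * c / (4 * R ^ 4) ≤ enH a V t := by
    have e1 : exp 1 * (η * c / R ^ 2) * t ≤ exp 1 * (η * c / R ^ 2) * a := by
      gcongr; exact ht.2
    have e2 : exp 1 * (η * c / R ^ 2) * a = exp 1 * (η * c / (4 * R ^ 4)) := by
      rw [ha]; field_simp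
    have e3 : enH a V t * exp (4 * R ^ 2 * t) ≤ enH a V t * exp 1 :=
      mul_le_mul_of_nonneg_left hexp (enH_nonneg _ _)
    have e4 : exp (-1) * exp 1 = 1 := by rw [← Real.exp_add]; simp
    have e5 : enH a V 0 ≤ exp 1 * (enH a V t + η * c / (4 * R ^ 4)) := by linarith
    have e6 := mul_le_mul_of_nonneg_left e5 (Real.exp_pos (-1)).le
    rw [← mul_assoc, e4] at e6
    linarith
  have hηb : η * c / (4 * R ^ 4) ≤ c * (2 + 2 * K ^ 2) * exp (-(2 * R ^ 2)) := by
    have hR2 : 1 ≤ R ^ 2 := one_le_pow₀ hR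
    have e1 : η ≤ (2 + 2 * K ^ 2) * exp (-(2 * R ^ 2)) * R ^ 2 := by
      rw [hη]
      nlinarith [mul_le_mul hε hR2 zero_le_one (Real.exp_pos _).le]
    rw [div_le_iff₀ (by positivity)]
    calc η * c ≤ (2 + 2 * K ^ 2) * exp (-(2 * R ^ 2)) * R ^ 2 * c := by gcongr
      _ ≤ (2 + 2 * K ^ 2) * exp (-(2 * R ^ 2)) * (4 * R ^ 4) * c := by gcongr; nlinarith
      _ = _ := by ring
  have hexp2 : exp (-(2 * R ^ 2)) ≤ exp (-(9 / 8 * R ^ 2)) := by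
    rw [Real.exp_le_exp]; nlinarith [sq_nonneg R]
  have hmain : (1 + c + c * (2 + 2 * K ^ 2)) * exp (-(9 / 8 * R ^ 2)) ≤
      exp (-1) * (exp (-R ^ 2) * (θ ^ 2 * (R ^ n)⁻¹ / 2)) := by
    have e1 : exp (-(9 / 8 * R ^ 2)) = exp (-(1 / 8 * R ^ 2)) * exp (-R ^ 2) := by
      rw [← Real.exp_add]; congr 1; ring
    have e2 : (1 + c + c * (2 + 2 * K ^ 2)) * exp (-(1 / 8 * R ^ 2)) ≤
        exp (-1) * θ ^ 2 / 2 * (R ^ n)⁻¹ := by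
      rw [← div_eq_mul_inv, le_div_iff₀ (by positivity)]
      linarith
    calc _ = (1 + c + c * (2 + 2 * K ^ 2)) * exp (-(1 / 8 * R ^ 2)) * exp (-R ^ 2) := by
          rw [e1]; ring
      _ ≤ exp (-1) * θ ^ 2 / 2 * (R ^ n)⁻¹ * exp (-R ^ 2) := by gcongr
      _ = _ := by ring
  have hfin : exp (-1) * (exp (-R ^ 2) * (θ ^ 2 * (R ^ n)⁻¹ / 2)) ≤ exp (-1) * enH a V 0 := by
    gcongr
    refine le_trans ?_ hH0
    gcongr
  have hK : 0 ≤ c * (2 + 2 * K ^ 2) := by positivity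
  nlinarith [mul_le_mul_of_nonneg_left hexp2 hK]

end SmoothDoubling

section SmoothDoubling

variable {n : ℕ} {V : EuclideanSpace ℝ (Fin n) → ℝ → ℝ} {a t s R K ε : ℝ}

set_option maxHeartbeats 1000000 in
theorem exists_frequency_bound (n : ℕ) (K : ℝ) : ∀ᶠ R : ℝ in Filter.atTop,
    ∀ a ∈ Ioc 0 (1 / (32 * R ^ 2)), ∀ ε,
    4 * volume.real (closedBall (0 : EuclideanSpace ℝ (Fin n)) 4) * ε ^ 2 ≤
      exp (-(9 / (16 * a))) * exp (-(2 * R ^ 2)) →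
    ∀ V : EuclideanSpace ℝ (Fin n) → ℝ → ℝ, IsApproxSol V R K ε →
    (∀ t ∈ Icc 0 (1 / (4 * R ^ 2)),
      exp (-(2 * R ^ 2)) ≤ ∫ x in ball (0 : EuclideanSpace ℝ (Fin n)) (3 / 2), V x t ^ 2) →
    0 < enH a V 0 ∧ a * enD a V 0 ≤ 400 * R ^ 2 * enH a V 0 := by
  set c := volume.real (closedBall (0 : EuclideanSpace ℝ (Fin n)) 4) with hc
  have hc0 : 0 ≤ c := measureReal_nonneg
  have hlim := (tendsto_pow_mul_exp_neg_sq 2 (b := 5) (by norm_num)).const_mul (4 * c * K ^ 2)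
  rw [mul_zero] at hlim
  have hlog : ∀ᶠ R : ℝ in Filter.atTop, c ≤ exp (R ^ 2) :=
    (Real.tendsto_exp_atTop.comp (Filter.tendsto_pow_atTop (by norm_num))).eventually_ge_atTop c
  filter_upwards [hlim.eventually_lt_const zero_lt_one, hlog, Filter.eventually_ge_atTop 1]
    with R hR1 hcR hR a haI ε hε V h hmass
  obtain ⟨ha0, haR⟩ := haI
  have hR0 : 0 < R := by linarith
  have hR2 : 1 ≤ R ^ 2 := one_le_pow₀ hR
  set T := 1 / (32 * R ^ 2) with hT
  have hT0 : 0 < T := by positivity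
  have hTR : T * (32 * R ^ 2) = 1 := by rw [hT]; field_simp
  have hT8 : 1 / (4 * R ^ 2) = 8 * T := by rw [hT]; field_simp; norm_num
  have hIcc : ∀ t ∈ Icc 0 T, t ∈ Icc 0 (1 / (4 * R ^ 2)) := fun t ht =>
    ⟨ht.1, by rw [hT8]; linarith [ht.2]⟩
  have hHlow : ∀ t ∈ Icc 0 T, exp (-(9 / (16 * (t + a)))) * exp (-(2 * R ^ 2)) ≤ enH a V t := by
    intro t ht
    have hs : 0 < t + a := by linarith [ht.1]
    have h1 := h.mul_setIntegral_le_enH (d := 3 / 2) hs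
    have e : ((3 : ℝ) / 2) ^ 2 / (4 * (t + a)) = 9 / (16 * (t + a)) := by field_simp; norm_num
    rw [e] at h1
    refine le_trans ?_ h1
    gcongr
    exact hmass t (hIcc t ht)
  have hHpos : ∀ t ∈ Icc 0 T, 0 < enH a V t := fun t ht =>
    lt_of_lt_of_le (by positivity) (hHlow t ht)
  have hη : ∀ t ∈ Icc 0 T, (2 * ε ^ 2 + 2 * K ^ 2 * R ^ 2 * exp (-(1 / (t + a)))) * c ≤
      enH a V t := by
    intro t ht
    have hs : 0 < t + a := by linarith [ht.1]
    refine le_trans ?_ (hHlow t ht)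
    have e1 : exp (-(9 / (16 * a))) ≤ exp (-(9 / (16 * (t + a)))) := by
      rw [Real.exp_le_exp, neg_le_neg_iff]
      gcongr
      linarith [ht.1]
    have e2 : exp (-(1 / (t + a))) ≤ exp (-(9 / (16 * (t + a)))) * exp (-(7 * R ^ 2)) := by
      rw [← Real.exp_add, Real.exp_le_exp]
      have : 7 * R ^ 2 ≤ 7 / (16 * (t + a)) := by
        rw [le_div_iff₀ (by positivity)]
        have : t + a ≤ 2 * T := by linarith [ht.2]
        calc 7 * R ^ 2 * (16 * (t + a)) ≤ 7 * R ^ 2 * (16 * (2 * T)) := by gcongr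
          _ = 7 * (T * (32 * R ^ 2)) := by ring
          _ = 7 := by rw [hTR, mul_one]
      have e3 : 1 / (t + a) = 9 / (16 * (t + a)) + 7 / (16 * (t + a)) := by field_simp; norm_num
      linarith
    have e4 : exp (-(7 * R ^ 2)) = exp (-(5 * R ^ 2)) * exp (-(2 * R ^ 2)) := by
      rw [← Real.exp_add]; congr 1; ring
    have e5 : 2 * ε ^ 2 * c ≤ 1 / 2 * (exp (-(9 / (16 * (t + a)))) * exp (-(2 * R ^ 2))) := by
      have := mul_le_mul_of_nonneg_right e1 (Real.exp_pos (-(2 * R ^ 2))).le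
      linarith
    have e6 : 2 * K ^ 2 * R ^ 2 * exp (-(1 / (t + a))) * c ≤
        1 / 2 * (exp (-(9 / (16 * (t + a)))) * exp (-(2 * R ^ 2))) := by
      calc 2 * K ^ 2 * R ^ 2 * exp (-(1 / (t + a))) * c
          ≤ 2 * K ^ 2 * R ^ 2 * (exp (-(9 / (16 * (t + a)))) * exp (-(7 * R ^ 2))) * c := by gcongr
        _ = (4 * c * K ^ 2 * (R ^ 2 * exp (-(5 * R ^ 2)))) *
            (1 / 2 * (exp (-(9 / (16 * (t + a)))) * exp (-(2 * R ^ 2)))) := by rw [e4]; ring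
        _ ≤ 1 * (1 / 2 * (exp (-(9 / (16 * (t + a)))) * exp (-(2 * R ^ 2)))) := by
            gcongr
        _ = _ := one_mul _
    linarith
  have hdH : ∀ t ∈ Icc 0 T, ∃ H', HasDerivAt (enH a V) H' t ∧
      enD a V t - 5 * R ^ 2 * enH a V t ≤ H' := by
    intro t ht
    obtain ⟨H', h1, h2⟩ := enH_deriv_lower (a := a) h hR0 (hIcc t ht) (by linarith [ht.1])
    refine ⟨H', h1, le_trans ?_ h2⟩
    have h3 := hη t ht
    have h4 : (2 * ε ^ 2 + 2 * K ^ 2 * R ^ 2 * exp (-(1 / (t + a)))) * c / R ^ 2 ≤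
        enH a V t * R ^ 2 := by
      refine (div_le_self (by positivity) hR2).trans (h3.trans ?_)
      exact le_mul_of_one_le_right (hHpos t ht).le hR2
    linarith
  choose! H' hH1 hH2 using hdH
  obtain ⟨τ, hτ, hFτ⟩ : ∃ τ ∈ Icc 0 T, enD a V τ ≤ 2501 * R ^ 4 * enH a V τ := by
    have hsub : ∀ t ∈ Icc (T / 2) T, t ∈ Icc 0 T := fun t ht => ⟨by linarith [ht.1], ht.2⟩
    obtain ⟨τ, hτ, hslope⟩ := exists_hasDerivAt_eq_slope (fun t => log (enH a V t))
      (fun t => H' t / enH a V t) (a := T / 2) (b := T) (by linarith)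
      (fun t ht => ((hH1 t (hsub t ht)).log
        (hHpos t (hsub t ht)).ne').continuousAt.continuousWithinAt)
      (fun t ht => (hH1 t (hsub t (Ioo_subset_Icc_self ht))).log
        (hHpos t (hsub t (Ioo_subset_Icc_self ht))).ne')
    have hτ' := hsub τ (Ioo_subset_Icc_self hτ)
    refine ⟨τ, hτ', ?_⟩
    have h1 : log (enH a V T) ≤ R ^ 2 := by
      rw [Real.log_le_iff_le_exp (hHpos T ⟨hT0.le, le_rfl⟩)]
      exact (h.enH_le (hIcc T ⟨hT0.le, le_rfl⟩) (by linarith)).trans hcR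
    have hT2 : T / 2 ∈ Icc 0 T := ⟨by linarith, by linarith⟩
    have h2 : -(38 * R ^ 2) ≤ log (enH a V (T / 2)) := by
      rw [Real.le_log_iff_exp_le (hHpos _ hT2)]
      refine le_trans ?_ (hHlow _ hT2)
      rw [← Real.exp_add, Real.exp_le_exp]
      have : 9 / (16 * (T / 2 + a)) ≤ 36 * R ^ 2 := by
        rw [div_le_iff₀ (by positivity)]
        calc (9 : ℝ) = 36 * R ^ 2 * (16 * (T / 2)) * (1 / 2 * 2) * (1 / (T * (32 * R ^ 2)))
              := by field_simp; norm_num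
          _ = 36 * R ^ 2 * (16 * (T / 2)) := by rw [hTR]; ring
          _ ≤ 36 * R ^ 2 * (16 * (T / 2 + a)) := by gcongr; linarith
      linarith
    have h3 : H' τ / enH a V τ ≤ 2496 * R ^ 4 := by
      rw [hslope, div_le_iff₀ (by linarith)]
      have : 2496 * R ^ 4 * (T - T / 2) = 39 * R ^ 2 * (T * (32 * R ^ 2)) := by ring
      rw [this, hTR]
      linarith
    rw [div_le_iff₀ (hHpos τ hτ')] at h3
    have h4 := hH2 τ hτ'
    have h5 : 5 * R ^ 2 * enH a V τ ≤ 5 * R ^ 4 * enH a V τ := by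
      have := (hHpos τ hτ').le
      gcongr 5 * ?_ * _
      nlinarith
    linarith
  have hdF : ∀ t ∈ Icc 0 T, ∃ F', HasDerivAt (fun t => (t + a) * (enD a V t / enH a V t)) F' t ∧
      -(2 * R ^ 2) * ((t + a) * (enD a V t / enH a V t) + 1) ≤ F' := by
    intro t ht
    have hs : 0 < t + a := by linarith [ht.1]
    have hH := hHpos t ht
    obtain ⟨F', h1, h2⟩ := exists_hasDerivAt_frequency h.smooth h.supp hs hH
    refine ⟨F', h1, le_trans ?_ h2⟩
    have h3 := (source_estimates (t := t) (a := a) h.smooth h.supp hR0 (error_sq_mul_gw_le hs)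
      fun x => h.source x t (hIcc t ht)).1
    rw [← hc] at h3
    have h4 := hη t ht
    have hsT : (t + a) * R ^ 2 ≤ 1 / 16 := by
      have : t + a ≤ 2 * T := by linarith [ht.2]
      calc (t + a) * R ^ 2 ≤ 2 * T * R ^ 2 := by gcongr
        _ = 1 / 16 * (T * (32 * R ^ 2)) := by ring
        _ = 1 / 16 := by rw [hTR, mul_one]
    have h5 : (∫ x, src V t x ^ 2 * gw (t + a) x) ≤
        3 * (R ^ 4 * enH a V t + R ^ 2 * enD a V t + enH a V t) := by linarith
    have h6 : (t + a) / (2 * enH a V t) * (∫ x, src V t x ^ 2 * gw (t + a) x) ≤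
        (t + a) / (2 * enH a V t) * (3 * (R ^ 4 * enH a V t + R ^ 2 * enD a V t + enH a V t)) := by
      gcongr
    have h7 : (t + a) / (2 * enH a V t) *
        (3 * (R ^ 4 * enH a V t + R ^ 2 * enD a V t + enH a V t)) =
        3 / 2 * ((t + a) * R ^ 2 * R ^ 2 + (t + a)
          + R ^ 2 * ((t + a) * (enD a V t / enH a V t))) := by
      field_simp; ring
    have h8 : (t + a) * R ^ 2 * R ^ 2 ≤ 1 / 16 * R ^ 2 := by gcongr
    have h9 : t + a ≤ 1 / 16 * R ^ 2 := by nlinarith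
    have h10 : 0 ≤ R ^ 2 * ((t + a) * (enD a V t / enH a V t)) := by
      have := enD_nonneg (V := V) a t
      positivity
    nlinarith
  choose! F' hF1 hF2 using hdF
  set F := fun t => (t + a) * (enD a V t / enH a V t) with hF
  have hmono : MonotoneOn (fun t => (F t + 1) * exp (2 * R ^ 2 * t)) (Icc 0 T) := by
    have hder : ∀ t ∈ Icc 0 T, HasDerivAt (fun t => (F t + 1) * exp (2 * R ^ 2 * t))
        (F' t * exp (2 * R ^ 2 * t) + (F t + 1) * (exp (2 * R ^ 2 * t) * (2 * R ^ 2))) t := by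
      intro t ht
      have e1 : HasDerivAt (fun t => exp (2 * R ^ 2 * t)) (exp (2 * R ^ 2 * t) * (2 * R ^ 2)) t := by
        simpa using ((hasDerivAt_id t).const_mul (2 * R ^ 2)).exp
      exact ((hF1 t ht).add_const 1).mul e1
    refine monotoneOn_of_hasDerivWithinAt_nonneg (convex_Icc 0 T)
      (fun t ht => (hder t ht).continuousAt.continuousWithinAt)
      (fun t ht => (hder t (interior_subset ht)).hasDerivWithinAt) fun t ht => ?_
    have e4 := mul_le_mul_of_nonneg_right (hF2 t (interior_subset ht))
      (Real.exp_pos (2 * R ^ 2 * t)).le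
    change -(2 * R ^ 2) * (F t + 1) * _ ≤ _ at e4
    linarith
  have h0T : (0 : ℝ) ∈ Icc 0 T := ⟨le_rfl, hT0.le⟩
  have hm := hmono h0T hτ hτ.1
  simp only [mul_zero, Real.exp_zero, mul_one] at hm
  have hH0 := hHpos 0 h0T
  refine ⟨hH0, ?_⟩
  have hFτ2 : F τ ≤ 160 * R ^ 2 := by
    have h1 : enD a V τ / enH a V τ ≤ 2501 * R ^ 4 := by
      rwa [div_le_iff₀ (hHpos τ hτ)]
    calc F τ ≤ (τ + a) * (2501 * R ^ 4) := by
          simp only [hF]; gcongr; linarith [hτ.1]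
      _ ≤ (2 * T) * (2501 * R ^ 4) := by gcongr; linarith [hτ.2]
      _ = T * (32 * R ^ 2) * (2501 / 16 * R ^ 2) := by ring
      _ ≤ 160 * R ^ 2 := by rw [hTR]; nlinarith
  have hexp : exp (2 * R ^ 2 * τ) ≤ 2 := by
    have h1 : 2 * R ^ 2 * τ ≤ 1 / 16 := by
      calc 2 * R ^ 2 * τ ≤ 2 * R ^ 2 * T := by gcongr; exact hτ.2
        _ = 1 / 16 * (T * (32 * R ^ 2)) := by ring
        _ = 1 / 16 := by rw [hTR, mul_one]
    have h2 : exp (2 * R ^ 2 * τ) ≤ exp (log 2) := by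
      rw [Real.exp_le_exp]; linarith [Real.log_two_gt_d9]
    rwa [Real.exp_log (by norm_num)] at h2
  have hF0 : F 0 ≤ 400 * R ^ 2 := by
    have : (F τ + 1) * exp (2 * R ^ 2 * τ) ≤ (160 * R ^ 2 + 1) * 2 := by gcongr
    linarith
  simp only [hF, zero_add] at hF0
  rw [← mul_div_assoc, div_le_iff₀ hH0] at hF0
  exact hF0

theorem doubling_of_frequency_bound
    (h : IsApproxSol V R K ε) {M r : ℝ} (hM : 0 < M) (hr : 0 < r)
    (ha : a = r ^ 2 / (8 * M)) (hF : n * enH a V 0 + 4 * a * enD a V 0 ≤ M * enH a V 0) :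
    ∫ x in ball (0 : EuclideanSpace ℝ (Fin n)) (2 * r), V x 0 ^ 2 ≤
      2 * exp (8 * M) * ∫ x in ball (0 : EuclideanSpace ℝ (Fin n)) r, V x 0 ^ 2 := by
  have ha0 : 0 < a := by rw [ha]; positivity
  have hVt : ContDiff ℝ 1 fun x => V x 0 := (h.smooth.slice_left 0).of_le (by norm_num)
  have hc := hasCompactSupport_slice h.supp 0
  have cV := hVt.continuous
  have cp := fun i => continuous_pd i hVt
  have cg := continuous_gw (n := n) a
  have hz : ∀ x ∉ tsupport (fun x => V x 0), V x 0 = 0 := fun x hx =>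
    image_eq_zero_of_notMem_tsupport (f := fun x => V x 0) hx
  have iH : Integrable fun x => V x 0 ^ 2 * gw a x := by
    simpa using integrable_sq_mul_gw h.smooth h.supp a 0
  have iD := integrable_gradSq_mul_gw h.smooth h.supp a 0
  have iN : Integrable fun x => V x 0 ^ 2 * (‖x‖ ^ 2 / (4 * a)) * gw a x :=
    integrable_of_tsupport hc (by fun_prop) fun x hx => by simp [hz x hx]
  have eH : enH a V 0 = ∫ x, V x 0 ^ 2 * gw a x := by simp [enH]
  have eD : enD a V 0 = ∫ x, (∑ i, pd i (fun y => V y 0) x ^ 2) * gw a x := by simp [enD]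
  have h1 := integral_normSq_mul (s := a) (f := fun x => V x 0 ^ 2) (hVt.pow 2)
    (HasCompactSupport.intro hc fun x hx => by simp [hz x hx])
  have h2 : ∫ x, V x 0 ^ 2 * (‖x‖ ^ 2 / (2 * a)) * gw a x =
      2 * ∫ x, V x 0 ^ 2 * (‖x‖ ^ 2 / (4 * a)) * gw a x := by
    rw [← integral_const_mul]; congr 1; funext x; field_simp; ring
  have hpd : ∀ i x, pd i (fun x => V x 0 ^ 2) x = 2 * V x 0 * pd i (fun y => V y 0) x := by
    intro i x
    simp only [pow_two]
    rw [pd_mul i (hVt.differentiable (by norm_num) x) (hVt.differentiable (by norm_num) x)]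
    ring
  have i4 : Integrable fun x => n * (V x 0 ^ 2 * gw a x)
      + V x 0 ^ 2 * (‖x‖ ^ 2 / (4 * a)) * gw a x := (iH.const_mul _).add iN
  have h3 : ∫ x, (n * V x 0 ^ 2 + ∑ i, x i * pd i (fun x => V x 0 ^ 2) x) * gw a x ≤
      n * enH a V 0 + (∫ x, V x 0 ^ 2 * (‖x‖ ^ 2 / (4 * a)) * gw a x) + 4 * a * enD a V 0 := by
    rw [eH, eD, ← integral_const_mul, ← integral_const_mul, ← integral_add (iH.const_mul _) iN,
      ← integral_add i4 (iD.const_mul _)]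
    simp only [hpd]
    refine integral_mono ?_ (i4.add (iD.const_mul _)) fun x => ?_
    · exact integrable_of_tsupport hc (by fun_prop) fun x hx => by simp [hz x hx]
    · have hx : ∑ i, x i * (2 * V x 0 * pd i (fun y => V y 0) x) ≤
          V x 0 ^ 2 * (‖x‖ ^ 2 / (4 * a)) + 4 * a * ∑ i, pd i (fun y => V y 0) x ^ 2 := by
        rw [EuclideanSpace.norm_sq_eq, Finset.sum_div, Finset.mul_sum, Finset.mul_sum,
          ← Finset.sum_add_distrib]
        refine Finset.sum_le_sum fun i _ => ?_
        have h5 : 0 ≤ (V x 0 * x i - 4 * a * pd i (fun y => V y 0) x) ^ 2 / (4 * a) := by positivity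
        have h6 : (V x 0 * x i - 4 * a * pd i (fun y => V y 0) x) ^ 2 / (4 * a) =
            V x 0 ^ 2 * (x i ^ 2 / (4 * a)) + 4 * a * pd i (fun y => V y 0) x ^ 2
            - x i * (2 * V x 0 * pd i (fun y => V y 0) x) := by
          field_simp; ring
        rw [Real.norm_eq_abs, sq_abs]
        linarith
      have := mul_le_mul_of_nonneg_right hx (gw_pos a x).le
      beta_reduce
      linarith
  have h4 : ∫ x, V x 0 ^ 2 * (‖x‖ ^ 2 / (4 * a)) * gw a x ≤ M * enH a V 0 := by
    rw [h2] at h1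
    linarith
  have hout : ∫ x in (ball (0 : EuclideanSpace ℝ (Fin n)) r)ᶜ, V x 0 ^ 2 * gw a x ≤
      4 * a / r ^ 2 * ∫ x, V x 0 ^ 2 * (‖x‖ ^ 2 / (4 * a)) * gw a x := by
    rw [← integral_const_mul]
    refine (setIntegral_mono_on iH.integrableOn (iN.const_mul _).integrableOn
      measurableSet_ball.compl fun x hx => ?_).trans
      (setIntegral_le_integral (iN.const_mul _) (Filter.Eventually.of_forall fun x => ?_))
    · have hx' : r ≤ ‖x‖ := by simpa using hx
      have h5 : 1 ≤ ‖x‖ ^ 2 / r ^ 2 := by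
        rw [one_le_div (by positivity)]; gcongr
      have h6 : 4 * a / r ^ 2 * (V x 0 ^ 2 * (‖x‖ ^ 2 / (4 * a)) * gw a x) =
          V x 0 ^ 2 * gw a x * (‖x‖ ^ 2 / r ^ 2) := by field_simp
      rw [h6]
      exact le_mul_of_one_le_right (mul_nonneg (sq_nonneg _) (gw_pos _ _).le) h5
    · have := gw_pos a x
      simp only [Pi.zero_apply]
      positivity
  have hhalf : 4 * a / r ^ 2 * (M * enH a V 0) = enH a V 0 / 2 := by
    rw [ha]; field_simp; ring
  have hout2 : ∫ x in (ball (0 : EuclideanSpace ℝ (Fin n)) r)ᶜ, V x 0 ^ 2 * gw a x ≤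
      enH a V 0 / 2 := by
    rw [← hhalf]
    exact hout.trans (by gcongr)
  have hsplit := integral_add_compl (μ := volume) (s := ball (0 : EuclideanSpace ℝ (Fin n)) r)
    measurableSet_ball iH
  rw [← eH] at hsplit
  have hin : ∫ x in ball (0 : EuclideanSpace ℝ (Fin n)) r, V x 0 ^ 2 * gw a x ≤
      ∫ x in ball (0 : EuclideanSpace ℝ (Fin n)) r, V x 0 ^ 2 :=
    setIntegral_mono iH.integrableOn (integrable_sq h.smooth h.supp 0).integrableOn fun x =>
      mul_le_of_le_one_right (sq_nonneg _) (gw_le_one ha0 x)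
  have hlow := h.mul_setIntegral_le_enH (t := 0) (a := a) (d := 2 * r) (by linarith)
  have e1 : (2 * r) ^ 2 / (4 * (0 + a)) = 8 * M := by rw [ha]; field_simp; ring
  rw [e1] at hlow
  have hfin : exp (-(8 * M)) * ∫ x in ball (0 : EuclideanSpace ℝ (Fin n)) (2 * r), V x 0 ^ 2 ≤
      2 * ∫ x in ball (0 : EuclideanSpace ℝ (Fin n)) r, V x 0 ^ 2 := by linarith
  have := mul_le_mul_of_nonneg_left hfin (Real.exp_pos (8 * M)).le
  rw [← mul_assoc, ← Real.exp_add, add_neg_cancel, Real.exp_zero, one_mul] at this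
  linarith

/-- The doubling inequality for smooth approximate solutions. -/
theorem smooth_doubling (n : ℕ) (K : ℝ) {θ : ℝ} (hθ : 0 < θ) : ∀ᶠ R : ℝ in Filter.atTop,
    ∀ r ∈ Ioc (0 : ℝ) (1 / 2), ∃ ε₀ > 0, ∀ ε ∈ Icc 0 ε₀,
    ∀ V : EuclideanSpace ℝ (Fin n) → ℝ → ℝ, IsApproxSol V R K ε →
    θ ^ 2 * (R ^ n)⁻¹ / 2 ≤ ∫ x in ball (0 : EuclideanSpace ℝ (Fin n)) 1, V x 0 ^ 2 →
    ∫ x in ball (0 : EuclideanSpace ℝ (Fin n)) (2 * r), V x 0 ^ 2 ≤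
      2 * exp (8 * (n + 1600 * R ^ 2)) *
        ∫ x in ball (0 : EuclideanSpace ℝ (Fin n)) r, V x 0 ^ 2 := by
  filter_upwards [exists_mass_lower_bound n K hθ, exists_frequency_bound n K,
    Filter.eventually_ge_atTop 1] with R h1 h2 hR r hr
  obtain ⟨hr0, hr1⟩ := hr
  set c := volume.real (closedBall (0 : EuclideanSpace ℝ (Fin n)) 4) with hc
  have hc0 : 0 ≤ c := measureReal_nonneg
  set M := n + 1600 * R ^ 2 with hM
  have hM0 : 0 < M := by positivity
  set a := r ^ 2 / (8 * M) with ha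
  have ha0 : 0 < a := by positivity
  have haR : a ≤ 1 / (32 * R ^ 2) := by
    rw [ha, div_le_div_iff₀ (by positivity) (by positivity)]
    have : r ^ 2 ≤ 1 := by nlinarith
    have : (0 : ℝ) ≤ n := by positivity
    nlinarith [sq_nonneg R]
  set q := min (exp (-(2 * R ^ 2))) (exp (-(9 / (16 * a))) * exp (-(2 * R ^ 2)) / (4 * c + 1))
    with hq
  have hq0 : 0 < q := by
    rw [hq]; exact lt_min (Real.exp_pos _) (by positivity)
  refine ⟨√q, by positivity, fun ε hε V h hL2 => ?_⟩
  have hεq : ε ^ 2 ≤ q := by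
    rw [← sq_sqrt hq0.le]; exact pow_le_pow_left₀ hε.1 hε.2 2
  have hε1 : 4 * c * ε ^ 2 ≤ exp (-(9 / (16 * a))) * exp (-(2 * R ^ 2)) := by
    have h3 := hεq.trans (min_le_right _ _)
    rw [le_div_iff₀ (by positivity)] at h3
    nlinarith [sq_nonneg ε]
  obtain ⟨h3, h4⟩ := h2 a ⟨ha0, haR⟩ ε hε1 V h (h1 ε (hεq.trans (min_le_left _ _)) V h hL2)
  exact doubling_of_frequency_bound h hM0 hr0 ha (by rw [hM]; linarith)

end SmoothDoubling

section MaximumPrinciple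

variable {n : ℕ}

theorem deriv_deriv_nonpos_of_isLocalMax {f : ℝ → ℝ} {x : ℝ} (h : IsLocalMax f x)
    (hc : ContinuousAt f x) : deriv (deriv f) x ≤ 0 := by
  by_contra! hpos
  have h1 := isLocalMin_of_deriv_deriv_pos hpos h.deriv_eq_zero hc
  have h2 : f =ᶠ[nhds x] fun _ => f x := by
    filter_upwards [h, h1] with y h3 h4 using le_antisymm h3 h4
  have h3 : deriv f =ᶠ[nhds x] fun _ => 0 := by
    filter_upwards [h2.eventuallyEq_nhds] with y hy
    rw [hy.deriv_eq, deriv_const]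
  rw [h3.deriv_eq, deriv_const] at hpos
  exact hpos.false

theorem nonpos_of_isLocalMax {f f' : ℝ → ℝ} {x d : ℝ} (h : IsLocalMax f x)
    (hf : ∀ s, HasDerivAt f (f' s) s) (hf' : HasDerivAt f' d x) : d ≤ 0 := by
  have h1 := deriv_deriv_nonpos_of_isLocalMax h (hf x).continuousAt
  rwa [funext fun s => (hf s).deriv, hf'.deriv] at h1

theorem nonpos_of_hasDerivWithinAt_Ici {f : ℝ → ℝ} {d t δ : ℝ} (hd : HasDerivWithinAt f d (Ici t) t)
    (hδ : 0 < δ) (h : ∀ s ∈ Ioo t (t + δ), f s ≤ f t) : d ≤ 0 := by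
  have h1 := hasDerivWithinAt_iff_tendsto_slope.1 hd
  rw [Ici_sdiff_left] at h1
  refine le_of_tendsto h1 ?_
  filter_upwards [Ioo_mem_nhdsGT (show t < t + δ by linarith)] with s hs
  rw [slope_def_field]
  exact div_nonpos_of_nonpos_of_nonneg (by linarith [h s hs]) (by linarith [hs.1])

theorem hasDerivAt_line {f : EuclideanSpace ℝ (Fin n) → ℝ} (hf : Differentiable ℝ f) (i : Fin n)
    (c : ℝ) (x : EuclideanSpace ℝ (Fin n)) (s : ℝ) :
    HasDerivAt (fun s : ℝ => f (x + (c * s) • EuclideanSpace.single i 1))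
      (c * pd i f (x + (c * s) • EuclideanSpace.single i 1)) s := by
  have h1 : HasDerivAt (fun s : ℝ => x + (c * s) • EuclideanSpace.single i (1 : ℝ))
      ((c * 1) • EuclideanSpace.single i (1 : ℝ)) s :=
    (((hasDerivAt_id s).const_mul c).smul_const _).const_add x
  have := (hf (x + (c * s) • EuclideanSpace.single i 1)).hasFDerivAt.comp_hasDerivAt s h1
  refine this.congr_deriv ?_
  simp [pd]

variable {z : EuclideanSpace ℝ (Fin n) → ℝ → ℝ} {t₀ τ K M ρ : ℝ}

set_option maxHeartbeats 1000000 in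
/-- The comparison step of the gradient estimate, by the maximum principle in the doubled
variable `s`. -/
theorem sub_le_of_parabolic (hτ : 0 < τ) (hM : 0 < M) (hρ : 0 ≤ ρ)
    (hz : ∀ t ∈ Icc t₀ (t₀ + τ), ContDiff ℝ 2 fun x => z x t)
    (hc : ContinuousOn (fun p : EuclideanSpace ℝ (Fin n) × ℝ => z p.1 p.2)
      (univ ×ˢ Icc t₀ (t₀ + τ)))
    (h0 : ∀ x, ∀ t ∈ Icc t₀ (t₀ + τ), ρ < ‖x‖ → z x t = 0)
    (hb : ∀ x, ∀ t ∈ Icc t₀ (t₀ + τ), |z x t| ≤ M)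
    (hK : ∀ x, ∀ t ∈ Ico t₀ (t₀ + τ), ∃ d, HasDerivWithinAt (z x) d (Ici t) t ∧
      |slap (fun y => z y t) x + d| ≤ K) (hK0 : 0 ≤ K) (j : Fin n)
    (x : EuclideanSpace ℝ (Fin n)) {s : ℝ} (hs : s ∈ Icc 0 √τ) :
    z (x + s • EuclideanSpace.single j 1) t₀ - z (x - s • EuclideanSpace.single j 1) t₀ ≤
      (K * √τ + 4 * M / √τ) * s := by
  set σ := √τ with hσ
  have hσ0 : 0 < σ := Real.sqrt_pos.2 hτ
  have hσ2 : σ ^ 2 = τ := sq_sqrt hτ.le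
  set e : EuclideanSpace ℝ (Fin n) := EuclideanSpace.single j 1 with he
  have hen : ‖e‖ = 1 := by simp [he]
  set B := K + 2 * M / τ with hB
  set A := K * σ + 4 * M / σ with hA
  have hAB : A * σ - B * σ ^ 2 = 2 * M := by
    rw [hA, hB, ← hσ2]; field_simp; ring
  have hBp : 0 < B := by positivity
  have hAB2 : ∀ s ∈ Icc 0 σ, -A * s + B * s ^ 2 ≤ 0 := by
    intro s hs
    have h1 : B * s ≤ B * σ := by gcongr; exact hs.2
    have h2 : B * σ ≤ A := by
      have : B * σ * σ ≤ A * σ := by nlinarith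
      exact le_of_mul_le_mul_right this hσ0
    nlinarith [hs.1]
  set Φ : EuclideanSpace ℝ (Fin n) × ℝ × ℝ → ℝ := fun p =>
    z (p.1 + p.2.1 • e) p.2.2 - z (p.1 - p.2.1 • e) p.2.2 - A * p.2.1 + B * p.2.1 ^ 2
      - 2 * M / τ * (p.2.2 - t₀) with hΦ
  set S := closedBall (0 : EuclideanSpace ℝ (Fin n)) (ρ + σ) ×ˢ Icc 0 σ ×ˢ Icc t₀ (t₀ + τ) with hS
  have hScomp : IsCompact S :=
    (isCompact_closedBall _ _).prod (isCompact_Icc.prod isCompact_Icc)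
  have hΦc : ContinuousOn Φ S := by
    have c1 : ContinuousOn (fun p : EuclideanSpace ℝ (Fin n) × ℝ × ℝ =>
        z (p.1 + p.2.1 • e) p.2.2) S :=
      hc.comp (f := fun p : EuclideanSpace ℝ (Fin n) × ℝ × ℝ => (p.1 + p.2.1 • e, p.2.2))
        (by fun_prop) fun p hp => ⟨mem_univ _, hp.2.2⟩
    have c2 : ContinuousOn (fun p : EuclideanSpace ℝ (Fin n) × ℝ × ℝ =>
        z (p.1 - p.2.1 • e) p.2.2) S :=
      hc.comp (f := fun p : EuclideanSpace ℝ (Fin n) × ℝ × ℝ => (p.1 - p.2.1 • e, p.2.2))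
        (by fun_prop) fun p hp => ⟨mem_univ _, hp.2.2⟩
    exact (((c1.sub c2).sub (by fun_prop)).add (by fun_prop)).sub (by fun_prop)
  have hvanish : ∀ x, ρ + σ ≤ ‖x‖ → ∀ s ∈ Ico 0 σ, ∀ t ∈ Icc t₀ (t₀ + τ),
      z (x + s • e) t = 0 ∧ z (x - s • e) t = 0 := by
    intro x hx s hs t ht
    have h1 : ‖s • e‖ = s := by rw [norm_smul, hen, mul_one, Real.norm_of_nonneg hs.1]
    have h2 := norm_sub_le_norm_add x (s • e)
    have h3 := norm_sub_norm_le x (s • e)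
    rw [h1] at h2 h3
    exact ⟨h0 _ _ ht (by linarith [hs.2]), h0 _ _ ht (by linarith [hs.2])⟩
  have hwM : ∀ (x : EuclideanSpace ℝ (Fin n)) (s : ℝ), ∀ t ∈ Icc t₀ (t₀ + τ), z (x + s • e) t - z (x - s • e) t ≤ 2 * M := by
    intro x s t ht
    have h1 := (abs_le.1 (hb (x + s • e) t ht)).2
    have h2 := (abs_le.1 (hb (x - s • e) t ht)).1
    linarith
  have hpen : ∀ t ∈ Icc t₀ (t₀ + τ), 0 ≤ 2 * M / τ * (t - t₀) := fun t ht =>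
    mul_nonneg (by positivity) (by linarith [ht.1])
  have hneg : ∀ p ∈ S, Φ p ≤ 0 := by
    have hSne : S.Nonempty := ⟨(0, 0, t₀), by
      simp only [hS, mem_prod, mem_closedBall, dist_self, mem_Icc]
      exact ⟨by positivity, ⟨le_rfl, hσ0.le⟩, le_rfl, by linarith⟩⟩
    obtain ⟨⟨x, s, t⟩, hp, hmax⟩ := hScomp.exists_isMaxOn hSne hΦc
    intro p hpS
    refine (hmax hpS).trans ?_
    by_contra! hpos
    obtain ⟨hx, hs, ht⟩ := hp
    simp only at hx hs ht
    have hs1 : 0 < s := by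
      rcases hs.1.eq_or_lt with h | h
      · simp only [hΦ, ← h, zero_smul, add_zero, sub_zero, sub_self] at hpos
        linarith [hpen t ht]
      · exact h
    have hs2 : s < σ := by
      rcases hs.2.eq_or_lt with h | h
      · simp only [hΦ, h] at hpos
        linarith [hpen t ht, hwM x σ t ht]
      · exact h
    have ht2 : t < t₀ + τ := by
      rcases ht.2.eq_or_lt with h | h
      · have h1 : 2 * M / τ * (t - t₀) = 2 * M := by rw [h]; field_simp; ring
        simp only [hΦ] at hpos
        linarith [hwM x s t ht, hAB2 s hs]
      · exact h
    have hx2 : ‖x‖ < ρ + σ := by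
      by_contra! hx2
      have h1 := hvanish x hx2 s ⟨hs.1, hs2⟩ t ht
      simp only [hΦ, h1.1, h1.2] at hpos
      linarith [hpen t ht, hAB2 s hs]
    have hzt := hz t ht
    have hdz : Differentiable ℝ fun x => z x t := hzt.differentiable (by norm_num)
    have hother : ∀ i, pd i (pd i fun y => z y t) (x + s • e) -
        pd i (pd i fun y => z y t) (x - s • e) ≤ 0 := by
      intro i
      have hl : IsLocalMax (fun h : ℝ =>
          z ((x + s • e) + (1 * h) • EuclideanSpace.single i 1) t
          - z ((x - s • e) + (1 * h) • EuclideanSpace.single i 1) t) 0 := by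
        have hcont : ContinuousAt (fun h : ℝ => x + h • EuclideanSpace.single i (1 : ℝ)) 0 := by
          fun_prop
        have hev : ∀ᶠ h : ℝ in nhds 0, x + h • EuclideanSpace.single i (1 : ℝ) ∈
            ball (0 : EuclideanSpace ℝ (Fin n)) (ρ + σ) :=
          hcont.eventually_mem (isOpen_ball.mem_nhds (by simpa using hx2))
        filter_upwards [hev] with h hh
        have := hmax (show (x + h • EuclideanSpace.single i (1 : ℝ), s, t) ∈ S from
          ⟨ball_subset_closedBall hh, hs, ht⟩)
        simp only [hΦ, mem_ofPred_eq] at this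
        simp only [one_mul, zero_smul, add_zero]
        have e1 : x + s • e + h • EuclideanSpace.single i (1 : ℝ) =
          x + h • EuclideanSpace.single i (1 : ℝ) + s • e := by abel
        have e2 : x - s • e + h • EuclideanSpace.single i (1 : ℝ) =
          x + h • EuclideanSpace.single i (1 : ℝ) - s • e := by abel
        rw [e1, e2]
        linarith
      have d1 := fun y (s : ℝ) => hasDerivAt_line hdz i 1 y s
      have hp := (contDiff_pd (m := 1) i hzt (by norm_num)).differentiable (by norm_num)
      have h1 := nonpos_of_isLocalMax hl (fun h => (d1 _ h).sub (d1 _ h))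
        (((hasDerivAt_line hp i 1 _ 0).const_mul 1).sub ((hasDerivAt_line hp i 1 _ 0).const_mul 1))
      simpa using h1
    have hself : pd j (pd j fun y => z y t) (x + s • e) -
        pd j (pd j fun y => z y t) (x - s • e) + 2 * B ≤ 0 := by
      have hl : IsLocalMax (fun s : ℝ => z (x + (1 * s) • e) t - z (x + (-1 * s) • e) t
          - A * s + B * s ^ 2) s := by
        filter_upwards [Ioo_mem_nhds hs1 hs2] with h hh
        have := hmax (show (x, h, t) ∈ S from ⟨hx, Ioo_subset_Icc_self hh, ht⟩)
        simp only [hΦ, mem_ofPred_eq] at this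
        simp only [one_mul, neg_one_mul, neg_smul, ← sub_eq_add_neg]
        linarith
      have d1 := fun c (s : ℝ) => hasDerivAt_line hdz j c x s
      have hq : ∀ s : ℝ, HasDerivAt (fun s : ℝ => B * s ^ 2) (B * (2 * s)) s := fun s => by
        simpa using (hasDerivAt_pow 2 s).const_mul B
      have hl1 : ∀ s : ℝ, HasDerivAt (fun s : ℝ => A * s) A s := fun s => by
        simpa using (hasDerivAt_id s).const_mul A
      have hp := (contDiff_pd (m := 1) j hzt (by norm_num)).differentiable (by norm_num)
      have hm : HasDerivAt (fun s : ℝ => B * (2 * s)) (B * 2) s := by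
        simpa using ((hasDerivAt_id s).const_mul 2).const_mul B
      have h1 := nonpos_of_isLocalMax hl
        (fun s => (((d1 1 s).sub (d1 (-1) s)).sub (hl1 s)).add (hq s))
        (((((hasDerivAt_line hp j 1 x s).const_mul 1).sub
          ((hasDerivAt_line hp j (-1) x s).const_mul (-1))).sub (hasDerivAt_const s A)).add hm)
      simp only [one_mul, neg_one_mul, neg_smul, ← sub_eq_add_neg, neg_neg] at h1
      linarith
    have hlap : slap (fun y => z y t) (x + s • e) - slap (fun y => z y t) (x - s • e)
        + 2 * B ≤ 0 := by
      rw [slap_eq_sum_pd, slap_eq_sum_pd, ← Finset.sum_sub_distrib,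
        ← Finset.add_sum_erase _ _ (Finset.mem_univ j)]
      have := Finset.sum_nonpos fun i (_ : i ∈ Finset.univ.erase j) => hother i
      linarith
    obtain ⟨d₁, hd₁, hk₁⟩ := hK (x + s • e) t ⟨ht.1, ht2⟩
    obtain ⟨d₂, hd₂, hk₂⟩ := hK (x - s • e) t ⟨ht.1, ht2⟩
    have htime : d₁ - d₂ - 2 * M / τ ≤ 0 := by
      have hl1 : HasDerivWithinAt (fun t => 2 * M / τ * (t - t₀)) (2 * M / τ) (Ici t) t := by
        simpa using (((hasDerivAt_id t).sub_const t₀).const_mul (2 * M / τ)).hasDerivWithinAt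
      refine nonpos_of_hasDerivWithinAt_Ici ((hd₁.sub hd₂).sub hl1)
        (show 0 < t₀ + τ - t by linarith) fun r hr => ?_
      have := hmax (show (x, s, r) ∈ S from
        ⟨hx, hs, by linarith [hr.1, ht.1], by linarith [hr.2]⟩)
      simp only [hΦ, mem_ofPred_eq] at this
      simp only [Pi.sub_apply]
      linarith
    have h1 := (abs_le.1 hk₁).1
    have h2 := (abs_le.1 hk₂).2
    have h3 : 0 < 2 * M / τ := by positivity
    have h4 : 2 * B = 2 * K + 2 * (2 * M / τ) := by rw [hB]; ring
    linarith
  have ht₀ : t₀ ∈ Icc t₀ (t₀ + τ) := ⟨le_rfl, by linarith⟩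
  have hBs : 0 ≤ B * s ^ 2 := by positivity
  by_cases hx : ‖x‖ ≤ ρ + σ
  · have := hneg (x, s, t₀) ⟨by simpa using hx, hs, ht₀⟩
    simp only [hΦ, sub_self, mul_zero] at this
    linarith
  · push Not at hx
    rcases hs.2.eq_or_lt with h | h
    · have h2 := hwM x s t₀ ht₀
      rw [h] at h2 ⊢
      nlinarith
    · have h1 := hvanish x hx.le s ⟨hs.1, h⟩ t₀ ht₀
      rw [h1.1, h1.2, sub_self]
      exact mul_nonneg (by positivity) hs.1

/-- Interior gradient estimate. -/
theorem pd_le_of_parabolic (hτ : 0 < τ) (hM : 0 < M) (hρ : 0 ≤ ρ)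
    (hz : ∀ t ∈ Icc t₀ (t₀ + τ), ContDiff ℝ 2 fun x => z x t)
    (hc : ContinuousOn (fun p : EuclideanSpace ℝ (Fin n) × ℝ => z p.1 p.2)
      (univ ×ˢ Icc t₀ (t₀ + τ)))
    (h0 : ∀ x, ∀ t ∈ Icc t₀ (t₀ + τ), ρ < ‖x‖ → z x t = 0)
    (hb : ∀ x, ∀ t ∈ Icc t₀ (t₀ + τ), |z x t| ≤ M)
    (hK : ∀ x, ∀ t ∈ Ico t₀ (t₀ + τ), ∃ d, HasDerivWithinAt (z x) d (Ici t) t ∧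
      |slap (fun y => z y t) x + d| ≤ K) (hK0 : 0 ≤ K) (j : Fin n)
    (x : EuclideanSpace ℝ (Fin n)) :
    pd j (fun y => z y t₀) x ≤ K * √τ + 4 * M / √τ := by
  have ht₀ : t₀ ∈ Icc t₀ (t₀ + τ) := ⟨le_rfl, by linarith⟩
  have hσ0 : 0 < √τ := Real.sqrt_pos.2 hτ
  set A := K * √τ + 4 * M / √τ with hA
  have hA0 : 0 ≤ A := by positivity
  have hdz : Differentiable ℝ fun x => z x t₀ := (hz t₀ ht₀).differentiable (by norm_num)
  have hl1 : HasDerivAt (fun s : ℝ => A * s) A 0 := by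
    simpa using (hasDerivAt_id (0 : ℝ)).const_mul A
  have h1 := nonpos_of_hasDerivWithinAt_Ici (((hasDerivAt_line hdz j 1 x 0).sub
    (hasDerivAt_line hdz j (-1) x 0)).sub hl1).hasDerivWithinAt hσ0 fun s hs => by
      have := sub_le_of_parabolic hτ hM hρ hz hc h0 hb hK hK0 j x (s := s)
        ⟨hs.1.le, by linarith [hs.2]⟩
      simp only [Pi.sub_apply, one_mul, neg_one_mul, neg_smul, ← sub_eq_add_neg, mul_zero, zero_smul,
        add_zero, sub_zero]
      linarith
  simp only [mul_zero, zero_smul, add_zero] at h1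
  linarith

end MaximumPrinciple

section GradientContinuity

variable {n : ℕ}

theorem pd_comp_add_right (i : Fin n) (f : EuclideanSpace ℝ (Fin n) → ℝ)
    (k x : EuclideanSpace ℝ (Fin n)) : pd i (fun y => f (y + k)) x = pd i f (x + k) := by
  simp only [pd, fderiv_comp_add_right]

theorem slap_comp_add_right (f : EuclideanSpace ℝ (Fin n) → ℝ)
    (k x : EuclideanSpace ℝ (Fin n)) : slap (fun y => f (y + k)) x = slap f (x + k) := by
  simp only [slap_eq_sum_pd]
  refine Finset.sum_congr rfl fun i _ => ?_
  rw [show pd i (fun y => f (y + k)) = fun y => pd i f (y + k) from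
    funext fun y => pd_comp_add_right i f k y, pd_comp_add_right]

/-- A classical function on `ℝⁿ × [0, T]`, supported in `B_{7/2}`, with bounded `Δv + ∂ₜv`. -/
structure IsClassical (v : EuclideanSpace ℝ (Fin n) → ℝ → ℝ) (T L C : ℝ) : Prop where
  contDiff : ∀ t ∈ Icc 0 T, ContDiff ℝ 2 fun x => v x t
  supp : ∀ x t, 7 / 2 < ‖x‖ → v x t = 0
  cont : ContinuousOn (fun p : EuclideanSpace ℝ (Fin n) × ℝ => v p.1 p.2) (univ ×ˢ Icc 0 T)
  lip : ∀ t ∈ Icc 0 T, ∀ x y, |v x t - v y t| ≤ L * ‖x - y‖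
  time : ∀ x, ∀ t ∈ Ico 0 T, ∃ d, HasDerivWithinAt (v x) d (Ici t) t ∧
    |slap (fun y => v y t) x + d| ≤ C

variable {v : EuclideanSpace ℝ (Fin n) → ℝ → ℝ} {T L C : ℝ}

theorem IsClassical.pd_sub_le (h : IsClassical v T L C) (hL : 0 < L) (hC : 0 ≤ C) (j : Fin n)
    {t : ℝ} (ht : t ∈ Icc 0 (T / 2)) (x k : EuclideanSpace ℝ (Fin n)) (hk : ‖k‖ ≤ T / 2) :
    |pd j (fun y => v y t) (x + k) - pd j (fun y => v y t) x| ≤ (2 * C + 4 * L) * √‖k‖ := by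
  have main : ∀ (x k : EuclideanSpace ℝ (Fin n)), ‖k‖ ≤ T / 2 →
      pd j (fun y => v y t) (x + k) - pd j (fun y => v y t) x ≤ (2 * C + 4 * L) * √‖k‖ := by
    intro x k hk
    rcases eq_or_ne k 0 with rfl | hk0
    · simp
    have hkp : 0 < ‖k‖ := norm_pos_iff.2 hk0
    have hsub : Icc t (t + ‖k‖) ⊆ Icc 0 T := Icc_subset_Icc ht.1 (by linarith [ht.2])
    have hsub' : Ico t (t + ‖k‖) ⊆ Ico 0 T := Ico_subset_Ico ht.1 (by linarith [ht.2])
    have hshift : ∀ s ∈ Icc 0 T, ContDiff ℝ 2 fun y => v (y + k) s := fun s hs =>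
      (h.contDiff s hs).comp (contDiff_id.add contDiff_const)
    have := pd_le_of_parabolic (z := fun y s => v (y + k) s - v y s) (t₀ := t) (τ := ‖k‖)
      (K := 2 * C) (M := L * ‖k‖) (ρ := 7 / 2 + ‖k‖) hkp (by positivity) (by positivity)
      (fun s hs => (hshift s (hsub hs)).sub (h.contDiff s (hsub hs)))
      ((h.cont.comp (f := fun p : EuclideanSpace ℝ (Fin n) × ℝ => (p.1 + k, p.2))
        (by fun_prop) fun p hp => ⟨mem_univ _, hsub hp.2⟩).sub
        (h.cont.mono (prod_mono subset_rfl hsub)))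
      (fun y s _ hy => by
        have h1 : 7 / 2 < ‖y + k‖ := by
          have := norm_sub_norm_le y (-k)
          rw [norm_neg, sub_neg_eq_add] at this
          linarith
        rw [h.supp _ s h1, h.supp y s (by linarith), sub_zero])
      (fun y s hs => by simpa using h.lip s (hsub hs) (y + k) y)
      (fun y s hs => by
        obtain ⟨d₁, hd₁, hc₁⟩ := h.time (y + k) s (hsub' hs)
        obtain ⟨d₂, hd₂, hc₂⟩ := h.time y s (hsub' hs)
        have hs' := hsub (Ico_subset_Icc_self hs)
        refine ⟨d₁ - d₂, hd₁.sub hd₂, ?_⟩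
        rw [slap_sub (hshift s hs').contDiffAt (h.contDiff s hs').contDiffAt,
          slap_comp_add_right (fun y => v y s)]
        rw [abs_le] at *
        constructor <;> linarith [hc₁.1, hc₁.2, hc₂.1, hc₂.2])
      (by positivity) j x
    have hs' : t ∈ Icc 0 T := hsub ⟨le_rfl, by linarith⟩
    rw [pd_sub j ((hshift t hs').differentiable (by norm_num) x)
      ((h.contDiff t hs').differentiable (by norm_num) x),
      pd_comp_add_right j (fun y => v y t)] at this
    refine this.trans_eq ?_
    have h2 : ‖k‖ / √‖k‖ = √‖k‖ := Real.div_sqrt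
    rw [add_mul, mul_div_assoc, mul_div_assoc, h2]
    ring
  refine abs_le.2 ⟨?_, main x k hk⟩
  have := main (x + k) (-k) (by rwa [norm_neg])
  rw [norm_neg, add_neg_cancel_right] at this
  linarith

theorem IsClassical.continuousOn_pd (h : IsClassical v T L C) (hT : 0 < T) (hL : 0 < L)
    (hC : 0 ≤ C) (j : Fin n) :
    ContinuousOn (fun p : EuclideanSpace ℝ (Fin n) × ℝ => pd j (fun y => v y p.2) p.1)
      (univ ×ˢ Icc 0 (T / 2)) := by
  refine continuousOn_of_uniform_approx_of_continuousOn fun U hU => ?_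
  obtain ⟨ε, hε, hεU⟩ := Metric.mem_uniformity_dist.1 hU
  have hlim : Filter.Tendsto (fun s : ℝ => (2 * C + 4 * L) * √s) (nhdsWithin 0 (Ioi 0))
      (nhds 0) := by
    have : Continuous fun s : ℝ => (2 * C + 4 * L) * √s := by fun_prop
    simpa using (this.tendsto 0).mono_left nhdsWithin_le_nhds
  obtain ⟨s, hs1, hs2⟩ := ((hlim.eventually_lt_const hε).and
    (Ioo_mem_nhdsGT (show (0 : ℝ) < T / 2 by positivity))).exists
  set e : EuclideanSpace ℝ (Fin n) := EuclideanSpace.single j 1 with he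
  have hen : ‖e‖ = 1 := by simp [he]
  have hsub : univ ×ˢ Icc 0 (T / 2) ⊆ (univ : Set (EuclideanSpace ℝ (Fin n))) ×ˢ Icc 0 T :=
    prod_mono subset_rfl (Icc_subset_Icc le_rfl (by linarith))
  refine ⟨fun p => (v (p.1 + s • e) p.2 - v p.1 p.2) / s,
    ((h.cont.comp (f := fun p : EuclideanSpace ℝ (Fin n) × ℝ => (p.1 + s • e, p.2))
      (by fun_prop) fun p hp => ⟨mem_univ _, (hsub hp).2⟩).sub (h.cont.mono hsub)).div_const s, ?_⟩
  rintro ⟨x, t⟩ ⟨-, ht⟩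
  refine hεU ?_
  have hd := fun r => hasDerivAt_line ((h.contDiff t (hsub ⟨mem_univ x, ht⟩).2).differentiable
    (by norm_num)) j 1 x r
  obtain ⟨r, hr, hreq⟩ := exists_hasDerivAt_eq_slope _ _ hs2.1
    (fun r _ => (hd r).continuousAt.continuousWithinAt) (fun r _ => hd r)
  have h1 : ‖r • e‖ = r := by rw [norm_smul, hen, mul_one, Real.norm_of_nonneg hr.1.le]
  have h2 := h.pd_sub_le hL hC j ht x (r • e) (by rw [h1]; linarith [hr.2, hs2.2])
  simp only [one_mul, zero_smul, add_zero, sub_zero, ← he] at hreq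
  rw [dist_comm, Real.dist_eq]
  beta_reduce
  rw [← hreq]
  refine h2.trans_lt (lt_of_le_of_lt ?_ hs1)
  rw [h1]
  have := Real.sqrt_le_sqrt hr.2.le
  gcongr

end GradientContinuity

section Stability

variable {n : ℕ}

/-- `w` is `C²` in space and `|Δw + ∂ₜw| ≤ k` on the cylinder `B_δ(x₀) × [t₀, t₀ + δ)`. -/
structure IsSourceBounded (w : EuclideanSpace ℝ (Fin n) → ℝ → ℝ) (x₀ : EuclideanSpace ℝ (Fin n))
    (t₀ δ k : ℝ) : Prop where
  contDiff : ∀ t ∈ Icc t₀ (t₀ + δ), ContDiff ℝ 2 fun x => w x t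
  time : ∀ x ∈ closedBall x₀ δ, ∀ t ∈ Ico t₀ (t₀ + δ), ∃ d, HasDerivWithinAt (w x) d (Ici t) t ∧
    |slap (fun y => w y t) x + d| ≤ k

variable {V w : EuclideanSpace ℝ (Fin n) → ℝ → ℝ} {x₀ : EuclideanSpace ℝ (Fin n)} {t₀ δ k : ℝ}

theorem continuous_src_uncurry
    (hV : ContDiff ℝ 3 fun p : EuclideanSpace ℝ (Fin n) × ℝ => V p.1 p.2) :
    Continuous fun p : EuclideanSpace ℝ (Fin n) × ℝ => src V p.2 p.1 := by
  refine Continuous.add ?_ (contDiff_deriv_slice (m := 2) (by norm_num) hV).continuous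
  simp only [slap_eq_sum_pd]
  refine continuous_finsetSum _ fun i _ => ?_
  exact (contDiff_pd_slice (m := 1) (k := 2) (F := fun x t => pd i (fun y => V y t) x) (by norm_num)
    (contDiff_pd_slice (m := 2) (by norm_num) hV i) i).continuous

theorem IsSourceBounded.neg (h : IsSourceBounded w x₀ t₀ δ k) :
    IsSourceBounded (fun x t => -w x t) x₀ t₀ δ k where
  contDiff t ht := (h.contDiff t ht).neg
  time x hx t ht := by
    obtain ⟨d, hd, hk⟩ := h.time x hx t ht
    refine ⟨-d, hd.neg, ?_⟩
    have := slap_const_mul (-1) (h.contDiff t (Ico_subset_Icc_self ht)).contDiffAt (x := x)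
    simp only [neg_one_mul] at this
    rwa [this, ← neg_add, abs_neg]

theorem src_le_of_isMaxOn {c ρ : ℝ} (hρ : 0 < ρ) (hc : 0 < c)
    (hV : ContDiff ℝ 3 fun p : EuclideanSpace ℝ (Fin n) × ℝ => V p.1 p.2)
    (hw : IsSourceBounded w x₀ t₀ ρ k)
    (hwc : ContinuousOn (fun p : EuclideanSpace ℝ (Fin n) × ℝ => w p.1 p.2)
      (closedBall x₀ ρ ×ˢ Icc t₀ (t₀ + ρ)))
    (hclose : ∀ x ∈ closedBall x₀ ρ, ∀ t ∈ Icc t₀ (t₀ + ρ), |w x t - V x t| < c * ρ ^ 2 / 2) :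
    ∃ x ∈ closedBall x₀ ρ, ∃ t ∈ Icc t₀ (t₀ + ρ), src V t x ≤ k + 2 * c * (n + ρ) := by
  set S := closedBall x₀ ρ ×ˢ Icc t₀ (t₀ + ρ) with hS
  set Φ : EuclideanSpace ℝ (Fin n) × ℝ → ℝ := fun p =>
    V p.1 p.2 - w p.1 p.2 - c * (‖p.1 - x₀‖ ^ 2 + (p.2 - t₀) ^ 2) with hΦ
  have hΦc : ContinuousOn Φ S :=
    (hV.continuous.continuousOn.sub hwc).sub (by fun_prop)
  have hp₀ : (x₀, t₀) ∈ S := ⟨by simpa using hρ.le, ⟨le_rfl, by linarith⟩⟩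
  obtain ⟨⟨x, t⟩, ⟨hx, ht⟩, hmax⟩ :=
    ((isCompact_closedBall x₀ ρ).prod isCompact_Icc).exists_isMaxOn ⟨_, hp₀⟩ hΦc
  simp only at hx ht
  have h0 := hmax hp₀
  simp only [hΦ, mem_ofPred_eq, sub_self, norm_zero] at h0
  have h1 := (abs_lt.1 (hclose x₀ hp₀.1 t₀ hp₀.2)).2
  have h2 := (abs_lt.1 (hclose x hx t ht)).1
  have h3 : ‖x - x₀‖ ^ 2 + (t - t₀) ^ 2 < ρ ^ 2 := by
    refine lt_of_mul_lt_mul_left ?_ hc.le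
    linarith
  have hx1 : ‖x - x₀‖ < ρ := by
    refine lt_of_pow_lt_pow_left₀ 2 hρ.le ?_
    nlinarith [sq_nonneg (t - t₀)]
  have ht1 : t - t₀ < ρ := by
    refine lt_of_pow_lt_pow_left₀ 2 hρ.le ?_
    nlinarith [sq_nonneg ‖x - x₀‖]
  refine ⟨x, hx, t, ht, ?_⟩
  have hVt : ContDiff ℝ 2 fun x => V x t := (hV.slice_left t).of_le (by norm_num)
  have hwt := hw.contDiff t ht
  have hspace : ∀ i, pd i (pd i fun y => V y t) x - pd i (pd i fun y => w y t) x - 2 * c ≤ 0 := by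
    intro i
    set e : EuclideanSpace ℝ (Fin n) := EuclideanSpace.single i 1 with he
    have hen : ‖e‖ = 1 := by simp [he]
    set a := inner ℝ (x - x₀) e with ha
    have hl : IsLocalMax (fun h : ℝ => V (x + (1 * h) • e) t - w (x + (1 * h) • e) t
        - c * (2 * a * h + h ^ 2)) 0 := by
      have hcont : ContinuousAt (fun h : ℝ => x + h • e) 0 := by fun_prop
      have hev : ∀ᶠ h : ℝ in nhds 0, x + h • e ∈ ball x₀ ρ :=
        hcont.eventually_mem (isOpen_ball.mem_nhds (by simpa [dist_eq_norm] using hx1))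
      filter_upwards [hev] with h hh
      have := hmax (show (x + h • e, t) ∈ S from ⟨ball_subset_closedBall hh, ht⟩)
      simp only [hΦ, mem_ofPred_eq] at this
      have hn : ‖x + h • e - x₀‖ ^ 2 = ‖x - x₀‖ ^ 2 + (2 * a * h + h ^ 2) := by
        rw [add_sub_right_comm, norm_add_sq_real, inner_smul_right, norm_smul, hen, mul_one,
          Real.norm_eq_abs, sq_abs, ← ha]
        ring
      rw [hn] at this
      simp only [one_mul, zero_smul, add_zero]
      linarith
    have d1 := fun s => hasDerivAt_line (hVt.differentiable (by norm_num)) i 1 x s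
    have d2 := fun s => hasDerivAt_line (hwt.differentiable (by norm_num)) i 1 x s
    have d3 : ∀ s : ℝ, HasDerivAt (fun h : ℝ => c * (2 * a * h + h ^ 2)) (c * (2 * a + 2 * s)) s :=
      fun s => by
        simpa using (((hasDerivAt_id s).const_mul (2 * a)).add (hasDerivAt_pow 2 s)).const_mul c
    have e1 := hasDerivAt_line ((contDiff_pd (m := 1) i hVt (by norm_num)).differentiable
      (by norm_num)) i 1 x 0
    have e2 := hasDerivAt_line ((contDiff_pd (m := 1) i hwt (by norm_num)).differentiable
      (by norm_num)) i 1 x 0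
    have e3 : HasDerivAt (fun s : ℝ => c * (2 * a + 2 * s)) (c * 2) 0 := by
      simpa using (((hasDerivAt_id (0 : ℝ)).const_mul 2).const_add (2 * a)).const_mul c
    have := nonpos_of_isLocalMax hl (fun s => ((d1 s).sub (d2 s)).sub (d3 s))
      (((e1.const_mul 1).sub (e2.const_mul 1)).sub e3)
    simp only [one_mul, zero_smul, add_zero] at this
    linarith
  have hlap : slap (fun y => V y t) x - slap (fun y => w y t) x - n * (2 * c) ≤ 0 := by
    have := Finset.sum_nonpos fun i (_ : i ∈ Finset.univ) => hspace i
    simpa [Finset.sum_sub_distrib, slap_eq_sum_pd] using this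
  obtain ⟨d, hd, hk⟩ := hw.time x hx t ⟨ht.1, by linarith⟩
  have hVd : HasDerivAt (V x) (deriv (V x) t) t :=
    ((hV.slice_right x).differentiable (by norm_num) t).hasDerivAt
  have hq : HasDerivAt (fun s => c * (s - t₀) ^ 2) (c * (2 * (t - t₀))) t := by
    simpa using (((hasDerivAt_id t).sub_const t₀).pow 2).const_mul c
  have htime := nonpos_of_hasDerivWithinAt_Ici
    ((hVd.hasDerivWithinAt.sub hd).sub hq.hasDerivWithinAt)
    (show 0 < t₀ + ρ - t by linarith) fun r hr => by
      have := hmax (show (x, r) ∈ S from ⟨hx, by linarith [hr.1, ht.1], by linarith [hr.2]⟩)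
      simp only [hΦ, mem_ofPred_eq] at this
      simp only [Pi.sub_apply]
      linarith
  have h5 := (abs_le.1 hk).2
  have h6 : c * (t - t₀) ≤ c * ρ := by gcongr
  rw [src]
  linarith

theorem src_le_of_approx (hδ : 0 < δ)
    (hV : ContDiff ℝ 3 fun p : EuclideanSpace ℝ (Fin n) × ℝ => V p.1 p.2)
    (H : ∀ η > 0, ∃ w, IsSourceBounded w x₀ t₀ δ k ∧
      ContinuousOn (fun p : EuclideanSpace ℝ (Fin n) × ℝ => w p.1 p.2)
        (closedBall x₀ δ ×ˢ Icc t₀ (t₀ + δ)) ∧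
      ∀ x ∈ closedBall x₀ δ, ∀ t ∈ Icc t₀ (t₀ + δ), |w x t - V x t| < η) :
    src V t₀ x₀ ≤ k := by
  refine le_of_forall_pos_lt_add fun α hα => ?_
  by_contra! hlt
  have hev := (continuous_src_uncurry hV).continuousAt.eventually_const_lt
    (show k + α / 2 < (fun p : EuclideanSpace ℝ (Fin n) × ℝ => src V p.2 p.1) (x₀, t₀) from by
      simp only; linarith)
  obtain ⟨r, hr, hball⟩ := Metric.eventually_nhds_iff.1 hev
  obtain ⟨ρ, hρ0, hρ⟩ := exists_between (lt_min hr hδ)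
  have hρr : ρ < r := hρ.trans_le (min_le_left _ _)
  have hρδ : ρ < δ := hρ.trans_le (min_le_right _ _)
  set c := α / (4 * (n + ρ)) with hc
  have hc0 : 0 < c := by positivity
  obtain ⟨w, hw, hwc, hclose⟩ := H (c * ρ ^ 2 / 2) (by positivity)
  have hB : closedBall x₀ ρ ⊆ closedBall x₀ δ := closedBall_subset_closedBall hρδ.le
  have hI : Icc t₀ (t₀ + ρ) ⊆ Icc t₀ (t₀ + δ) := Icc_subset_Icc_right (by linarith)
  obtain ⟨x, hx, t, ht, hle⟩ := src_le_of_isMaxOn hρ0 hc0 hV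
    ⟨fun t ht => hw.contDiff t (hI ht), fun x hx t ht => hw.time x (hB hx) t
      ⟨ht.1, by linarith [ht.2]⟩⟩ (hwc.mono (prod_mono hB hI))
    fun x hx t ht => hclose x (hB hx) t (hI ht)
  have h1 := hball (y := (x, t)) (by
    rw [Prod.dist_eq]
    refine max_lt ((mem_closedBall.1 hx).trans_lt hρr) ?_
    rw [Real.dist_eq, abs_of_nonneg (by linarith [ht.1])]
    linarith [ht.2])
  have h2 : 2 * c * (n + ρ) = α / 2 := by rw [hc]; field_simp; ring
  simp only at h1
  linarith

theorem abs_src_le_of_approx (hδ : 0 < δ)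
    (hV : ContDiff ℝ 3 fun p : EuclideanSpace ℝ (Fin n) × ℝ => V p.1 p.2)
    (H : ∀ η > 0, ∃ w, IsSourceBounded w x₀ t₀ δ k ∧
      ContinuousOn (fun p : EuclideanSpace ℝ (Fin n) × ℝ => w p.1 p.2)
        (closedBall x₀ δ ×ˢ Icc t₀ (t₀ + δ)) ∧
      ∀ x ∈ closedBall x₀ δ, ∀ t ∈ Icc t₀ (t₀ + δ), |w x t - V x t| < η) :
    |src V t₀ x₀| ≤ k := by
  refine abs_le.2 ⟨?_, src_le_of_approx hδ hV H⟩
  have h1 := src_le_of_approx (V := fun x t => -V x t) (k := k) (x₀ := x₀) (t₀ := t₀) hδ hV.neg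
    fun η hη => by
    obtain ⟨w, hw, hwc, hclose⟩ := H η hη
    refine ⟨fun x t => -w x t, hw.neg, hwc.neg, fun x hx t ht => ?_⟩
    rw [← neg_sub', abs_neg]
    exact hclose x hx t ht
  have h2 : src (fun x t => -V x t) t₀ x₀ = -src V t₀ x₀ := by
    have e1 := slap_const_mul (-1) (x := x₀)
      ((hV.slice_left t₀).of_le (by norm_num : (2 : WithTop ℕ∞) ≤ 3)).contDiffAt
    simp only [neg_one_mul] at e1
    have e2 : deriv (fun t => -V x₀ t) t₀ = -deriv (V x₀) t₀ := deriv.fun_neg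
    simp only [src, e1, e2]
    ring
  linarith

end Stability

section Mollification

variable {n : ℕ} {φ : ContDiffBump (0 : EuclideanSpace ℝ (Fin n) × ℝ)}
  {g : EuclideanSpace ℝ (Fin n) × ℝ → ℝ}

instance : Measure.IsAddHaarMeasure (volume : Measure (EuclideanSpace ℝ (Fin n) × ℝ)) :=
  Measure.prod.instIsAddHaarMeasure volume volume

/-- The mollification of `g` by the normalized bump `φ`. -/
noncomputable def mollify (φ : ContDiffBump (0 : EuclideanSpace ℝ (Fin n) × ℝ))
    (g : EuclideanSpace ℝ (Fin n) × ℝ → ℝ) (p : EuclideanSpace ℝ (Fin n) × ℝ) : ℝ :=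
  ∫ q, φ.normed volume q * g (p - q)

theorem contDiff_mollify (hg : Continuous g) : ContDiff ℝ 3 (mollify φ g) :=
  φ.hasCompactSupport_normed.contDiff_convolution_left (n := 3) (ContinuousLinearMap.lsmul ℝ ℝ)
    (φ.contDiff_normed (n := 3)) hg.locallyIntegrable

theorem abs_mollify_sub_le (hg : Continuous g) {p : EuclideanSpace ℝ (Fin n) × ℝ} {ω : ℝ}
    (h : ∀ q, dist q p < φ.rOut → |g q - g p| ≤ ω) : |mollify φ g p - g p| ≤ ω :=
  φ.dist_normed_convolution_le hg.aestronglyMeasurable fun q hq => h q hq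

theorem integrable_mollify (hg : Continuous g) (p : EuclideanSpace ℝ (Fin n) × ℝ) :
    Integrable fun q => φ.normed volume q * g (p - q) :=
  (φ.continuous_normed.mul (by fun_prop)).integrable_of_hasCompactSupport
    φ.hasCompactSupport_normed.mul_right

theorem abs_mollify_le {M : ℝ} (h : ∀ p, |g p| ≤ M)
    (p : EuclideanSpace ℝ (Fin n) × ℝ) : |mollify φ g p| ≤ M := by
  have h1 := norm_integral_le_of_norm_le (f := fun q => φ.normed volume q * g (p - q))
    (g := fun q => φ.normed volume q * M) (φ.integrable_normed.mul_const M)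
    (Filter.Eventually.of_forall fun q => by
      rw [norm_mul, Real.norm_of_nonneg (φ.nonneg_normed q)]
      exact mul_le_mul_of_nonneg_left (h _) (φ.nonneg_normed q))
  rw [integral_mul_const, φ.integral_normed, one_mul] at h1
  exact h1

theorem norm_lt_of_normed_ne_zero {q : EuclideanSpace ℝ (Fin n) × ℝ}
    (hq : φ.normed volume q ≠ 0) : ‖q.1‖ < φ.rOut ∧ |q.2| < φ.rOut := by
  have h1 : q ∈ ball 0 φ.rOut := by
    rw [← φ.support_normed_eq (μ := volume)]; exact hq
  have h2 := mem_ball_zero_iff.1 h1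
  exact ⟨(norm_fst_le q).trans_lt h2, (norm_snd_le q).trans_lt h2⟩

theorem mollify_eq_zero {ρ : ℝ} (h : ∀ x t, ρ < ‖x‖ → g (x, t) = 0)
    {p : EuclideanSpace ℝ (Fin n) × ℝ} (hp : ρ + φ.rOut < ‖p.1‖) : mollify φ g p = 0 := by
  refine integral_eq_zero_of_ae (Filter.Eventually.of_forall fun q => ?_)
  by_cases hq : φ.normed volume q = 0
  · simp [hq]
  · have h1 := (norm_lt_of_normed_ne_zero hq).1
    have h2 := norm_sub_norm_le p.1 q.1
    have h3 : g (p - q) = 0 := h (p.1 - q.1) (p.2 - q.2) (by linarith)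
    simp [h3]

theorem pd_mollify {g' : EuclideanSpace ℝ (Fin n) × ℝ → ℝ} {L : ℝ} (hg : Continuous g)
    (hg' : Continuous g') (hL : ∀ p, |g' p| ≤ L) (i : Fin n)
    (hd : ∀ t, Differentiable ℝ fun x => g (x, t))
    (hgd : ∀ x t, pd i (fun y => g (y, t)) x = g' (x, t))
    (x : EuclideanSpace ℝ (Fin n)) (t : ℝ) :
    pd i (fun y => mollify φ g (y, t)) x = mollify φ g' (x, t) := by
  set e : EuclideanSpace ℝ (Fin n) := EuclideanSpace.single i 1 with he
  have h1 := hasDerivAt_integral_of_dominated_loc_of_deriv_le (μ := volume) (𝕜 := ℝ) (x₀ := (0 : ℝ))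
    (F := fun (s : ℝ) q => φ.normed volume q * g ((x + (1 * s) • e, t) - q))
    (F' := fun (s : ℝ) q => φ.normed volume q * g' ((x + (1 * s) • e, t) - q))
    (bound := fun q => φ.normed volume q * L) (s := univ) Filter.univ_mem
    (Filter.Eventually.of_forall fun s => (integrable_mollify hg _).aestronglyMeasurable)
    (integrable_mollify hg _) (integrable_mollify hg' _).aestronglyMeasurable
    (Filter.Eventually.of_forall fun q s _ => by
      rw [norm_mul, Real.norm_of_nonneg (φ.nonneg_normed q)]
      exact mul_le_mul_of_nonneg_left (hL _) (φ.nonneg_normed q))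
    (φ.integrable_normed.mul_const L)
    (Filter.Eventually.of_forall fun q s _ => by
      have := hasDerivAt_line (hd (t - q.2)) i 1 (x - q.1) s
      rw [hgd, one_mul] at this
      refine HasDerivAt.const_mul _ ?_
      simp only [sub_add_eq_add_sub] at this
      exact this)
  have hm : Differentiable ℝ fun y => mollify φ g (y, t) :=
    ((contDiff_mollify hg).slice_left (F := fun x t => mollify φ g (x, t)) t).differentiable
      (by norm_num)
  have h2 := hasDerivAt_line hm i 1 x 0
  have h3 := h2.unique h1.2
  simpa [mollify] using h3

theorem mollify_add_right (p₁ p₂ : EuclideanSpace ℝ (Fin n) × ℝ) :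
    mollify φ g (p₁ + p₂) = mollify φ (fun p => g (p + p₂)) p₁ := by
  simp only [mollify]
  refine integral_congr_ae (Filter.Eventually.of_forall fun q => ?_)
  simp only [add_sub_right_comm]

/-- The probability measure with density the normalized bump. -/
noncomputable def bumpMeasure (φ : ContDiffBump (0 : EuclideanSpace ℝ (Fin n) × ℝ)) :
    Measure (EuclideanSpace ℝ (Fin n) × ℝ) :=
  volume.withDensity fun q => ENNReal.ofReal (φ.normed volume q)

instance : IsProbabilityMeasure (bumpMeasure φ) where
  measure_univ := by
    rw [bumpMeasure, withDensity_apply _ MeasurableSet.univ, setLIntegral_univ,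
      ← ofReal_integral_eq_lintegral_ofReal φ.integrable_normed
        (Filter.Eventually.of_forall φ.nonneg_normed), φ.integral_normed, ENNReal.ofReal_one]

theorem integral_bumpMeasure (f : EuclideanSpace ℝ (Fin n) × ℝ → ℝ) :
    ∫ q, f q ∂bumpMeasure φ = ∫ q, φ.normed volume q * f q := by
  rw [bumpMeasure, integral_withDensity_eq_integral_toReal_smul
    (φ.continuous_normed.measurable.ennreal_ofReal) (by simp)]
  simp only [ENNReal.toReal_ofReal (φ.nonneg_normed _), smul_eq_mul]

theorem ae_bumpMeasure {P : EuclideanSpace ℝ (Fin n) × ℝ → Prop}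
    (h : ∀ q, ‖q.1‖ < φ.rOut → |q.2| < φ.rOut → P q) : ∀ᵐ q ∂bumpMeasure φ, P q := by
  rw [bumpMeasure, ae_withDensity_iff φ.continuous_normed.measurable.ennreal_ofReal]
  refine Filter.Eventually.of_forall fun q hq => ?_
  have h1 := norm_lt_of_normed_ne_zero (φ := φ) (q := q) fun h0 => hq (by rw [h0, ENNReal.ofReal_zero])
  exact h q h1.1 h1.2

/-- Mollification is a limit of convex combinations of translates. -/
theorem exists_convex_approx {S : Set (EuclideanSpace ℝ (Fin n) × ℝ)} (hS : IsCompact S)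
    (hg : Continuous g) {M : ℝ} (hM : ∀ p, |g p| ≤ M) (A : Set C(S, ℝ)) (hA : Convex ℝ A)
    (h : ∀ q, ‖q.1‖ < φ.rOut → |q.2| < φ.rOut → ∃ f ∈ A, ∀ p : S, f p = g (p - q)) {η : ℝ}
    (hη : 0 < η) : ∃ f ∈ A, ∀ p : S, |f p - mollify φ g p| < η := by
  have := isCompact_iff_compactSpace.1 hS
  let F : C(EuclideanSpace ℝ (Fin n) × ℝ, C(S, ℝ)) :=
    ContinuousMap.curry ⟨fun z : (EuclideanSpace ℝ (Fin n) × ℝ) × S => g (z.2 - z.1), by fun_prop⟩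
  have hF : ∀ q (p : S), F q p = g (p - q) := fun q p => rfl
  have hM0 : 0 ≤ M := (abs_nonneg _).trans (hM 0)
  have hFi : Integrable F (bumpMeasure φ) :=
    Integrable.of_bound F.continuous.aestronglyMeasurable M (Filter.Eventually.of_forall fun q =>
      (ContinuousMap.norm_le _ hM0).2 fun p => hM _)
  have hmem : ∫ q, F q ∂bumpMeasure φ ∈ closure A := by
    refine hA.closure.integral_mem isClosed_closure (ae_bumpMeasure fun q h1 h2 => ?_) hFi
    obtain ⟨f, hfA, hf⟩ := h q h1 h2
    have : F q = f := ContinuousMap.ext fun p => by rw [hF, hf]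
    rw [this]
    exact subset_closure hfA
  obtain ⟨f, hfA, hf⟩ := Metric.mem_closure_iff.1 hmem η hη
  refine ⟨f, hfA, fun p => ?_⟩
  have h1 := (ContinuousMap.dist_lt_iff hη).1 hf p
  rw [ContinuousMap.integral_apply hFi, integral_bumpMeasure, dist_comm] at h1
  exact h1

end Mollification

section MollifiedSource

variable {n : ℕ} {φ : ContDiffBump (0 : EuclideanSpace ℝ (Fin n) × ℝ)}
  {g : EuclideanSpace ℝ (Fin n) × ℝ → ℝ} {x₀ : EuclideanSpace ℝ (Fin n)} {t₀ k δ M : ℝ}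

theorem IsSourceBounded.convexComb {w₁ w₂ : EuclideanSpace ℝ (Fin n) → ℝ → ℝ}
    (h₁ : IsSourceBounded w₁ x₀ t₀ δ k) (h₂ : IsSourceBounded w₂ x₀ t₀ δ k) {a b : ℝ}
    (ha : 0 ≤ a) (hb : 0 ≤ b) (hab : a + b = 1) :
    IsSourceBounded (fun x t => a * w₁ x t + b * w₂ x t) x₀ t₀ δ k where
  contDiff t ht := (contDiff_const.mul (h₁.contDiff t ht)).add
    (contDiff_const.mul (h₂.contDiff t ht))
  time x hx t ht := by
    obtain ⟨d₁, hd₁, hk₁⟩ := h₁.time x hx t ht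
    obtain ⟨d₂, hd₂, hk₂⟩ := h₂.time x hx t ht
    have c₁ := (h₁.contDiff t (Ico_subset_Icc_self ht)).contDiffAt (x := x)
    have c₂ := (h₂.contDiff t (Ico_subset_Icc_self ht)).contDiffAt (x := x)
    refine ⟨a * d₁ + b * d₂, (hd₁.const_mul a).add (hd₂.const_mul b), ?_⟩
    rw [slap_add (contDiffAt_const.mul c₁) (contDiffAt_const.mul c₂), slap_const_mul a c₁,
      slap_const_mul b c₂]
    rw [abs_le] at *
    have e : k = a * k + b * k := by rw [← add_mul, hab, one_mul]
    have i1 := mul_le_mul_of_nonneg_left hk₁.1 ha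
    have i2 := mul_le_mul_of_nonneg_left hk₁.2 ha
    have i3 := mul_le_mul_of_nonneg_left hk₂.1 hb
    have i4 := mul_le_mul_of_nonneg_left hk₂.2 hb
    constructor <;> linarith

theorem abs_src_mollify_le (hg : Continuous g) (hM : ∀ p, |g p| ≤ M)
    (hg2 : ∀ t ∈ Icc t₀ (t₀ + 4 * φ.rOut), ContDiff ℝ 2 fun x => g (x, t))
    (htime : ∀ x ∈ closedBall x₀ (2 * φ.rOut), ∀ t ∈ Ico t₀ (t₀ + 4 * φ.rOut),
      ∃ d, HasDerivWithinAt (fun s => g (x, s)) d (Ici t) t ∧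
        |slap (fun y => g (y, t)) x + d| ≤ k) :
    |src (fun x t => mollify φ g (x, t + 2 * φ.rOut)) t₀ x₀| ≤ k := by
  have hε := φ.rOut_pos
  set ε := φ.rOut with hεdef
  refine abs_src_le_of_approx hε ((contDiff_mollify hg).comp
    (contDiff_fst.prodMk (contDiff_snd.add contDiff_const))) fun η hη => ?_
  set S := closedBall x₀ ε ×ˢ Icc t₀ (t₀ + ε) with hS
  let A : Set C(S, ℝ) := {f | ∃ w, IsSourceBounded w x₀ t₀ ε k ∧ ∀ p : S, f p = w p.1.1 p.1.2}
  have hA : Convex ℝ A := by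
    rintro f₁ ⟨w₁, hw₁, hf₁⟩ f₂ ⟨w₂, hw₂, hf₂⟩ a b ha hb hab
    exact ⟨_, hw₁.convexComb hw₂ ha hb hab, fun p => by simp [hf₁, hf₂]⟩
  obtain ⟨f, ⟨w, hw, hfw⟩, hf⟩ := exists_convex_approx (φ := φ) (S := S)
    (g := fun p => g (p + (0, 2 * ε))) ((isCompact_closedBall _ _).prod isCompact_Icc)
    (by fun_prop) (fun p => hM _) A hA (fun q h1 h2 => by
      rw [abs_lt] at h2
      refine ⟨⟨fun p : S => g (p.1 - q + (0, 2 * ε)), by fun_prop⟩,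
        ⟨fun x t => g (x - q.1, t - q.2 + 2 * ε), ⟨fun t ht => ?_, fun x hx t ht => ?_⟩,
          fun p => ?_⟩, fun p => rfl⟩
      · exact (hg2 (t - q.2 + 2 * ε) ⟨by linarith [ht.1], by linarith [ht.2]⟩).comp
          (contDiff_id.sub contDiff_const)
      · obtain ⟨d, hd, hk⟩ := htime (x - q.1) (by
            rw [mem_closedBall, dist_eq_norm] at hx ⊢
            have := norm_sub_le (x - x₀) q.1
            rw [sub_right_comm]
            linarith) (t - q.2 + 2 * ε) ⟨by linarith [ht.1], by linarith [ht.2]⟩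
        refine ⟨d, ?_, ?_⟩
        · have h3 : HasDerivWithinAt (fun s => s - q.2 + 2 * ε) 1 (Ici t) t :=
            (((hasDerivAt_id t).sub_const q.2).add_const (2 * ε)).hasDerivWithinAt
          have := HasDerivWithinAt.comp t hd h3 fun s (hs : t ≤ s) => by
            simp only [mem_Ici]; linarith
          rwa [mul_one] at this
        · have := slap_comp_add_right (fun y => g (y, t - q.2 + 2 * ε)) (-q.1) x
          simp only [← sub_eq_add_neg] at this
          rwa [this]
      · simp [Prod.add_def]) hη
  refine ⟨w, hw, ?_, fun x hx t ht => ?_⟩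
  · rw [continuousOn_iff_continuous_domRestrict]
    exact f.continuous.congr hfw
  · have := hf ⟨(x, t), hx, ht⟩
    rw [hfw, ← mollify_add_right] at this
    simpa using this

end MollifiedSource

section Approximation

variable {n : ℕ}

theorem abs_pd_le_of_lip {f : EuclideanSpace ℝ (Fin n) → ℝ} {L : ℝ} (hL : 0 ≤ L)
    (h : ∀ x y, |f x - f y| ≤ L * ‖x - y‖) (i : Fin n) (x : EuclideanSpace ℝ (Fin n)) :
    |pd i f x| ≤ L := by
  have h1 := norm_fderiv_le_of_lip' ℝ (f := f) (x₀ := x) hL (Filter.Eventually.of_forall fun y => h y x)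
  have h2 := (fderiv ℝ f x).le_of_opNorm_le h1 (EuclideanSpace.single i 1)
  simpa [pd] using h2

/-- The right-hand side `R² |u| + R |∇u|` of the differential inequality. -/
noncomputable def gradBound (R a : ℝ) (b : Fin n → ℝ) : ℝ := R ^ 2 * |a| + R * √(∑ i, b i ^ 2)

theorem gradBound_nonneg {R : ℝ} (hR : 0 ≤ R) (a : ℝ) (b : Fin n → ℝ) : 0 ≤ gradBound R a b := by
  unfold gradBound; positivity

theorem sqrt_sum_sq_le_add {b b' : Fin n → ℝ} {ω : ℝ} (hb : ∀ i, |b i - b' i| ≤ ω) :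
    √(∑ i, b i ^ 2) ≤ √(∑ i, b' i ^ 2) + n * ω := by
  have h1 := norm_le_norm_add_norm_sub' (WithLp.toLp 2 b : EuclideanSpace ℝ (Fin n))
    (WithLp.toLp 2 b')
  have h2 : ‖(WithLp.toLp 2 b - WithLp.toLp 2 b' : EuclideanSpace ℝ (Fin n))‖ ≤ n * ω := by
    set z := (WithLp.toLp 2 b - WithLp.toLp 2 b' : EuclideanSpace ℝ (Fin n)) with hz
    have : z = ∑ i, EuclideanSpace.single i (z i) := by
      ext j
      simp [Finset.sum_apply, Pi.single_apply]
    rw [this]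
    refine (norm_sum_le _ _).trans ?_
    refine (Finset.sum_le_card_nsmul _ _ ω fun i _ => ?_).trans_eq (by simp)
    simpa [hz] using hb i
  simp only [EuclideanSpace.norm_eq, Real.norm_eq_abs, sq_abs] at h1 h2
  linarith

theorem gradBound_le {R ω a a' : ℝ} {b b' : Fin n → ℝ} (hR : 0 ≤ R) (ha : |a - a'| ≤ ω)
    (hb : ∀ i, |b i - b' i| ≤ ω) :
    gradBound R a b ≤ gradBound R a' b' + (R ^ 2 + n * R) * ω := by
  have h1 : |a| ≤ |a'| + ω := by linarith [abs_sub_abs_le_abs_sub a a']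
  have h2 := mul_le_mul_of_nonneg_left (sqrt_sum_sq_le_add hb) hR
  have h3 := mul_le_mul_of_nonneg_left h1 (sq_nonneg R)
  unfold gradBound
  linarith

variable {v : EuclideanSpace ℝ (Fin n) → ℝ → ℝ} {R K L C ε : ℝ}

/-- The function `v`, extended in time by its values at the endpoints of `[0, T]`. -/
noncomputable def timeExtend (v : EuclideanSpace ℝ (Fin n) → ℝ → ℝ) (T : ℝ)
    (p : EuclideanSpace ℝ (Fin n) × ℝ) : ℝ := v p.1 (max 0 (min p.2 T))

theorem clamp_mem {T : ℝ} (hT : 0 ≤ T) (t : ℝ) : max 0 (min t T) ∈ Icc 0 T :=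
  ⟨le_max_left _ _, max_le hT (min_le_right _ _)⟩

theorem timeExtend_eq {T t : ℝ} (ht : t ∈ Icc 0 T) (x : EuclideanSpace ℝ (Fin n)) :
    timeExtend v T (x, t) = v x t := by
  simp only [timeExtend, min_eq_left ht.2, max_eq_right ht.1]

theorem continuous_comp_clamp {T : ℝ} (hT : 0 ≤ T)
    (h : ContinuousOn (fun p : EuclideanSpace ℝ (Fin n) × ℝ => v p.1 p.2) (univ ×ˢ Icc 0 T)) :
    Continuous (timeExtend v T) :=
  h.comp_continuous (f := fun p : EuclideanSpace ℝ (Fin n) × ℝ => (p.1, max 0 (min p.2 T)))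
    (by fun_prop) fun p => ⟨mem_univ _, clamp_mem hT p.2⟩

theorem exists_uniform_modulus {g : EuclideanSpace ℝ (Fin n) × ℝ → ℝ}
    {G : Fin n → EuclideanSpace ℝ (Fin n) × ℝ → ℝ} (hg : Continuous g) (hG : ∀ i, Continuous (G i))
    {Q : Set (EuclideanSpace ℝ (Fin n) × ℝ)} (hQ : IsCompact Q) {ω : ℝ} (hω : 0 < ω) :
    ∃ δ > 0, ∀ p ∈ Q, ∀ q, dist q p < δ → |g q - g p| ≤ ω ∧ ∀ i, |G i q - G i p| ≤ ω := by
  have hc : Continuous fun p => (g p, fun i => G i p) := hg.prodMk (continuous_pi hG)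
  obtain ⟨δ, hδ, h⟩ := Metric.mem_uniformity_dist.1
    (hQ.uniformContinuousAt_of_continuousAt _ (fun a _ => hc.continuousAt)
      (Metric.dist_mem_uniformity hω))
  refine ⟨δ, hδ, fun p hp q hq => ?_⟩
  have h1 : dist (g p, fun i => G i p) (g q, fun i => G i q) < ω := h (by rwa [dist_comm]) hp
  rw [dist_comm, Prod.dist_eq, max_lt_iff, dist_pi_lt_iff hω] at h1
  exact ⟨h1.1.le, fun i => (h1.2 i).le⟩

set_option maxHeartbeats 1000000 in
theorem exists_isApproxSol (hR : 1 ≤ R) (hK : 0 ≤ K) (h : IsClassical v (1 / R ^ 2) L C)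
    (hL : 0 < L) (hC : 0 ≤ C) (hb : ∀ x, ∀ t ∈ Icc 0 (1 / R ^ 2), |v x t| ≤ 1)
    (hs : ∀ x, ∀ t ∈ Ico 0 (1 / R ^ 2), ∃ d, HasDerivWithinAt (v x) d (Ici t) t ∧
      |slap (fun y => v y t) x + d| ≤ gradBound R (v x t) (fun i => pd i (fun y => v y t) x)
        + if 5 / 2 ≤ ‖x‖ then K * R else 0) (hε : 0 < ε) :
    ∃ V, IsApproxSol V R K ε ∧ ∀ x, |V x 0 - v x 0| ≤ ε := by
  set T := 1 / R ^ 2 with hT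
  have hR0 : 0 < R := by linarith
  have hT0 : 0 < T := by positivity
  have hT2 : 0 ≤ T / 2 := by positivity
  have hsub : Icc 0 (T / 2) ⊆ Icc 0 T := Icc_subset_Icc_right (by linarith)
  set g := timeExtend v (T / 2) with hg
  set G : Fin n → EuclideanSpace ℝ (Fin n) × ℝ → ℝ := fun i =>
    timeExtend (fun x t => pd i (fun y => v y t) x) (T / 2) with hG
  have hgc : Continuous g := continuous_comp_clamp hT2 (h.cont.mono (prod_mono subset_rfl hsub))
  have hGc : ∀ i, Continuous (G i) := fun i =>
    continuous_comp_clamp hT2 (h.continuousOn_pd hT0 hL hC i)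
  have hgb : ∀ p, |g p| ≤ 1 := fun p => hb _ _ (hsub (clamp_mem hT2 _))
  have hGb : ∀ i p, |G i p| ≤ L := fun i p =>
    abs_pd_le_of_lip hL.le (h.lip _ (hsub (clamp_mem hT2 _))) i p.1
  have hg2 : ∀ t, ContDiff ℝ 2 fun x => g (x, t) := fun t =>
    h.contDiff _ (hsub (clamp_mem hT2 _))
  have hg0 : ∀ x t, 7 / 2 < ‖x‖ → g (x, t) = 0 := fun x t hx => h.supp x _ hx
  have hD : 0 < R ^ 2 + n * R := by positivity
  set ω := ε / (2 * (R ^ 2 + n * R)) with hω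
  have hω0 : 0 < ω := by positivity
  have hωε : 2 * ((R ^ 2 + n * R) * ω) = ε := by rw [hω]; field_simp
  have hω1 : 2 * ω ≤ ε := by
    have : 1 ≤ R ^ 2 + n * R := by
      have : 0 ≤ n * R := by positivity
      nlinarith
    nlinarith
  obtain ⟨δ, hδ, hmod⟩ := exists_uniform_modulus hgc hGc
    ((isCompact_closedBall (0 : EuclideanSpace ℝ (Fin n)) 4).prod
      (isCompact_Icc (a := (0 : ℝ)) (b := T))) hω0
  obtain ⟨r, hr0, hr⟩ := exists_between
    (show (0 : ℝ) < min (δ / 4) (min (T / 16) (1 / 8)) by positivity)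
  rw [lt_min_iff, lt_min_iff] at hr
  obtain ⟨hr1, hr2, hr3⟩ := hr
  let φ : ContDiffBump (0 : EuclideanSpace ℝ (Fin n) × ℝ) := ⟨r / 2, r, by positivity, by linarith⟩
  have hφ : φ.rOut = r := rfl
  set V : EuclideanSpace ℝ (Fin n) → ℝ → ℝ := fun x t => mollify φ g (x, t + 2 * r) with hV
  have hVs : ContDiff ℝ 3 fun p : EuclideanSpace ℝ (Fin n) × ℝ => V p.1 p.2 :=
    (contDiff_mollify hgc).comp (contDiff_fst.prodMk (contDiff_snd.add contDiff_const))
  have hV0 : ∀ x t, 7 / 2 + r < ‖x‖ → V x t = 0 := fun x t hx => mollify_eq_zero hg0 hx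
  have hmem : ∀ x : EuclideanSpace ℝ (Fin n), ‖x‖ ≤ 4 → ∀ t ∈ Icc 0 (T / 4),
      (x, t + 2 * r) ∈ closedBall (0 : EuclideanSpace ℝ (Fin n)) 4 ×ˢ Icc 0 T := fun x hx t ht =>
    ⟨by simpa using hx, by linarith [ht.1], by linarith [ht.2]⟩
  have hVclose : ∀ x, ‖x‖ ≤ 4 → ∀ t ∈ Icc 0 (T / 4), |V x t - g (x, t + 2 * r)| ≤ ω :=
    fun x hx t ht => abs_mollify_sub_le hgc fun q hq =>
      (hmod _ (hmem x hx t ht) q (by rw [hφ] at hq; linarith)).1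
  have hVclose' : ∀ x, ‖x‖ ≤ 4 → ∀ t ∈ Icc 0 (T / 4), ∀ i,
      |pd i (fun y => V y t) x - G i (x, t + 2 * r)| ≤ ω := by
    intro x hx t ht i
    rw [show pd i (fun y => V y t) x = mollify φ (G i) (x, t + 2 * r) from
      pd_mollify hgc (hGc i) (hGb i) i (fun t => (hg2 t).differentiable (by norm_num))
        (fun x t => rfl) x _]
    exact abs_mollify_sub_le (hGc i) fun q hq =>
      (hmod _ (hmem x hx t ht) q (by rw [hφ] at hq; linarith)).2 i
  have hT4 : 1 / (4 * R ^ 2) = T / 4 := by rw [hT]; field_simp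
  refine ⟨V, ⟨hVs, fun x t hx => hV0 x t (by linarith), fun x t _ => abs_mollify_le hgb _,
    fun x t ht => ?_⟩, fun x => ?_⟩
  · rw [hT4] at ht
    have hnn : 0 ≤ if 2 ≤ ‖x‖ then K * R else 0 := by split_ifs <;> positivity
    change _ ≤ gradBound R (V x t) (fun i => pd i (fun y => V y t) x) + _
    by_cases hx : ‖x‖ ≤ 4
    · set p := (x, t + 2 * r) with hp
      have hk : |src V t x| ≤ gradBound R (g p) (fun i => G i p) + (R ^ 2 + n * R) * ω
          + if 2 ≤ ‖x‖ then K * R else 0 := by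
        refine abs_src_mollify_le hgc hgb (fun t _ => hg2 t) fun y hy s hs' => ?_
        rw [hφ] at hy hs'
        have hs2 : s ∈ Ico 0 (T / 2) := ⟨by linarith [hs'.1, ht.1], by linarith [hs'.2, ht.2]⟩
        have hge : ∀ y, g (y, s) = v y s := timeExtend_eq (Ico_subset_Icc_self hs2)
        obtain ⟨d, hd, hdk⟩ := hs y s ⟨hs2.1, by linarith [hs2.2]⟩
        refine ⟨d, hd.congr_of_eventuallyEq ?_ (hge y), ?_⟩
        · filter_upwards [Ico_mem_nhdsGE hs2.2] with τ hτ
          exact timeExtend_eq ⟨hs2.1.trans hτ.1, hτ.2.le⟩ y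
        · have hdist : dist (y, s) p < δ := by
            rw [hp, Prod.dist_eq, max_lt_iff]
            refine ⟨(mem_closedBall.1 hy).trans_lt (by linarith), ?_⟩
            rw [Real.dist_eq, abs_lt]
            constructor <;> linarith [hs'.1, hs'.2]
          have hm := hmod p (hmem x hx t ht) (y, s) hdist
          have hGe : ∀ i, G i (y, s) = pd i (fun y => v y s) y := fun i =>
            timeExtend_eq (v := fun x t => pd i (fun y => v y t) x) (Ico_subset_Icc_self hs2) y
          have hgb := gradBound_le hR0.le hm.1 hm.2
          simp only [hge, hGe] at hgb
          simp only [hge]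
          have hind : (if 5 / 2 ≤ ‖y‖ then K * R else 0) ≤ if 2 ≤ ‖x‖ then K * R else 0 := by
            have hyx : ‖y‖ - ‖x‖ ≤ 2 * r := by
              rw [mem_closedBall, dist_eq_norm] at hy
              exact (norm_sub_norm_le y x).trans hy
            by_cases hy2 : 5 / 2 ≤ ‖y‖
            · rw [if_pos hy2, if_pos (by linarith)]
            · rwa [if_neg hy2]
          linarith
      have h1 : |g p - V x t| ≤ ω := by rw [abs_sub_comm]; exact hVclose x hx t ht
      have h2 : ∀ i, |G i p - pd i (fun y => V y t) x| ≤ ω := fun i => by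
        rw [abs_sub_comm]; exact hVclose' x hx t ht i
      have := gradBound_le hR0.le h1 h2
      linarith
    · push Not at hx
      have h0 : src V t x = 0 := by
        have hx' : x ∉ closedBall (0 : EuclideanSpace ℝ (Fin n)) (7 / 2 + r) := by
          rw [mem_closedBall_zero_iff]; linarith
        rw [src, slap_eq_zero (fun h => hx' (tsupport_slice_subset hV0 t h)),
          deriv_eq_zero_of_norm hV0 t (by linarith), add_zero]
      rw [h0, abs_zero]
      have := gradBound_nonneg hR0.le (V x t) (fun i => pd i (fun y => V y t) x)
      linarith
  · by_cases hx : ‖x‖ ≤ 4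
    · have h0 : (0 : ℝ) ∈ Icc 0 (T / 4) := ⟨le_rfl, by positivity⟩
      have h1 := hVclose x hx 0 h0
      have h2 := (hmod (x, 0) ⟨by simpa using hx, le_rfl, hT0.le⟩ (x, 0 + 2 * r) (by
        rw [Prod.dist_eq, max_lt_iff, dist_self, Real.dist_eq, abs_lt]
        exact ⟨hδ, by linarith, by linarith⟩)).1
      rw [show g (x, 0) = v x 0 from timeExtend_eq ⟨le_rfl, hT2⟩ x] at h2
      have := abs_sub_le (V x 0) (g (x, 0 + 2 * r)) (v x 0)
      linarith
    · push Not at hx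
      rw [hV0 x 0 (by linarith), h.supp x 0 (by linarith), sub_zero, abs_zero]
      exact hε.le

end Approximation

section Limit

variable {n : ℕ}

theorem abs_setIntegral_sq_sub_le {f F : EuclideanSpace ℝ (Fin n) → ℝ} {ε ρ : ℝ}
    (hf : Continuous f) (hF : Continuous F) (hfb : ∀ x, |f x| ≤ 1) (hFb : ∀ x, |F x| ≤ 1)
    (h : ∀ x, |F x - f x| ≤ ε) (hρ : ρ ≤ 1) :
    |(∫ x in ball (0 : EuclideanSpace ℝ (Fin n)) ρ, F x ^ 2) - ∫ x in ball 0 ρ, f x ^ 2| ≤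
      2 * ε * volume.real (ball (0 : EuclideanSpace ℝ (Fin n)) 1) := by
  have hε : 0 ≤ ε := (abs_nonneg _).trans (h 0)
  have hi : ∀ g : EuclideanSpace ℝ (Fin n) → ℝ, Continuous g →
      IntegrableOn (fun x => g x ^ 2) (ball 0 ρ) volume := by
    intro g hg
    have : IntegrableOn (fun x => g x ^ 2) (closedBall 0 ρ) volume :=
      (hg.pow 2).continuousOn.integrableOn_compact (isCompact_closedBall 0 ρ)
    exact this.mono_set ball_subset_closedBall
  rw [← integral_sub (hi F hF) (hi f hf), ← Real.norm_eq_abs]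
  have hvol : volume.real (ball (0 : EuclideanSpace ℝ (Fin n)) ρ) ≤
      volume.real (ball (0 : EuclideanSpace ℝ (Fin n)) 1) :=
    measureReal_mono (ball_subset_ball hρ) measure_ball_lt_top.ne
  refine le_trans (norm_setIntegral_le_of_norm_le_const (C := 2 * ε) measure_ball_lt_top
    fun x _ => ?_) (mul_le_mul_of_nonneg_left hvol (by positivity))
  have h1 : |F x + f x| ≤ 2 := (abs_add_le _ _).trans (by linarith [hfb x, hFb x])
  rw [Real.norm_eq_abs, show F x ^ 2 - f x ^ 2 = (F x + f x) * (F x - f x) by ring, abs_mul]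
  exact mul_le_mul h1 (h x) (abs_nonneg _) zero_le_two

theorem doubling_of_isClassical (n : ℕ) {K θ : ℝ} (hK : 0 ≤ K) (hθ : 0 < θ) :
    ∀ᶠ R : ℝ in Filter.atTop, ∀ (v : EuclideanSpace ℝ (Fin n) → ℝ → ℝ) (L C : ℝ), 0 < L → 0 ≤ C →
      IsClassical v (1 / R ^ 2) L C → (∀ x, ∀ t ∈ Icc 0 (1 / R ^ 2), |v x t| ≤ 1) →
      (∀ x, ∀ t ∈ Ico 0 (1 / R ^ 2), ∃ d, HasDerivWithinAt (v x) d (Ici t) t ∧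
        |slap (fun y => v y t) x + d| ≤ gradBound R (v x t) (fun i => pd i (fun y => v y t) x)
          + if 5 / 2 ≤ ‖x‖ then K * R else 0) →
      θ ^ 2 * (R ^ n)⁻¹ ≤ ∫ x in ball (0 : EuclideanSpace ℝ (Fin n)) 1, v x 0 ^ 2 →
      ∀ r ∈ Ioc (0 : ℝ) (1 / 2),
        ∫ x in ball (0 : EuclideanSpace ℝ (Fin n)) (2 * r), v x 0 ^ 2 ≤
          2 * exp (8 * (n + 1600 * R ^ 2)) *
            ∫ x in ball (0 : EuclideanSpace ℝ (Fin n)) r, v x 0 ^ 2 := by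
  filter_upwards [smooth_doubling n K hθ, Filter.eventually_ge_atTop 1] with R hR hR1
  intro v L C hL hC h hb hs hmass r hr
  have hR0 : 0 < R := by linarith
  obtain ⟨ε₀, hε₀, H⟩ := hR r hr
  set A := 2 * exp (8 * (n + 1600 * R ^ 2)) with hA
  have hA0 : 0 < A := by positivity
  set c := volume.real (ball (0 : EuclideanSpace ℝ (Fin n)) 1) with hc
  have h0T : (0 : ℝ) ∈ Icc 0 (1 / R ^ 2) := ⟨le_rfl, by positivity⟩
  refine le_of_forall_pos_le_add fun η hη => ?_
  have hlim : ∀ B : ℝ, Filter.Tendsto (fun ε : ℝ => 2 * ε * c * B) (nhdsWithin 0 (Ioi 0))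
      (nhds 0) := fun B => by
    have : Continuous fun ε : ℝ => 2 * ε * c * B := by fun_prop
    simpa using (this.tendsto 0).mono_left nhdsWithin_le_nhds
  obtain ⟨ε, ⟨hε1, hε2⟩, hε3⟩ := (((hlim 1).eventually_lt_const
    (show 0 < θ ^ 2 * (R ^ n)⁻¹ / 2 by positivity)).and
    ((hlim (1 + A)).eventually_lt_const hη)).and (Ioo_mem_nhdsGT hε₀) |>.exists
  obtain ⟨V, hV, hVv⟩ := exists_isApproxSol hR1 hK h hL hC hb hs hε3.1
  have hVb : ∀ x, |V x 0| ≤ 1 := fun x => hV.bound x 0 ⟨le_rfl, by positivity⟩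
  have hcomp : ∀ ρ : ℝ, ρ ≤ 1 → _ := fun ρ hρ => abs_setIntegral_sq_sub_le (ρ := ρ)
    (h.contDiff 0 h0T).continuous (hV.smooth.slice_left 0).continuous (fun x => hb x 0 h0T) hVb
    hVv hρ
  have c1 := abs_le.1 (hcomp 1 le_rfl)
  have c2 := abs_le.1 (hcomp (2 * r) (by linarith [hr.2]))
  have c3 := abs_le.1 (hcomp r (by linarith [hr.2]))
  have hd := H ε ⟨hε3.1.le, hε3.2.le⟩ V hV (by linarith [c1.1])
  have := mul_le_mul_of_nonneg_left c3.2 hA0.le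
  linarith [c2.1]

end Limit

section Cutoff

variable {n : ℕ}

theorem exists_cutoff (n : ℕ) : ∃ (χ : EuclideanSpace ℝ (Fin n) → ℝ) (K : ℝ), 0 < K ∧
    ContDiff ℝ 2 χ ∧ (∀ x, χ x ∈ Icc (0 : ℝ) 1) ∧ (∀ x, ‖x‖ ≤ 5 / 2 → χ x = 1) ∧
    (∀ x, 7 / 2 < ‖x‖ → χ x = 0) ∧ (∀ x, ‖gradient χ x‖ ≤ K) ∧ ∀ x, |slap χ x| ≤ K := by
  let χ : ContDiffBump (0 : EuclideanSpace ℝ (Fin n)) := ⟨5 / 2, 7 / 2, by norm_num, by norm_num⟩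
  have hχ : ContDiff ℝ 2 χ := χ.contDiff
  have hs : ∀ x, x ∉ closedBall (0 : EuclideanSpace ℝ (Fin n)) (7 / 2) → x ∉ tsupport χ := by
    intro x hx
    rwa [χ.tsupport_eq]
  have hc1 : Continuous fun x => ‖gradient χ x‖ := by
    simp only [norm_gradient_eq]
    exact Real.continuous_sqrt.comp (continuous_finsetSum _ fun i _ =>
      (contDiff_pd (m := 1) i hχ (by norm_num)).continuous.pow 2)
  obtain ⟨K₁, hK₁⟩ := (isCompact_closedBall (0 : EuclideanSpace ℝ (Fin n)) (7 / 2)).bddAbove_image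
    hc1.continuousOn
  obtain ⟨K₂, hK₂⟩ := (isCompact_closedBall (0 : EuclideanSpace ℝ (Fin n)) (7 / 2)).bddAbove_image
    (continuous_slap hχ).abs.continuousOn
  refine ⟨χ, max 1 (max K₁ K₂), by positivity, hχ, fun x => ⟨χ.nonneg, χ.le_one⟩, fun x hx => ?_,
    fun x hx => ?_, fun x => ?_, fun x => ?_⟩
  · exact χ.one_of_mem_closedBall (by simpa using hx)
  · exact χ.zero_of_le_dist (by simpa using hx.le)
  · by_cases hx : x ∈ closedBall (0 : EuclideanSpace ℝ (Fin n)) (7 / 2)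
    · exact (hK₁ (mem_image_of_mem _ hx)).trans (by simp)
    · have : ‖gradient χ x‖ = 0 := by
        rw [norm_gradient_eq]
        simp [pd_eq_zero _ (hs x hx)]
      rw [this]; positivity
  · by_cases hx : x ∈ closedBall (0 : EuclideanSpace ℝ (Fin n)) (7 / 2)
    · exact (hK₂ (mem_image_of_mem _ hx)).trans (by simp)
    · rw [slap_eq_zero (hs x hx), abs_zero]; positivity

theorem norm_fderiv_eq_gradient (f : EuclideanSpace ℝ (Fin n) → ℝ)
    (x : EuclideanSpace ℝ (Fin n)) : ‖fderiv ℝ f x‖ = ‖gradient f x‖ := by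
  rw [gradient, LinearIsometryEquiv.norm_map]

theorem gradient_mul {f g : EuclideanSpace ℝ (Fin n) → ℝ} {x : EuclideanSpace ℝ (Fin n)}
    (hf : DifferentiableAt ℝ f x) (hg : DifferentiableAt ℝ g x) :
    gradient (fun y => f y * g y) x = f x • gradient g x + g x • gradient f x := by
  simp only [gradient, fderiv_fun_mul hf hg, map_add, map_smul]

theorem sum_pd_mul_pd (f g : EuclideanSpace ℝ (Fin n) → ℝ) (x : EuclideanSpace ℝ (Fin n)) :
    |∑ i, pd i f x * pd i g x| ≤ ‖gradient f x‖ * ‖gradient g x‖ := by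
  have h : ∀ (f : EuclideanSpace ℝ (Fin n) → ℝ) i, gradient f x i = pd i f x := by
    intro f i
    have := EuclideanSpace.inner_single_right (𝕜 := ℝ) i 1 (gradient f x)
    rw [one_mul, inner_gradient_left] at this
    simpa [pd] using this.symm
  have := abs_real_inner_le_norm (gradient f x) (gradient g x)
  rw [PiLp.inner_apply] at this
  simpa [h, mul_comm] using this

end Cutoff

section Localize

variable {n : ℕ}

theorem mul_cutoff_eventuallyEq_zero {χ f : EuclideanSpace ℝ (Fin n) → ℝ}
    (hχ0 : ∀ x, 7 / 2 < ‖x‖ → χ x = 0) {x : EuclideanSpace ℝ (Fin n)} (hx : 4 ≤ ‖x‖) :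
    (fun y => χ y * f y) =ᶠ[nhds x] fun _ => 0 := by
  filter_upwards [(isOpen_lt continuous_const continuous_norm).mem_nhds
    (show 7 / 2 < ‖x‖ by linarith)] with y hy
  rw [hχ0 y hy, zero_mul]

theorem contDiff_mul_cutoff {χ f : EuclideanSpace ℝ (Fin n) → ℝ} (hχ : ContDiff ℝ 2 χ)
    (hχ0 : ∀ x, 7 / 2 < ‖x‖ → χ x = 0)
    (hf : ContDiffOn ℝ 2 f (ball (0 : EuclideanSpace ℝ (Fin n)) 4)) :
    ContDiff ℝ 2 fun x => χ x * f x := by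
  refine contDiff_iff_contDiffAt.2 fun x => ?_
  by_cases hx : ‖x‖ < 4
  · exact hχ.contDiffAt.mul (hf.contDiffAt (isOpen_ball.mem_nhds (by simpa using hx)))
  · exact contDiffAt_const.congr_of_eventuallyEq
      (mul_cutoff_eventuallyEq_zero hχ0 (not_lt.1 hx))

theorem norm_gradient_mul_cutoff_le {χ f : EuclideanSpace ℝ (Fin n) → ℝ} {K R : ℝ} (hK : 0 ≤ K)
    (hR : 0 ≤ R) (hχ : ContDiff ℝ 2 χ) (hχ1 : ∀ x, χ x ∈ Icc (0 : ℝ) 1)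
    (hχ0 : ∀ x, 7 / 2 < ‖x‖ → χ x = 0) (hχK : ∀ x, ‖gradient χ x‖ ≤ K)
    (hf : ContDiffOn ℝ 2 f (ball (0 : EuclideanSpace ℝ (Fin n)) 4))
    (hfb : ∀ x ∈ ball (0 : EuclideanSpace ℝ (Fin n)) 4, |f x| ≤ 1)
    (hfR : ∀ x ∈ ball (0 : EuclideanSpace ℝ (Fin n)) 4, ‖gradient f x‖ ≤ R)
    (x : EuclideanSpace ℝ (Fin n)) : ‖gradient (fun y => χ y * f y) x‖ ≤ R + K := by
  by_cases hx : ‖x‖ < 4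
  · have hx' : x ∈ ball (0 : EuclideanSpace ℝ (Fin n)) 4 := by simpa using hx
    rw [gradient_mul (hχ.differentiable (by norm_num) x)
      ((hf.contDiffAt (isOpen_ball.mem_nhds hx')).differentiableAt (by norm_num))]
    refine (norm_add_le _ _).trans ?_
    rw [norm_smul, norm_smul, Real.norm_of_nonneg (hχ1 x).1, Real.norm_eq_abs]
    have h1 := mul_le_mul (hχ1 x).2 (hfR x hx') (norm_nonneg _) zero_le_one
    have h2 := mul_le_mul (hfb x hx') (hχK x) (norm_nonneg _) zero_le_one
    linarith
  · rw [← norm_fderiv_eq_gradient,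
      (mul_cutoff_eventuallyEq_zero hχ0 (not_lt.1 hx)).fderiv_eq]
    simp only [fderiv_fun_const, Pi.zero_apply, norm_zero]
    positivity

theorem abs_slap_mul_cutoff_add_le {χ f : EuclideanSpace ℝ (Fin n) → ℝ} {K R d : ℝ} (hK : 0 ≤ K)
    (hR : 1 ≤ R) (hχ : ContDiff ℝ 2 χ) (hχ1 : ∀ x, χ x ∈ Icc (0 : ℝ) 1)
    (hχe : ∀ x, ‖x‖ ≤ 5 / 2 → χ x = 1) (hχK : ∀ x, ‖gradient χ x‖ ≤ K)
    (hχK' : ∀ x, |slap χ x| ≤ K) {x : EuclideanSpace ℝ (Fin n)}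
    (hf : ContDiffAt ℝ 2 f x) (hfb : |f x| ≤ 1) (hfR : ‖gradient f x‖ ≤ R)
    (hd : |slap f x + d| ≤ R ^ 2 * |f x| + R * ‖gradient f x‖) :
    |slap (fun y => χ y * f y) x + χ x * d| ≤
      gradBound R (χ x * f x) (fun i => pd i (fun y => χ y * f y) x) +
        if 5 / 2 ≤ ‖x‖ then 4 * K * R else 0 := by
  have hfd : DifferentiableAt ℝ f x := hf.differentiableAt (by norm_num)
  simp only [gradBound, ← norm_gradient_eq]
  split_ifs with hx
  · rw [slap_mul hχ.contDiffAt hf]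
    have e : slap χ x * f x + 2 * ∑ i, pd i χ x * pd i f x + χ x * slap f x + χ x * d =
        χ x * (slap f x + d) + (slap χ x * f x + 2 * ∑ i, pd i χ x * pd i f x) := by ring
    have h0 := (hχ1 x).1
    have h1 : |χ x * (slap f x + d)| ≤ χ x * (R ^ 2 * |f x| + R * ‖gradient f x‖) := by
      rw [abs_mul, abs_of_nonneg h0]
      exact mul_le_mul_of_nonneg_left hd h0
    have h2 : |slap χ x * f x| ≤ K * 1 := by
      rw [abs_mul]
      exact mul_le_mul (hχK' x) hfb (abs_nonneg _) hK
    have h3 : |2 * ∑ i, pd i χ x * pd i f x| ≤ 2 * (K * R) := by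
      rw [abs_mul, abs_two]
      gcongr
      exact (sum_pd_mul_pd χ f x).trans (mul_le_mul (hχK x) hfR (norm_nonneg _) hK)
    have h4 : χ x * ‖gradient f x‖ ≤ ‖gradient (fun y => χ y * f y) x‖ + K := by
      have e : χ x • gradient f x = gradient (fun y => χ y * f y) x - f x • gradient χ x := by
        rw [gradient_mul (hχ.differentiable (by norm_num) x) hfd, add_sub_cancel_right]
      have h := norm_sub_le (gradient (fun y => χ y * f y) x) (f x • gradient χ x)
      rw [← e, norm_smul, norm_smul, Real.norm_of_nonneg h0, Real.norm_eq_abs] at h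
      have := mul_le_mul hfb (hχK x) (norm_nonneg _) zero_le_one
      linarith
    have h5 := mul_le_mul_of_nonneg_left h4 (zero_le_one.trans hR)
    have h6 : K ≤ K * R := le_mul_of_one_le_right hK hR
    rw [e, abs_mul (χ x) (f x), abs_of_nonneg h0]
    have h7 := abs_add_le (χ x * (slap f x + d)) (slap χ x * f x + 2 * ∑ i, pd i χ x * pd i f x)
    have h8 := abs_add_le (slap χ x * f x) (2 * ∑ i, pd i χ x * pd i f x)
    linarith
  · have hev : (fun y => χ y * f y) =ᶠ[nhds x] f := by
      filter_upwards [(isOpen_lt continuous_norm continuous_const).mem_nhds (not_le.1 hx)] with y hy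
      rw [hχe y (le_of_lt hy), one_mul]
    have hs : slap (fun y => χ y * f y) x = slap f x := by
      simp only [slap_eq_sum_pd]
      exact Finset.sum_congr rfl fun i _ => pd_congr_of_eventuallyEq i
        (hev.eventuallyEq_nhds.mono fun y hy => pd_congr_of_eventuallyEq i hy)
    have hg : gradient (fun y => χ y * f y) x = gradient f x := by
      simp only [gradient, hev.fderiv_eq]
    rw [hs, hg, hχe x (not_le.1 hx).le, one_mul, one_mul, add_zero]
    exact hd

end Localize

section Doubling

variable {n : ℕ}

theorem exists_isClassical_cutoff {χ : EuclideanSpace ℝ (Fin n) → ℝ}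
    {u : EuclideanSpace ℝ (Fin n) → ℝ → ℝ} {K R : ℝ} (hK : 0 < K) (hR : 1 ≤ R)
    (hχ : ContDiff ℝ 2 χ) (hχ1 : ∀ x, χ x ∈ Icc (0 : ℝ) 1) (hχe : ∀ x, ‖x‖ ≤ 5 / 2 → χ x = 1)
    (hχ0 : ∀ x, 7 / 2 < ‖x‖ → χ x = 0) (hχK : ∀ x, ‖gradient χ x‖ ≤ K)
    (hχK' : ∀ x, |slap χ x| ≤ K)
    (hux : ∀ t ∈ Icc (0 : ℝ) (1 / R ^ 2),
      ContDiffOn ℝ 2 (fun x => u x t) (ball (0 : EuclideanSpace ℝ (Fin n)) 4))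
    (hut : ∀ x ∈ ball (0 : EuclideanSpace ℝ (Fin n)) 4,
      ContDiffOn ℝ 1 (u x) (Icc (0 : ℝ) (1 / R ^ 2)))
    (hu : ∀ x ∈ ball (0 : EuclideanSpace ℝ (Fin n)) 4, ∀ t ∈ Icc (0 : ℝ) (1 / R ^ 2),
      |slap (fun y => u y t) x + derivWithin (u x) (Icc (0 : ℝ) (1 / R ^ 2)) t| ≤
        R ^ 2 * |u x t| + R * ‖gradient (fun y => u y t) x‖)
    (hub : ∀ x ∈ ball (0 : EuclideanSpace ℝ (Fin n)) 4, ∀ t ∈ Icc (0 : ℝ) (1 / R ^ 2),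
      |u x t| ≤ 1)
    (huR : ∀ x ∈ ball (0 : EuclideanSpace ℝ (Fin n)) 4, ∀ t ∈ Icc (0 : ℝ) (1 / R ^ 2),
      ‖gradient (fun y => u y t) x‖ ≤ R) :
    ∃ L C, 0 < L ∧ 0 ≤ C ∧ IsClassical (fun x t => χ x * u x t) (1 / R ^ 2) L C ∧
      (∀ x, ∀ t ∈ Icc 0 (1 / R ^ 2), |χ x * u x t| ≤ 1) ∧
      ∀ x, ∀ t ∈ Ico 0 (1 / R ^ 2), ∃ d, HasDerivWithinAt (fun s => χ x * u x s) d (Ici t) t ∧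
        |slap (fun y => χ y * u y t) x + d| ≤
          gradBound R (χ x * u x t) (fun i => pd i (fun y => χ y * u y t) x)
            + if 5 / 2 ≤ ‖x‖ then 4 * K * R else 0 := by
  have hR0 : 0 < R := by linarith
  have hvb : ∀ x, ∀ t ∈ Icc 0 (1 / R ^ 2), |χ x * u x t| ≤ 1 := by
    intro x t ht
    by_cases hx : ‖x‖ < 4
    · rw [abs_mul, abs_of_nonneg (hχ1 x).1]
      exact mul_le_one₀ (hχ1 x).2 (abs_nonneg _) (hub x (by simpa using hx) t ht)
    · rw [hχ0 x (by linarith [not_lt.1 hx])]; simp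
  have hgrad : ∀ t ∈ Icc (0 : ℝ) (1 / R ^ 2), ∀ x,
      ‖gradient (fun y => χ y * u y t) x‖ ≤ R + K := fun t ht =>
    norm_gradient_mul_cutoff_le hK.le hR0.le hχ hχ1 hχ0 hχK (hux t ht)
      (fun x hx => hub x hx t ht) fun x hx => huR x hx t ht
  have hcd : ∀ t ∈ Icc (0 : ℝ) (1 / R ^ 2), ContDiff ℝ 2 fun x => χ x * u x t := fun t ht =>
    contDiff_mul_cutoff hχ hχ0 (hux t ht)
  have hlip : ∀ t ∈ Icc (0 : ℝ) (1 / R ^ 2), ∀ x y,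
      |χ x * u x t - χ y * u y t| ≤ (R + K) * ‖x - y‖ := by
    intro t ht x y
    exact convex_univ.norm_image_sub_le_of_norm_fderiv_le (𝕜 := ℝ)
      (f := fun x => χ x * u x t)
      (fun x _ => (hcd t ht).differentiable (by norm_num) x)
      (fun x _ => (norm_fderiv_eq_gradient _ x).trans_le (hgrad t ht x))
      (mem_univ y) (mem_univ x)
  have htime : ∀ x, ∀ t ∈ Ico 0 (1 / R ^ 2),
      ∃ d, HasDerivWithinAt (fun s => χ x * u x s) d (Ici t) t ∧
        |slap (fun y => χ y * u y t) x + d| ≤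
          gradBound R (χ x * u x t) (fun i => pd i (fun y => χ y * u y t) x)
            + if 5 / 2 ≤ ‖x‖ then 4 * K * R else 0 := by
    intro x t ht
    have ht' := Ico_subset_Icc_self ht
    by_cases hx : ‖x‖ < 4
    · have hx' : x ∈ ball (0 : EuclideanSpace ℝ (Fin n)) 4 := by simpa using hx
      have hd : HasDerivWithinAt (u x) (derivWithin (u x) (Icc (0 : ℝ) (1 / R ^ 2)) t)
          (Icc (0 : ℝ) (1 / R ^ 2)) t :=
        ((hut x hx').differentiableOn (by norm_num) t ht').hasDerivWithinAt
      refine ⟨_, (hd.mono_of_mem_nhdsWithin (Icc_mem_nhdsGE_of_mem ht)).const_mul (χ x), ?_⟩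
      exact abs_slap_mul_cutoff_add_le hK.le hR hχ hχ1 hχe hχK hχK'
        ((hux t ht').contDiffAt (isOpen_ball.mem_nhds hx')) (hub x hx' t ht') (huR x hx' t ht')
        (hu x hx' t ht')
    · have h4 := not_lt.1 hx
      refine ⟨0, ?_, ?_⟩
      · simp only [hχ0 x (by linarith), zero_mul]
        exact hasDerivWithinAt_const _ _ _
      · rw [slap_eq_zero (notMem_tsupport_iff_eventuallyEq.2
          (mul_cutoff_eventuallyEq_zero hχ0 h4)), add_zero, abs_zero]
        have := gradBound_nonneg hR0.le (χ x * u x t) fun i => pd i (fun y => χ y * u y t) x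
        split_ifs <;> positivity
  refine ⟨R + K, R ^ 2 + R * (R + K) + 4 * K * R, by positivity, by positivity,
    ⟨hcd, fun x t hx => by rw [hχ0 x hx, zero_mul], ?_, hlip, ?_⟩, hvb, htime⟩
  · refine continuousOn_prod_of_continuousOn_lipschitzOnWith _ (R + K).toNNReal ?_ ?_
    · intro x _
      by_cases hx : ‖x‖ < 4
      · exact (hut x (by simpa using hx)).continuousOn.const_smul (χ x)
      · simp only [hχ0 x (by linarith [not_lt.1 hx]), zero_mul]
        exact continuousOn_const
    · intro t ht
      refine LipschitzOnWith.of_dist_le_mul fun x _ y _ => ?_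
      rw [Real.coe_toNNReal _ (by positivity), dist_eq_norm, dist_eq_norm]
      exact hlip t ht x y
  · intro x t ht
    obtain ⟨d, hd, h⟩ := htime x t ht
    refine ⟨d, hd, h.trans ?_⟩
    have ht' := Ico_subset_Icc_self ht
    have h1 := hgrad t ht' x
    rw [norm_gradient_eq] at h1
    have h2 : gradBound R (χ x * u x t) (fun i => pd i (fun y => χ y * u y t) x) ≤
        R ^ 2 * 1 + R * (R + K) := by
      unfold gradBound
      gcongr
      exact hvb x t ht'
    have h3 : (if 5 / 2 ≤ ‖x‖ then 4 * K * R else 0) ≤ 4 * K * R := by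
      split_ifs
      · exact le_rfl
      · positivity
    linarith

end Doubling

/-- if `θ ∈ (0,1]` and `u` is `C^{2,1}` on `B₄ × [0,1/R²]` with
`|Δu + ∂ₜu| ≤ R²|u| + R|∇u|`, `‖u‖_∞ ≤ 1`, `‖∇u‖_∞ ≤ R` and
`‖u(·,0)‖_{L²(B₁)} ≥ θ R^{-n/2}`, then there is `N = N(n,θ)` such that the doubling
inequality `∫_{B_{2r}} u(x,0)² dx ≤ e^{N R²} ∫_{B_r} u(x,0)² dx` holds for
`0 < r ≤ 1/2` and `R ≥ N`. -/
theorem stmt_16 (n : ℕ) : ∀ θ : ℝ, θ ∈ Ioc (0 : ℝ) 1 →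
    ∃ N > (0 : ℝ), ∀ R : ℝ, 0 < R →
    ∀ u : EuclideanSpace ℝ (Fin n) → ℝ → ℝ,
    (∀ t ∈ Icc (0 : ℝ) (1 / R ^ 2),
      ContDiffOn ℝ 2 (fun x => u x t) (ball (0 : EuclideanSpace ℝ (Fin n)) 4)) →
    (∀ x ∈ ball (0 : EuclideanSpace ℝ (Fin n)) 4,
      ContDiffOn ℝ 1 (u x) (Icc (0 : ℝ) (1 / R ^ 2))) →
    (∀ x ∈ ball (0 : EuclideanSpace ℝ (Fin n)) 4, ∀ t ∈ Icc (0 : ℝ) (1 / R ^ 2),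
      |slap (fun y => u y t) x + derivWithin (u x) (Icc (0 : ℝ) (1 / R ^ 2)) t| ≤
        R ^ 2 * |u x t| + R * ‖gradient (fun y => u y t) x‖) →
    (∀ x ∈ ball (0 : EuclideanSpace ℝ (Fin n)) 4, ∀ t ∈ Icc (0 : ℝ) (1 / R ^ 2),
      |u x t| ≤ 1) →
    (∀ x ∈ ball (0 : EuclideanSpace ℝ (Fin n)) 4, ∀ t ∈ Icc (0 : ℝ) (1 / R ^ 2),
      ‖gradient (fun y => u y t) x‖ ≤ R) →
    Real.sqrt (∫ x in ball (0 : EuclideanSpace ℝ (Fin n)) 1, u x 0 ^ 2) ≥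
      θ * R ^ (-(n : ℝ) / 2) →
    ∀ r : ℝ, 0 < r → r ≤ 1 / 2 → R ≥ N →
      (∫ x in ball (0 : EuclideanSpace ℝ (Fin n)) (2 * r), u x 0 ^ 2) ≤
        Real.exp (N * R ^ 2) * ∫ x in ball (0 : EuclideanSpace ℝ (Fin n)) r, u x 0 ^ 2 := by
  intro θ hθ
  obtain ⟨χ, K, hK, hχ, hχ1, hχe, hχ0, hχK, hχK'⟩ := exists_cutoff n
  obtain ⟨R₀, hR₀⟩ := Filter.eventually_atTop.1
    (doubling_of_isClassical n (K := 4 * K) (by positivity) hθ.1)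
  refine ⟨max R₀ (8 * n + 12801), lt_max_of_lt_right (by positivity), ?_⟩
  intro R hR u hux hut hu hub huR hmass r hr hr2 hRN
  set N : ℝ := max R₀ (8 * n + 12801)
  have hN : (8 * n + 12801 : ℝ) ≤ N := le_max_right _ _
  have hn : (0 : ℝ) ≤ n := n.cast_nonneg
  have hR1 : 1 ≤ R := by linarith
  obtain ⟨L, C, hL, hC, hv, hvb, hvs⟩ :=
    exists_isClassical_cutoff hK hR1 hχ hχ1 hχe hχ0 hχK hχK' hux hut hu hub huR
  have heq : ∀ ρ : ℝ, ρ ≤ 1 → ∫ x in ball (0 : EuclideanSpace ℝ (Fin n)) ρ, (χ x * u x 0) ^ 2 =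
      ∫ x in ball (0 : EuclideanSpace ℝ (Fin n)) ρ, u x 0 ^ 2 := by
    intro ρ hρ
    refine setIntegral_congr_fun measurableSet_ball fun x hx => ?_
    have hx' : ‖x‖ < ρ := by simpa using hx
    simp only [hχe x (by linarith), one_mul]
  have hnn : ∀ ρ : ℝ, 0 ≤ ∫ x in ball (0 : EuclideanSpace ℝ (Fin n)) ρ, u x 0 ^ 2 := fun ρ =>
    integral_nonneg fun x => sq_nonneg _
  have hm : θ ^ 2 * (R ^ n)⁻¹ ≤ ∫ x in ball (0 : EuclideanSpace ℝ (Fin n)) 1, u x 0 ^ 2 := by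
    have h1 := (Real.le_sqrt' (mul_pos hθ.1 (rpow_pos_of_pos hR _))).1 hmass
    have h2 : (R ^ (-(n : ℝ) / 2)) ^ 2 = (R ^ n)⁻¹ := by
      rw [← rpow_natCast, ← rpow_mul hR.le, ← rpow_natCast, ← rpow_neg hR.le]
      congr 1
      push_cast
      ring
    rwa [mul_pow, h2] at h1
  have hd := hR₀ R ((le_max_left _ _).trans hRN) (fun x t => χ x * u x t) L C hL hC hv hvb hvs
    (by rwa [heq 1 le_rfl]) r ⟨hr, hr2⟩
  rw [heq (2 * r) (by linarith), heq r (by linarith)] at hd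
  refine hd.trans (mul_le_mul_of_nonneg_right ?_ (hnn r))
  have hR2 : 1 ≤ R ^ 2 := one_le_pow₀ hR1
  have h2 : (2 : ℝ) ≤ exp 1 := by linarith [add_one_le_exp (1 : ℝ)]
  calc 2 * exp (8 * (n + 1600 * R ^ 2)) ≤ exp 1 * exp (8 * (n + 1600 * R ^ 2)) := by gcongr
    _ = exp (1 + 8 * (n + 1600 * R ^ 2)) := (exp_add _ _).symm
    _ ≤ exp (N * R ^ 2) := exp_le_exp.2 (by
      nlinarith [mul_le_mul_of_nonneg_right hN (sq_nonneg R), mul_le_mul_of_nonneg_left hR2 hn])
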